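/- arXiv:math/0410212 — 2 statements merged into one kernel-verified Lean document; each statement's English description precedes it below -/
import Mathlib

section
/- For every k ≥ 2 there exists a Fatou–Bieberbach domain Ω in ℂ^k such that there is no holomorphic automorphism F of ℂ^k and no point p ∈ ℂ^k with Ω = {z ∈ ℂ^k : F^{∘n}(z) → p as n → ∞}, i.e. Ω is not the basin of attraction of any single automorphism of ℂ^k. -/
open Metric Set Filter

noncomputable section

/-- A Fatou–Bieberbach domain in `ℂ^k`: an open set `Ω ≠ ℂ^k` which is the range of an
injective entire map `ℂ^k → ℂ^k`. -/
def IsFBDomain {k : ℕ} (Ω : Set (EuclideanSpace ℂ (Fin k))) : Prop :=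
  IsOpen Ω ∧ Ω ≠ Set.univ ∧
    ∃ F : EuclideanSpace ℂ (Fin k) → EuclideanSpace ℂ (Fin k),
      Differentiable ℂ F ∧ Function.Injective F ∧ Set.range F = Ω

/-- A holomorphic automorphism of `ℂ^k`: a holomorphic bijection with holomorphic inverse. -/
def IsAutomorphism {k : ℕ} (F : EuclideanSpace ℂ (Fin k) → EuclideanSpace ℂ (Fin k)) : Prop :=
  Differentiable ℂ F ∧ ∃ G : EuclideanSpace ℂ (Fin k) → EuclideanSpace ℂ (Fin k),
    Differentiable ℂ G ∧ Function.LeftInverse G F ∧ Function.RightInverse G F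

/-! ### Rigidity: automorphisms of `ℂ^k` preserving the unit polydisc -/

namespace FBaux

open Topology

/-- Cartan type uniqueness on the polydisc. -/
lemma cartan_polydisc {k : ℕ} (K : (Fin k → ℂ) → (Fin k → ℂ))
    (hd : DifferentiableOn ℂ K (ball 0 1)) (hm : MapsTo K (ball 0 1) (ball 0 1))
    (h0 : K 0 = 0) (hder : HasFDerivAt K (ContinuousLinearMap.id ℂ (Fin k → ℂ)) 0) :
    ∀ z ∈ ball (0 : Fin k → ℂ) 1, K z = z := by
  -- first: the claim in the i-th coordinate when this coordinate is dominant
  have key : ∀ w ∈ ball (0 : Fin k → ℂ) 1, ∀ i, w i ≠ 0 → ‖w‖ = ‖w i‖ → K w i = w i := by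
    intro w hw i hwi hni
    have hw1 : ‖w‖ < 1 := by simpa using hw
    have hpos : 0 < ‖w‖ := by rw [hni]; exact norm_pos_iff.2 hwi
    set f : ℂ → ℂ := fun l => K (l • w) i with hf
    have hmem : ∀ l ∈ ball (0 : ℂ) (1 / ‖w‖), l • w ∈ ball (0 : Fin k → ℂ) 1 := by
      intro l hl
      have : ‖l‖ < 1 / ‖w‖ := by simpa using hl
      rw [lt_div_iff₀ hpos] at this
      simpa [norm_smul] using this
    have hfd : DifferentiableOn ℂ f (ball 0 (1 / ‖w‖)) := by
      have : DifferentiableOn ℂ (fun l : ℂ => K (l • w)) (ball 0 (1 / ‖w‖)) :=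
        hd.comp (by fun_prop) hmem
      exact differentiableOn_pi.1 this i
    have hf0 : f 0 = 0 := by simp [hf, h0]
    have hfm : MapsTo f (ball 0 (1 / ‖w‖)) (closedBall (f 0) 1) := by
      intro l hl
      have h := hm (hmem l hl)
      have h' : ‖K (l • w)‖ < 1 := by simpa using h
      rw [hf0]
      simpa [hf] using (norm_le_pi_norm _ i).trans h'.le
    have hder' : HasDerivAt f (w i) 0 := by
      have hder2 : HasFDerivAt K (ContinuousLinearMap.id ℂ (Fin k → ℂ)) ((0 : ℂ) • w) := by
        simpa using hder
      have h1 : HasDerivAt (fun l : ℂ => l • w) ((1 : ℂ) • w) 0 :=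
        (hasDerivAt_id (0 : ℂ)).smul_const w
      have h2 := hder2.comp_hasDerivAt (0 : ℂ) h1
      have h3 := (hasDerivAt_pi.1 h2) i
      simpa using h3
    have h00 : (0 : ℂ) ∈ ball (0 : ℂ) (1 / ‖w‖) := by simp [hpos]
    have hds : dslope f 0 0 = w i := by rw [dslope_same]; exact hder'.deriv
    have := Complex.affine_of_mapsTo_ball_of_norm_dslope_eq_div hfd hfm h00
      (by rw [hds, hni]; simp)
    have h1 : (1 : ℂ) ∈ ball (0 : ℂ) (1 / ‖w‖) := by
      simp [one_lt_inv₀ hpos, hw1]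
    have := this h1
    rw [hds, hf0] at this
    simpa [hf] using this
  intro z hz
  have hz1 : ‖z‖ < 1 := by simpa using hz
  funext i
  -- vary the i-th coordinate
  set g : ℂ → ℂ := fun ζ => K (Function.update z i ζ) i with hg
  have hupd : ∀ ζ ∈ ball (0 : ℂ) 1, Function.update z i ζ ∈ ball (0 : Fin k → ℂ) 1 := by
    intro ζ hζ
    have hζ' : ‖ζ‖ < 1 := by simpa using hζ
    rw [mem_ball_zero_iff, pi_norm_lt_iff one_pos]
    intro j
    by_cases hj : j = i
    · subst hj; simpa using hζ'
    · rw [Function.update_of_ne hj]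
      exact (norm_le_pi_norm z j).trans_lt hz1
  have hgd : DifferentiableOn ℂ g (ball 0 1) := by
    have : DifferentiableOn ℂ (fun ζ : ℂ => K (Function.update z i ζ)) (ball 0 1) := by
      refine hd.comp ?_ hupd
      refine Differentiable.differentiableOn ?_
      rw [differentiable_pi]
      intro j
      by_cases hj : j = i
      · subst hj; simp
      · simp [Function.update_of_ne hj]
    exact differentiableOn_pi.1 this i
  have hga : AnalyticOnNhd ℂ g (ball 0 1) := hgd.analyticOnNhd isOpen_ball
  set s : ℝ := (‖z‖ + 1) / 2 with hs
  have hs0 : 0 < s := by have := norm_nonneg z; positivity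
  have hs1 : s < 1 := by linarith
  have hzs : ‖z‖ < s := by linarith
  have hsn : ‖(s : ℂ)‖ = s := by simp [abs_of_pos hs0]
  have hsm : (s : ℂ) ∈ ball (0 : ℂ) 1 := by rw [mem_ball_zero_iff, hsn]; exact hs1
  have hev : g =ᶠ[𝓝 (s : ℂ)] fun ζ => ζ := by
    have ho : IsOpen {ζ : ℂ | ‖z‖ < ‖ζ‖ ∧ ‖ζ‖ < 1} :=
      (isOpen_lt continuous_const continuous_norm).inter
        (isOpen_lt continuous_norm continuous_const)
    have hsm' : (s : ℂ) ∈ {ζ : ℂ | ‖z‖ < ‖ζ‖ ∧ ‖ζ‖ < 1} := by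
      exact ⟨by rw [hsn]; exact hzs, by rw [hsn]; exact hs1⟩
    filter_upwards [ho.mem_nhds hsm'] with ζ hζ
    have h1 := key (Function.update z i ζ) (hupd ζ (by simpa using hζ.2)) i
    simp only [Function.update_self] at h1
    refine h1 ?_ ?_
    · intro h; rw [h] at hζ; have := hζ.1; simp at this; exact absurd this (not_lt.2 (norm_nonneg z))
    · apply le_antisymm
      · rw [pi_norm_le_iff_of_nonneg (norm_nonneg _)]
        intro j
        by_cases hj : j = i
        · subst hj; simp
        · rw [Function.update_of_ne hj]
          exact (norm_le_pi_norm z j).trans hζ.1.le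
      · simpa using norm_le_pi_norm (Function.update z i ζ) i
  have := hga.eqOn_of_preconnected_of_eventuallyEq (g := fun ζ => ζ)
    (fun x _ => analyticAt_id) (convex_ball (0 : ℂ) 1).isPreconnected hsm hev
  have h2 := this (x := z i) (by simpa using (norm_le_pi_norm z i).trans_lt hz1)
  simpa [hg] using h2

/-- Möbius estimate in the disc. -/
lemma moebius_lt {a z : ℂ} (ha : ‖a‖ < 1) (hz : ‖z‖ < 1) :
    1 + (starRingEnd ℂ) a * z ≠ 0 ∧ ‖(z + a) / (1 + (starRingEnd ℂ) a * z)‖ < 1 := by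
  have hne : 1 + (starRingEnd ℂ) a * z ≠ 0 := by
    intro h
    have h1 : (starRingEnd ℂ) a * z = -1 := by linear_combination h
    have h2 : ‖a‖ * ‖z‖ = 1 := by
      have := congrArg norm h1
      simpa using this
    nlinarith [norm_nonneg a, norm_nonneg z]
  refine ⟨hne, ?_⟩
  rw [norm_div, div_lt_one (norm_pos_iff.2 hne)]
  apply lt_of_pow_lt_pow_left₀ 2 (norm_nonneg _)
  have e1 : ‖z + a‖ ^ 2 = Complex.normSq (z + a) := by rw [Complex.normSq_eq_norm_sq]
  have e2 : ‖1 + (starRingEnd ℂ) a * z‖ ^ 2 = Complex.normSq (1 + (starRingEnd ℂ) a * z) := by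
    rw [Complex.normSq_eq_norm_sq]
  have ha2 : Complex.normSq a < 1 := by
    rw [Complex.normSq_eq_norm_sq]; nlinarith [norm_nonneg a]
  have hz2 : Complex.normSq z < 1 := by
    rw [Complex.normSq_eq_norm_sq]; nlinarith [norm_nonneg z]
  rw [e1, e2]
  simp only [Complex.normSq_apply, Complex.add_re, Complex.add_im, Complex.mul_re, Complex.mul_im,
    Complex.one_re, Complex.one_im, Complex.conj_re, Complex.conj_im] at *
  nlinarith [mul_pos (sub_pos.2 ha2) (sub_pos.2 hz2)]

/-- The polydisc Möbius map. -/
def mob {k : ℕ} (b : Fin k → ℂ) (z : Fin k → ℂ) : Fin k → ℂ :=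
  fun i => (z i + b i) / (1 + (starRingEnd ℂ) (b i) * z i)

lemma mob_mem {k : ℕ} {b : Fin k → ℂ} (hb : b ∈ ball (0 : Fin k → ℂ) 1) {z : Fin k → ℂ}
    (hz : z ∈ ball (0 : Fin k → ℂ) 1) : mob b z ∈ ball (0 : Fin k → ℂ) 1 := by
  have hb1 : ‖b‖ < 1 := by simpa using hb
  have hz1 : ‖z‖ < 1 := by simpa using hz
  rw [mem_ball_zero_iff, pi_norm_lt_iff one_pos]
  intro i
  exact (moebius_lt ((norm_le_pi_norm b i).trans_lt hb1) ((norm_le_pi_norm z i).trans_lt hz1)).2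

lemma mob_diff {k : ℕ} {b : Fin k → ℂ} (hb : b ∈ ball (0 : Fin k → ℂ) 1) :
    DifferentiableOn ℂ (mob b) (ball (0 : Fin k → ℂ) 1) := by
  have hb1 : ‖b‖ < 1 := by simpa using hb
  rw [differentiableOn_pi]
  intro i
  have h1 : DifferentiableOn ℂ (fun z : Fin k → ℂ => z i + b i) (ball 0 1) := by fun_prop
  have h2 : DifferentiableOn ℂ (fun z : Fin k → ℂ => 1 + (starRingEnd ℂ) (b i) * z i)
    (ball 0 1) := by fun_prop
  suffices h : ∀ z ∈ ball (0 : Fin k → ℂ) 1, 1 + (starRingEnd ℂ) (b i) * z i ≠ 0 by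
    have h3 := h1.mul (h2.inv h)
    exact h3.congr fun z _ => by simp [mob, div_eq_mul_inv]
  intro z hz
  have hz1 : ‖z‖ < 1 := by simpa using hz
  exact (moebius_lt ((norm_le_pi_norm b i).trans_lt hb1) ((norm_le_pi_norm z i).trans_lt hz1)).1

lemma mob_neg_mob {k : ℕ} {b : Fin k → ℂ} (hb : b ∈ ball (0 : Fin k → ℂ) 1) {z : Fin k → ℂ}
    (hz : z ∈ ball (0 : Fin k → ℂ) 1) : mob (-b) (mob b z) = z := by
  have hb1 : ‖b‖ < 1 := by simpa using hb
  have hz1 : ‖z‖ < 1 := by simpa using hz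
  funext i
  have hbi := (norm_le_pi_norm b i).trans_lt hb1
  have h1 := (moebius_lt hbi ((norm_le_pi_norm z i).trans_lt hz1)).1
  have h2 := (moebius_lt hbi (z := -(b i)) (by simpa using hbi)).1
  have h2' : 1 - (starRingEnd ℂ) (b i) * b i ≠ 0 := by
    intro h; apply h2; linear_combination h
  have h3 : 1 + (starRingEnd ℂ) (-(b i)) * ((z i + b i) / (1 + (starRingEnd ℂ) (b i) * z i)) ≠ 0 := by
    have : 1 + (starRingEnd ℂ) (-(b i)) * ((z i + b i) / (1 + (starRingEnd ℂ) (b i) * z i))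
      = (1 - (starRingEnd ℂ) (b i) * b i) / (1 + (starRingEnd ℂ) (b i) * z i) := by
      simp only [map_neg]
      field_simp
      ring
    rw [this]
    exact div_ne_zero h2' h1
  simp only [mob, Pi.neg_apply]
  rw [div_eq_iff h3]
  simp only [map_neg]
  set c := (starRingEnd ℂ) (b i)
  set q := (z i + b i) / (1 + c * z i) with hq
  have hqq : q * (1 + c * z i) = z i + b i := div_mul_cancel₀ _ h1
  linear_combination (hqq)

/-- An automorphism of `ℂ^k` preserving the unit polydisc does not decrease the sup norm. -/
lemma rigid {k : ℕ} (F G : (Fin k → ℂ) → (Fin k → ℂ)) (hF : Differentiable ℂ F)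
    (hG : Differentiable ℂ G) (hGF : ∀ x, G (F x) = x) (hFG : ∀ x, F (G x) = x)
    (hFU : MapsTo F (ball 0 1) (ball 0 1)) (hGU : MapsTo G (ball 0 1) (ball 0 1)) :
    ∀ z, ‖z‖ ≤ ‖F z‖ := by
  set b := G 0 with hb
  have hbm : b ∈ ball (0 : Fin k → ℂ) 1 := hGU (by simp)
  have hbm' : -b ∈ ball (0 : Fin k → ℂ) 1 := by simpa using hbm
  have h0m : (0 : Fin k → ℂ) ∈ ball (0 : Fin k → ℂ) 1 := by simp
  have hnhds : ball (0 : Fin k → ℂ) 1 ∈ 𝓝 (0 : Fin k → ℂ) := isOpen_ball.mem_nhds h0m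
  set H : (Fin k → ℂ) → (Fin k → ℂ) := fun z => F (mob b z) with hH
  set I : (Fin k → ℂ) → (Fin k → ℂ) := fun z => mob (-b) (G z) with hI
  have hHd : DifferentiableOn ℂ H (ball 0 1) := hF.comp_differentiableOn (mob_diff hbm)
  have hId : DifferentiableOn ℂ I (ball 0 1) := (mob_diff hbm').comp hG.differentiableOn hGU
  have hHm : MapsTo H (ball 0 1) (ball 0 1) := fun z hz => hFU (mob_mem hbm hz)
  have hIm : MapsTo I (ball 0 1) (ball 0 1) := fun z hz => mob_mem hbm' (hGU hz)
  have hmob0 : mob b 0 = b := by funext i; simp [mob]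
  have hH0 : H 0 = 0 := by
    simp only [hH, hmob0]
    exact hFG 0
  have hI0 : I 0 = 0 := by
    have := mob_neg_mob hbm h0m
    rw [hmob0] at this
    exact this
  have hIH : ∀ z ∈ ball (0 : Fin k → ℂ) 1, I (H z) = z := by
    intro z hz
    simp only [hI, hH, hGF]
    exact mob_neg_mob hbm hz
  set B := fderiv ℂ I 0 with hB
  have hBn : ‖B‖ ≤ 1 := Complex.norm_fderiv_le_one_of_mapsTo_ball hId
    (by rw [hI0]; exact fun z hz => ball_subset_closedBall (hIm hz)) one_pos
  have hH1 : HasFDerivAt H (fderiv ℂ H 0) 0 := (hHd.differentiableAt hnhds).hasFDerivAt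
  have hI1 : HasFDerivAt I B 0 := (hId.differentiableAt hnhds).hasFDerivAt
  have hBA : B.comp (fderiv ℂ H 0) = ContinuousLinearMap.id ℂ _ := by
    have h1 : HasFDerivAt (I ∘ H) (B.comp (fderiv ℂ H 0)) 0 := by
      apply HasFDerivAt.comp
      · rw [hH0]; exact hI1
      · exact hH1
    have h2 : HasFDerivAt (I ∘ H) (ContinuousLinearMap.id ℂ (Fin k → ℂ)) 0 := by
      refine (hasFDerivAt_id (0 : Fin k → ℂ)).congr_of_eventuallyEq ?_
      filter_upwards [hnhds] with z hz using hIH z hz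
    exact h1.unique h2
  have hK := cartan_polydisc (fun z => B (H z))
    (B.differentiable.comp_differentiableOn hHd)
    (by
      intro z hz
      have h1 : ‖H z‖ < 1 := by simpa using hHm hz
      have h2 : ‖B (H z)‖ ≤ 1 * ‖H z‖ := B.le_of_opNorm_le hBn _
      simp only [mem_ball_zero_iff]
      linarith)
    (by simp [hH0])
    (by
      rw [← hBA]
      exact B.hasFDerivAt.comp 0 hH1)
  -- hence `B ∘ F` is the inverse Möbius map on the polydisc
  have hBF : ∀ x ∈ ball (0 : Fin k → ℂ) 1, B (F x) = mob (-b) x := by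
    intro x hx
    have h1 := hK (mob (-b) x) (mob_mem hbm' hx)
    have h2 : mob b (mob (-b) x) = x := by
      have := mob_neg_mob hbm' hx
      rwa [neg_neg] at this
    simp only [hH, h2] at h1
    exact h1
  -- `b = 0`
  have hb0 : b = 0 := by
    funext i
    by_contra hbi
    have hbi : b i ≠ 0 := hbi
    have hb1 : ‖b i‖ < 1 := (norm_le_pi_norm b i).trans_lt (by simpa using hbm)
    set g : ℂ → ℂ := fun ζ => (1 - (starRingEnd ℂ) (b i) * ζ) * B (F (Pi.single i ζ)) i with hg
    have hsd : Differentiable ℂ (fun ζ : ℂ => (Pi.single i ζ : Fin k → ℂ)) := by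
      rw [differentiable_pi]
      intro j
      by_cases hj : j = i
      · subst hj; simp
      · simp [Pi.single_eq_of_ne hj]
    have hgd : Differentiable ℂ g := by
      have h1 : Differentiable ℂ (fun ζ : ℂ => B (F (Pi.single i ζ))) :=
        B.differentiable.comp (hF.comp hsd)
      have h2 := differentiable_pi.1 h1 i
      exact Differentiable.mul (by fun_prop) h2
    have hev : g =ᶠ[𝓝 (0 : ℂ)] fun ζ => ζ - b i := by
      filter_upwards [ball_mem_nhds (0 : ℂ) one_pos] with ζ hζ
      have hζ1 : ‖ζ‖ < 1 := by simpa using hζ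
      have hs : (Pi.single i ζ : Fin k → ℂ) ∈ ball (0 : Fin k → ℂ) 1 := by
        rw [mem_ball_zero_iff, Pi.norm_single]; exact hζ1
      have hne := (moebius_lt (a := -(b i)) (z := ζ) (by simpa using hb1) hζ1).1
      have hne' : 1 - (starRingEnd ℂ) (b i) * ζ ≠ 0 := by
        intro h; apply hne; simp only [map_neg]; linear_combination h
      simp only [hg, hBF _ hs, mob, Pi.neg_apply, Pi.single_eq_same, map_neg]
      have e : 1 + -(starRingEnd ℂ) (b i) * ζ = 1 - (starRingEnd ℂ) (b i) * ζ := by ring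
      rw [e, mul_div_cancel₀ _ hne']
      ring
    have hall : g = fun ζ => ζ - b i :=
      AnalyticOnNhd.eq_of_eventuallyEq
        (fun x _ => hgd.analyticAt x)
        (fun x _ => ((differentiable_id.sub_const (b i)).analyticAt x)) hev
    have hc : (starRingEnd ℂ) (b i) ≠ 0 := by simpa using hbi
    have h1 := congrFun hall (1 / (starRingEnd ℂ) (b i))
    simp only [hg, mul_one_div_cancel hc, sub_self, zero_mul] at h1
    have h2 : (starRingEnd ℂ) (b i) * b i = 1 := by
      field_simp at h1
      linear_combination h1
    have h3 : ‖b i‖ * ‖b i‖ = 1 := by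
      have := congrArg norm h2
      simpa using this
    nlinarith [norm_nonneg (b i)]
  have hBF' : ∀ x ∈ ball (0 : Fin k → ℂ) 1, B (F x) = x := by
    intro x hx
    rw [hBF x hx, hb0]
    funext i
    simp [mob]
  intro z
  have hBz : B (F z) = z := by
    set f : ℂ → (Fin k → ℂ) := fun l => B (F (l • z)) with hf
    have hfd : Differentiable ℂ f := B.differentiable.comp (hF.comp (by fun_prop))
    have hev : f =ᶠ[𝓝 (0 : ℂ)] fun l => l • z := by
      have hc : Continuous (fun l : ℂ => l • z) := by fun_prop
      have := hc.continuousAt (x := (0 : ℂ)) (by simpa using hnhds)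
      filter_upwards [this] with l hl using hBF' _ hl
    have hall := AnalyticOnNhd.eq_of_eventuallyEq
        (fun x _ => hfd.analyticAt x)
        (fun x _ => ((by fun_prop : Differentiable ℂ (fun l : ℂ => l • z)).analyticAt x)) hev
    have := congrFun hall 1
    simpa [hf] using this
  calc ‖z‖ = ‖B (F z)‖ := by rw [hBz]
    _ ≤ 1 * ‖F z‖ := B.le_of_opNorm_le hBn _
    _ = ‖F z‖ := one_mul _

/-! ### Shears and approximation -/

/-- Entire functions approximating `0` on one disc and an entire function on another one. -/
lemma runge (g : ℂ → ℂ) (hg : Differentiable ℂ g) (b : ℂ) (r ρ ε : ℝ) (hr : 0 ≤ r) (hρ : 0 < ρ)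
    (hε : 0 < ε) (hb : 4 * (r + ρ) ≤ ‖b‖) :
    ∃ f : ℂ → ℂ, Differentiable ℂ f ∧ (∀ t, ‖t‖ ≤ r → ‖f t‖ ≤ ε) ∧
      ∀ t, ‖t - b‖ ≤ ρ → ‖f t - g t‖ ≤ ε := by
  have hbpos : 0 < ‖b‖ := by linarith
  have hb0 : b ≠ 0 := norm_pos_iff.1 hbpos
  set h : ℂ → ℂ := fun t => t ^ 2 * (3 - 2 * t) with hh
  have hhd : Differentiable ℂ h := by simp only [hh]; fun_prop
  have hsmall : ∀ n : ℕ, ∀ t : ℂ, ‖t‖ ≤ 1 / 4 → ‖h^[n] t‖ ≤ (7 / 8) ^ n * (1 / 4) := by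
    intro n
    induction n with
    | zero => intro t ht; simpa using ht
    | succ n ih =>
      intro t ht
      rw [Function.iterate_succ_apply']
      have h1 := ih t ht
      set s := h^[n] t
      have hp : (7 / 8 : ℝ) ^ n ≤ 1 := pow_le_one₀ (by norm_num) (by norm_num)
      have hs4 : ‖s‖ ≤ 1 / 4 := by linarith
      have h3 : ‖(3 : ℂ) - 2 * s‖ ≤ 7 / 2 := by
        calc ‖(3 : ℂ) - 2 * s‖ ≤ ‖(3 : ℂ)‖ + ‖2 * s‖ := norm_sub_le _ _
          _ = 3 + 2 * ‖s‖ := by simp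
          _ ≤ 7 / 2 := by linarith
      have h4 : ‖h s‖ = ‖s‖ ^ 2 * ‖(3 : ℂ) - 2 * s‖ := by simp [hh]
      rw [h4, pow_succ]
      have h5 : ‖s‖ ^ 2 ≤ ‖s‖ * (1 / 4) := by nlinarith [norm_nonneg s]
      calc ‖s‖ ^ 2 * ‖(3 : ℂ) - 2 * s‖ ≤ (‖s‖ * (1 / 4)) * (7 / 2) := by gcongr
        _ ≤ ((7 / 8) ^ n * (1 / 4) * (1 / 4)) * (7 / 2) := by gcongr
        _ = _ := by ring
  have hsym : ∀ n : ℕ, ∀ t : ℂ, h^[n] (1 - t) = 1 - h^[n] t := by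
    intro n
    induction n with
    | zero => intro t; simp
    | succ n ih =>
      intro t
      rw [Function.iterate_succ_apply', Function.iterate_succ_apply', ih]
      simp only [hh]
      ring
  have hitd : ∀ n : ℕ, Differentiable ℂ h^[n] := fun n => hhd.iterate n
  obtain ⟨M, hM⟩ := (isCompact_closedBall (0 : ℂ) (r + ‖b‖ + ρ)).exists_bound_of_continuousOn
    hg.continuous.continuousOn
  have hM0 : 0 ≤ M := (norm_nonneg _).trans (hM 0 (by simp; positivity))
  have hlim : Tendsto (fun n : ℕ => (7 / 8 : ℝ) ^ n * (1 / 4) * (M + 1)) atTop (𝓝 0) := by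
    have := (tendsto_pow_atTop_nhds_zero_of_lt_one (r := (7 / 8 : ℝ)) (by norm_num) (by norm_num))
    have h := (this.mul_const (1 / 4)).mul_const (M + 1)
    rw [zero_mul, zero_mul] at h
    exact h
  obtain ⟨n, hn⟩ := (hlim.eventually (gt_mem_nhds hε)).exists
  have hsm : ∀ u : ℂ, ∀ t : ℂ, ‖u‖ ≤ 1 / 4 → ‖t‖ ≤ r + ‖b‖ + ρ → ‖h^[n] u * g t‖ ≤ ε := by
    intro u t hu ht
    rw [norm_mul]
    have h1 := hsmall n u hu
    have h2 := hM t (by simpa using ht)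
    calc ‖h^[n] u‖ * ‖g t‖ ≤ ((7 / 8) ^ n * (1 / 4)) * (M + 1) := by
          gcongr; linarith
      _ ≤ ε := hn.le
  refine ⟨fun t => h^[n] (t / b) * g t, ?_, ?_, ?_⟩
  · exact ((hitd n).comp (by fun_prop)).mul hg
  · intro t ht
    refine hsm _ _ ?_ (by linarith)
    rw [norm_div, div_le_iff₀ hbpos]
    linarith
  · intro t ht
    have e : h^[n] (t / b) * g t - g t = - (h^[n] ((b - t) / b) * g t) := by
      have : t / b = 1 - (b - t) / b := by field_simp; ring
      rw [this, hsym]; ring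
    rw [e, norm_neg]
    refine hsm _ _ ?_ ?_
    · rw [norm_div, div_le_iff₀ hbpos, norm_sub_rev]
      linarith
    · calc ‖t‖ = ‖(t - b) + b‖ := by ring_nf
        _ ≤ ‖t - b‖ + ‖b‖ := norm_add_le _ _
        _ ≤ _ := by linarith

/-- The shear `x ↦ x + f (x i) v`, where `v i = 0`. -/
def shear {k : ℕ} (i : Fin k) (v : Fin k → ℂ) (hv : v i = 0) (f : ℂ → ℂ) :
    Equiv.Perm (Fin k → ℂ) where
  toFun x := x + f (x i) • v
  invFun x := x - f (x i) • v
  left_inv x := by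
    have : (x + f (x i) • v) i = x i := by simp [hv]
    simp only [this]; abel
  right_inv x := by
    have : (x - f (x i) • v) i = x i := by simp [hv]
    simp only [this]; abel

lemma shear_apply {k : ℕ} (i : Fin k) (v : Fin k → ℂ) (hv : v i = 0) (f : ℂ → ℂ)
    (x : Fin k → ℂ) : shear i v hv f x = x + f (x i) • v := rfl

lemma shear_inv_apply {k : ℕ} (i : Fin k) (v : Fin k → ℂ) (hv : v i = 0) (f : ℂ → ℂ)
    (x : Fin k → ℂ) : (shear i v hv f)⁻¹ x = x - f (x i) • v := rfl

lemma shear_inv {k : ℕ} (i : Fin k) (v : Fin k → ℂ) (hv : v i = 0) (f : ℂ → ℂ) :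
    (shear i v hv f)⁻¹ = shear i v hv (fun t => - f t) := by
  ext1 x
  rw [shear_inv_apply, shear_apply]
  simp [sub_eq_add_neg]

/-- The group generated by holomorphic shears. -/
def Sh (k : ℕ) : Subgroup (Equiv.Perm (Fin k → ℂ)) :=
  Subgroup.closure {σ | ∃ (i : Fin k) (v : Fin k → ℂ) (hv : v i = 0) (f : ℂ → ℂ),
    Differentiable ℂ f ∧ σ = shear i v hv f}

lemma shear_mem {k : ℕ} (i : Fin k) (v : Fin k → ℂ) (hv : v i = 0) (f : ℂ → ℂ)
    (hf : Differentiable ℂ f) : shear i v hv f ∈ Sh k :=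
  Subgroup.subset_closure ⟨i, v, hv, f, hf, rfl⟩

lemma Sh_induction {k : ℕ} {p : Equiv.Perm (Fin k → ℂ) → Prop}
    (hs : ∀ (i : Fin k) (v : Fin k → ℂ) (hv : v i = 0) (f : ℂ → ℂ), Differentiable ℂ f →
      p (shear i v hv f)) (h1 : p 1) (hm : ∀ σ τ, σ ∈ Sh k → τ ∈ Sh k → p σ → p τ → p (σ * τ))
    {σ : Equiv.Perm (Fin k → ℂ)} (hσ : σ ∈ Sh k) : p σ := by
  induction hσ using Subgroup.closure_induction'' with
  | mem x hx => obtain ⟨i, v, hv, f, hf, rfl⟩ := hx; exact hs i v hv f hf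
  | inv_mem x hx =>
    obtain ⟨i, v, hv, f, hf, rfl⟩ := hx
    rw [shear_inv]
    exact hs i v hv _ hf.fun_neg
  | one => exact h1
  | mul x y hx hy h2 h3 => exact hm x y hx hy h2 h3

lemma Sh_diff {k : ℕ} {σ : Equiv.Perm (Fin k → ℂ)} (hσ : σ ∈ Sh k) : Differentiable ℂ σ := by
  refine Sh_induction (p := fun σ => Differentiable ℂ σ) ?_ ?_ ?_ hσ
  · intro i v hv f hf
    have : Differentiable ℂ (fun x : Fin k → ℂ => x + f (x i) • v) :=
      differentiable_id.add ((hf.comp (differentiable_apply i)).smul_const v)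
    exact this
  · exact differentiable_id
  · intro σ τ _ _ h1 h2
    exact h1.comp h2

lemma Sh_cont {k : ℕ} {σ : Equiv.Perm (Fin k → ℂ)} (hσ : σ ∈ Sh k) : Continuous σ :=
  (Sh_diff hσ).continuous

lemma exists_ne_fin {k : ℕ} (hk : 2 ≤ k) (i : Fin k) : ∃ j : Fin k, j ≠ i := by
  have : Nontrivial (Fin k) := Fin.nontrivial_iff_two_le.2 hk
  exact exists_ne i

lemma translation_mem {k : ℕ} (hk : 2 ≤ k) (b : Fin k → ℂ) :
    ∃ τ ∈ Sh k, ∀ x, τ x = b + x := by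
  have i : Fin k := ⟨0, by omega⟩
  obtain ⟨j, hj⟩ := exists_ne_fin hk i
  have h1 := shear_mem i (b - Pi.single i (b i)) (by simp) (fun _ => 1) (by fun_prop)
  have h2 := shear_mem j (Pi.single i (b i)) (by simp [hj]) (fun _ => 1) (by fun_prop)
  refine ⟨_, mul_mem h1 h2, ?_⟩
  intro x
  rw [Equiv.Perm.mul_apply, shear_apply, shear_apply]
  simp only [one_smul]
  abel

/-- `σ` and its inverse are `ε`-close to the identity on the polydisc of radius `r`. -/
def Near {k : ℕ} (σ : Equiv.Perm (Fin k → ℂ)) (r ε : ℝ) : Prop :=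
  ∀ x : Fin k → ℂ, ‖x‖ ≤ r → ‖σ x - x‖ ≤ ε ∧ ‖σ⁻¹ x - x‖ ≤ ε

lemma Near.mono {k : ℕ} {σ : Equiv.Perm (Fin k → ℂ)} {r ε r' ε' : ℝ} (h : Near σ r ε)
    (hr : r' ≤ r) (hε : ε ≤ ε') : Near σ r' ε' := fun x hx =>
  ⟨((h x (hx.trans hr)).1).trans hε, ((h x (hx.trans hr)).2).trans hε⟩

lemma Near.mul {k : ℕ} {σ τ : Equiv.Perm (Fin k → ℂ)} {r ε₁ ε₂ : ℝ} (hσ : Near σ (r + 1) ε₁)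
    (hτ : Near τ (r + 1) ε₂) (h1 : ε₁ ≤ 1) (h2 : ε₂ ≤ 1) : Near (σ * τ) r (ε₁ + ε₂) := by
  intro x hx
  have hb : ∀ y : Fin k → ℂ, ‖y - x‖ ≤ 1 → ‖y‖ ≤ r + 1 := by
    intro y hy
    calc ‖y‖ = ‖x + (y - x)‖ := by congr 1; abel
      _ ≤ ‖x‖ + ‖y - x‖ := norm_add_le _ _
      _ ≤ r + 1 := by linarith
  have hx' : ‖x‖ ≤ r + 1 := by linarith
  constructor
  · have a := (hτ x hx').1
    have b := (hσ (τ x) (hb _ (a.trans h2))).1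
    rw [Equiv.Perm.mul_apply]
    calc ‖σ (τ x) - x‖ = ‖(σ (τ x) - τ x) + (τ x - x)‖ := by congr 1; abel
      _ ≤ ‖σ (τ x) - τ x‖ + ‖τ x - x‖ := norm_add_le _ _
      _ ≤ _ := by linarith
  · have a := (hσ x hx').2
    have b := (hτ (σ⁻¹ x) (hb _ (a.trans h1))).2
    rw [mul_inv_rev, Equiv.Perm.mul_apply]
    calc ‖τ⁻¹ (σ⁻¹ x) - x‖ = ‖(τ⁻¹ (σ⁻¹ x) - σ⁻¹ x) + (σ⁻¹ x - x)‖ := by congr 1; abel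
      _ ≤ ‖τ⁻¹ (σ⁻¹ x) - σ⁻¹ x‖ + ‖σ⁻¹ x - x‖ := norm_add_le _ _
      _ ≤ _ := by linarith

lemma near_shear {k : ℕ} (i : Fin k) (v : Fin k → ℂ) (hv : v i = 0) (f : ℂ → ℂ) (r ε : ℝ)
    (h : ∀ t, ‖t‖ ≤ r → ‖f t‖ * ‖v‖ ≤ ε) : Near (shear i v hv f) r ε := by
  intro x hx
  have := h (x i) ((norm_le_pi_norm x i).trans hx)
  rw [shear_apply, shear_inv_apply]
  constructor
  · simpa [norm_smul] using this
  · simpa [norm_smul] using this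

lemma near_one {k : ℕ} (r ε : ℝ) (hε : 0 ≤ ε) : Near (1 : Equiv.Perm (Fin k → ℂ)) r ε := by
  intro x _
  simpa using hε

lemma shear_approx {k : ℕ} (i : Fin k) (v : Fin k → ℂ) (hv : v i = 0) (g : ℂ → ℂ)
    (hg : Differentiable ℂ g) (r ρ ε : ℝ) (hr : 0 ≤ r) (hρ : 0 < ρ) (hε : 0 < ε)
    (b : Fin k → ℂ) (hb : 4 * (r + ρ) ≤ ‖b i‖) :
    ∃ φ ∈ Sh k, Near φ r ε ∧ ∀ x, ‖x‖ ≤ ρ → ‖φ (b + x) - (b + (x + g (x i) • v))‖ ≤ ε := by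
  have hv1 : 0 < ‖v‖ + 1 := by positivity
  obtain ⟨f, hf, hf0, hf1⟩ := runge (fun t => g (t - b i)) (hg.comp (by fun_prop)) (b i) r ρ
    (ε / (‖v‖ + 1)) hr hρ (by positivity) hb
  have hle : ε / (‖v‖ + 1) * ‖v‖ ≤ ε := by
    rw [div_mul_eq_mul_div, div_le_iff₀ hv1]
    nlinarith [norm_nonneg v]
  refine ⟨shear i v hv f, shear_mem i v hv f hf, near_shear i v hv f r ε ?_, ?_⟩
  · intro t ht
    exact (mul_le_mul_of_nonneg_right (hf0 t ht) (norm_nonneg _)).trans hle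
  · intro x hx
    rw [shear_apply]
    have e : b + x + f ((b + x) i) • v - (b + (x + g (x i) • v))
        = (f ((b + x) i) - g (x i)) • v := by
      rw [sub_smul]; abel
    rw [e, norm_smul]
    have := hf1 ((b + x) i) (by simpa using (norm_le_pi_norm x i).trans hx)
    simp only [Pi.add_apply, add_sub_cancel_left] at this ⊢
    exact (mul_le_mul_of_nonneg_right this (norm_nonneg _)).trans hle

lemma unif_cont_ball {k : ℕ} {f : (Fin k → ℂ) → (Fin k → ℂ)} (hf : Continuous f) (R ε : ℝ)
    (hε : 0 < ε) : ∃ δ > 0, ∀ x y : Fin k → ℂ, ‖x‖ ≤ R → ‖y‖ ≤ R → ‖x - y‖ ≤ δ →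
      ‖f x - f y‖ ≤ ε := by
  have := (isCompact_closedBall (0 : Fin k → ℂ) R).uniformContinuousOn_of_continuous
    hf.continuousOn
  rw [Metric.uniformContinuousOn_iff] at this
  obtain ⟨δ, hδ, h⟩ := this ε hε
  refine ⟨δ / 2, by positivity, fun x y hx hy hxy => ?_⟩
  have := h x (by simpa using hx) y (by simpa using hy) (by rw [dist_eq_norm]; linarith)
  rw [dist_eq_norm] at this
  exact this.le

/-- Every element of the shear group, transplanted far away, can be approximated by
an element of the shear group which is close to the identity on a polydisc. -/
lemma local_approx {k : ℕ} {Θ : Equiv.Perm (Fin k → ℂ)} (hΘ : Θ ∈ Sh k) :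
    ∀ R : ℝ, 0 < R → ∃ R' : ℝ, 0 < R' ∧ ∀ r ε : ℝ, 0 ≤ r → 0 < ε → ∀ c : Fin k → ℂ,
      (∀ i, 4 * (r + R') ≤ ‖c i‖) → ∃ φ ∈ Sh k, Near φ r ε ∧
        ∀ x, ‖x‖ ≤ R → ‖φ (c + x) - (c + Θ x)‖ ≤ ε := by
  refine Sh_induction (p := fun Θ => ∀ R : ℝ, 0 < R → ∃ R' : ℝ, 0 < R' ∧ ∀ r ε : ℝ, 0 ≤ r →
      0 < ε → ∀ c : Fin k → ℂ, (∀ i, 4 * (r + R') ≤ ‖c i‖) → ∃ φ ∈ Sh k, Near φ r ε ∧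
        ∀ x, ‖x‖ ≤ R → ‖φ (c + x) - (c + Θ x)‖ ≤ ε) ?_ ?_ ?_ hΘ
  · intro i v hv f hf R hR
    refine ⟨R, hR, fun r ε hr hε c hc => ?_⟩
    exact shear_approx i v hv f hf r R ε hr hR hε c (hc i)
  · intro R hR
    refine ⟨R, hR, fun r ε hr hε c hc => ⟨1, one_mem _, near_one r ε hε.le, ?_⟩⟩
    intro x _
    simpa using hε.le
  · intro Θ₁ Θ₂ h1 h2 ih1 ih2 R hR
    obtain ⟨M, hM⟩ := (isCompact_closedBall (0 : Fin k → ℂ) R).exists_bound_of_continuousOn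
      (Sh_cont h2).continuousOn
    have hM0 : 0 ≤ M := (norm_nonneg _).trans (hM 0 (by simp [hR.le]))
    obtain ⟨R1, hR1, H1⟩ := ih1 (M + 1) (by positivity)
    obtain ⟨R2, hR2, H2⟩ := ih2 R hR
    refine ⟨R1 + R2 + 1, by positivity, fun r ε hr hε c hc => ?_⟩
    set ε0 := min ε 1 / 2 with hε0
    have hε0p : 0 < ε0 := by positivity
    have hε01 : ε0 ≤ 1 / 2 := by rw [hε0]; linarith [min_le_right ε 1]
    have hε0e : ε0 + ε0 ≤ ε := by rw [hε0]; linarith [min_le_left ε 1]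
    obtain ⟨δ, hδ, hδ'⟩ := unif_cont_ball (Sh_cont h1) (M + 1) ε0 hε0p
    obtain ⟨φ1, hφ1, hn1, ha1⟩ := H1 (r + 1) ε0 (by linarith) hε0p c
      (fun i => by linarith [hc i])
    obtain ⟨φ2, hφ2, hn2, ha2⟩ := H2 (r + 1) (min ε0 δ) (by linarith) (by positivity) c
      (fun i => by linarith [hc i])
    have hm1 := min_le_left ε0 δ
    have hm2 := min_le_right ε0 δ
    refine ⟨φ1 * φ2, mul_mem hφ1 hφ2,
      (hn1.mul hn2 (by linarith) (by linarith)).mono le_rfl (by linarith), ?_⟩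
    intro x hx
    have a2 := ha2 x hx
    set x' := φ2 (c + x) - c with hx'
    have ex : φ2 (c + x) = c + x' := by rw [hx']; abel
    have d : ‖x' - Θ₂ x‖ ≤ min ε0 δ := by
      have : x' - Θ₂ x = φ2 (c + x) - (c + Θ₂ x) := by rw [hx']; abel
      rw [this]; exact a2
    have b2 : ‖Θ₂ x‖ ≤ M := hM x (by simpa using hx)
    have bx' : ‖x'‖ ≤ M + 1 := by
      calc ‖x'‖ = ‖Θ₂ x + (x' - Θ₂ x)‖ := by congr 1; abel
        _ ≤ ‖Θ₂ x‖ + ‖x' - Θ₂ x‖ := norm_add_le _ _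
        _ ≤ M + 1 := by linarith
    have a1 := ha1 x' bx'
    have u := hδ' x' (Θ₂ x) bx' (by linarith) (by linarith)
    rw [Equiv.Perm.mul_apply, Equiv.Perm.mul_apply, ex]
    calc ‖φ1 (c + x') - (c + Θ₁ (Θ₂ x))‖
        = ‖(φ1 (c + x') - (c + Θ₁ x')) + (Θ₁ x' - Θ₁ (Θ₂ x))‖ := by congr 1; abel
      _ ≤ ‖φ1 (c + x') - (c + Θ₁ x')‖ + ‖Θ₁ x' - Θ₁ (Θ₂ x)‖ := norm_add_le _ _
      _ ≤ ε := by linarith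

/-- Approximate translation of a polydisc to a far away place. -/
lemma move {k : ℕ} (hk : 2 ≤ k) (r ρ ε L : ℝ) (hr : 0 ≤ r) (hρ : 0 < ρ) (hε : 0 < ε)
    (b : Fin k → ℂ) (i : Fin k) (hb : 4 * (r + ρ) + 8 ≤ ‖b i‖) :
    ∃ φ ∈ Sh k, Near φ r ε ∧ ∃ b' : Fin k → ℂ, (∀ j, L ≤ ‖b' j‖) ∧
      ∀ x, ‖x‖ ≤ ρ → ‖φ (b + x) - (b' + x)‖ ≤ ε := by
  obtain ⟨j, hj⟩ := exists_ne_fin hk i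
  set ε0 := min ε 1 / 2 with hε0
  have hε0p : 0 < ε0 := by positivity
  have hε01 : ε0 ≤ 1 / 2 := by rw [hε0]; linarith [min_le_right ε 1]
  have hε0e : ε0 + ε0 ≤ ε := by rw [hε0]; linarith [min_le_left ε 1]
  set L' : ℝ := max L (4 * (r + ρ) + 8) with hL'
  have hL1 : L ≤ L' := le_max_left _ _
  have hL2 : 4 * (r + ρ) + 8 ≤ L' := le_max_right _ _
  have hL0 : 0 ≤ L' := by linarith
  have hLn : ‖(L' : ℂ)‖ = L' := by simp [abs_of_nonneg hL0]
  set v : Fin k → ℂ := fun l => if l = i then 0 else (L' : ℂ) - b l with hv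
  have hvi : v i = 0 := by simp [hv]
  obtain ⟨φ1, hφ1, hn1, ha1⟩ := shear_approx i v hvi (fun _ => 1) (by fun_prop) (r + 1) ρ ε0
    (by linarith) hρ hε0p b (by linarith)
  set b1 := b + v with hb1
  have hb1j : b1 j = L' := by simp [hb1, hv, hj]
  set v2 : Fin k → ℂ := Pi.single i ((L' : ℂ) - b i) with hv2
  have hv2j : v2 j = 0 := by simp [hv2, hj]
  obtain ⟨φ2, hφ2, hn2, ha2⟩ := shear_approx j v2 hv2j (fun _ => 1) (by fun_prop) (r + 1) (ρ + 1)
    ε0 (by linarith) (by linarith) hε0p b1 (by rw [hb1j, hLn]; linarith)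
  refine ⟨φ2 * φ1, mul_mem hφ2 hφ1,
    (hn2.mul hn1 (by linarith) (by linarith)).mono le_rfl hε0e, b1 + v2, ?_, ?_⟩
  · intro l
    have : (b1 + v2) l = L' := by
      by_cases hl : l = i
      · subst hl; simp [hb1, hvi, hv2]
      · simp [hb1, hv, hv2, hl]
    rw [this, hLn]
    exact hL1
  · intro x hx
    have a1 := ha1 x hx
    set x' := φ1 (b + x) - b1 with hx'
    have ex : φ1 (b + x) = b1 + x' := by rw [hx']; abel
    have d : ‖x' - x‖ ≤ ε0 := by
      have : x' - x = φ1 (b + x) - (b + (x + (1 : ℂ) • v)) := by rw [hx', hb1, one_smul]; abel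
      rw [this]; exact a1
    have bx' : ‖x'‖ ≤ ρ + 1 := by
      calc ‖x'‖ = ‖x + (x' - x)‖ := by congr 1; abel
        _ ≤ ‖x‖ + ‖x' - x‖ := norm_add_le _ _
        _ ≤ ρ + 1 := by linarith
    have a2 := ha2 x' bx'
    rw [Equiv.Perm.mul_apply, ex]
    rw [one_smul] at a2
    calc ‖φ2 (b1 + x') - (b1 + v2 + x)‖
        = ‖(φ2 (b1 + x') - (b1 + (x' + v2))) + (x' - x)‖ := by congr 1; abel
      _ ≤ ‖φ2 (b1 + x') - (b1 + (x' + v2))‖ + ‖x' - x‖ := norm_add_le _ _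
      _ ≤ ε := by linarith


lemma stepI {k : ℕ} (hk : 2 ≤ k) (T : Set (Fin k → ℂ)) (b y : Fin k → ℂ) (r ρ ε : ℝ)
    (hr : 0 ≤ r) (hρ : 0 < ρ) (hε : 0 < ε) (hT : ∀ x ∈ T, ‖x - b‖ ≤ ρ)
    (hy : 1000 * ρ ≤ ‖y - b‖) (hb : ∀ i, 4 * (r + ρ) ≤ ‖b i‖) :
    ∃ φ ∈ Sh k, Near φ r ε ∧ ∃ r' : ℝ, r + 1 ≤ r' ∧ ‖φ y‖ < r' - 1 ∧
      ∃ (b' : Fin k → ℂ) (ρ' : ℝ) (i : Fin k), 1 ≤ ρ' ∧ (∀ x ∈ T, ‖φ x - b'‖ ≤ ρ') ∧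
        10 * (r' + ρ') + 20 ≤ ‖b' i‖ := by
  obtain ⟨i, hi⟩ : ∃ i, 1000 * ρ ≤ ‖(y - b) i‖ := by
    by_contra hcon
    push Not at hcon
    exact absurd ((pi_norm_lt_iff (by positivity)).2 hcon) (not_lt.2 hy)
  obtain ⟨j, hj⟩ := exists_ne_fin hk i
  set D : ℂ := b i - y i with hD
  have hDn : 1000 * ρ ≤ ‖D‖ := by rw [hD, norm_sub_rev]; exact hi
  have hDp : 0 < ‖D‖ := by linarith
  have hD0 : D ≠ 0 := norm_pos_iff.1 hDp
  set v : Fin k → ℂ := Pi.single j 1 with hv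
  have hvi : v i = 0 := by simp [hv, hj.symm]
  have hvn : ‖v‖ = 1 := by rw [hv, Pi.norm_single, norm_one]
  set r' : ℝ := max (r + 1) (‖y‖ + 2) with hr'
  have hr1 : r + 1 ≤ r' := le_max_left _ _
  have hr2 : ‖y‖ + 2 ≤ r' := le_max_right _ _
  set A : ℝ := 2 * (‖b‖ + 10 * r' + 10 * ρ + 40) with hA
  have hAp : 0 ≤ A := by have := norm_nonneg b; rw [hA]; linarith
  have hAn : ‖(A : ℂ)‖ = A := by simp [abs_of_nonneg hAp]
  set a : ℂ := A / D with ha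
  have haD : a * D = A := by rw [ha]; field_simp
  have hSp : 0 < r + ‖y‖ + ρ + ‖D‖ + 1 := by positivity
  obtain ⟨h, hh, h0, h1⟩ := runge (fun _ => a) (by fun_prop) (b i) r ρ
    (min ε 1 / (r + ‖y‖ + ρ + ‖D‖ + 1)) hr hρ (by positivity) (hb i)
  have hm1 := min_le_left ε 1
  have hm2 := min_le_right ε 1
  have hδ : ∀ s : ℝ, s ≤ r + ‖y‖ + ρ + ‖D‖ + 1 →
      s * (min ε 1 / (r + ‖y‖ + ρ + ‖D‖ + 1)) ≤ min ε 1 := by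
    intro s hs
    rw [mul_div_assoc', div_le_iff₀ hSp, mul_comm]
    exact mul_le_mul_of_nonneg_left hs (by positivity)
  have hyi := norm_le_pi_norm y i
  set f : ℂ → ℂ := fun t => (t - y i) * h t with hf
  have hfd : Differentiable ℂ f := by
    rw [hf]; exact (differentiable_id.sub_const _).mul hh
  refine ⟨shear i v hvi f, shear_mem i v hvi f hfd, near_shear i v hvi f r ε ?_, r', hr1, ?_,
    b + (A : ℂ) • v, ρ + 1 + A / 1000, j, ?_, ?_, ?_⟩
  · intro t ht
    rw [hvn, mul_one, hf]
    simp only [norm_mul]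
    have e1 : ‖t - y i‖ ≤ r + ‖y‖ := (norm_sub_le _ _).trans (by linarith)
    calc ‖t - y i‖ * ‖h t‖ ≤ (r + ‖y‖) * (min ε 1 / (r + ‖y‖ + ρ + ‖D‖ + 1)) := by
          gcongr; exact h0 t ht
      _ ≤ min ε 1 := hδ _ (by linarith)
      _ ≤ ε := hm1
  · rw [shear_apply]
    simp only [hf, sub_self, zero_mul, zero_smul, add_zero]
    linarith
  · have : 0 ≤ A / 1000 := by positivity
    linarith
  · intro x hx
    have hxb := hT x hx
    have ht : ‖x i - b i‖ ≤ ρ := (norm_le_pi_norm (x - b) i).trans hxb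
    rw [shear_apply]
    have e : x + f (x i) • v - (b + (A : ℂ) • v) = (x - b) + (f (x i) - A) • v := by
      rw [sub_smul]; abel
    have e2 : f (x i) - A = (x i - y i) * (h (x i) - a) + a * (x i - b i) := by
      rw [← haD, hD, hf]; ring
    have e3 : ‖x i - y i‖ ≤ ρ + ‖D‖ := by
      calc ‖x i - y i‖ = ‖(x i - b i) + D‖ := by rw [hD]; congr 1; ring
        _ ≤ ‖x i - b i‖ + ‖D‖ := norm_add_le _ _
        _ ≤ _ := by linarith
    have e4 : ‖a * (x i - b i)‖ ≤ A / 1000 := by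
      rw [norm_mul, ha, norm_div, hAn]
      calc A / ‖D‖ * ‖x i - b i‖ ≤ A / ‖D‖ * (‖D‖ / 1000) := by gcongr; linarith
        _ = A / 1000 := by field_simp
    have e5 : ‖(x i - y i) * (h (x i) - a)‖ ≤ 1 := by
      rw [norm_mul]
      calc ‖x i - y i‖ * ‖h (x i) - a‖
          ≤ (ρ + ‖D‖) * (min ε 1 / (r + ‖y‖ + ρ + ‖D‖ + 1)) := by
            gcongr; exact h1 _ ht
        _ ≤ min ε 1 := hδ _ (by have := norm_nonneg y; linarith)
        _ ≤ 1 := hm2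
    rw [e]
    calc ‖(x - b) + (f (x i) - A) • v‖ ≤ ‖x - b‖ + ‖(f (x i) - A) • v‖ := norm_add_le _ _
      _ = ‖x - b‖ + ‖f (x i) - A‖ := by rw [norm_smul, hvn, mul_one]
      _ ≤ ρ + (1 + A / 1000) := by
        gcongr
        rw [e2]
        exact (norm_add_le _ _).trans (add_le_add e5 e4)
      _ = _ := by ring
  · have e1 : (b + (A : ℂ) • v) j = b j + A := by simp [hv]
    rw [e1]
    have e2 : A ≤ ‖b j + A‖ + ‖b‖ := by
      calc A = ‖(b j + A) - b j‖ := by rw [add_sub_cancel_left, hAn]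
        _ ≤ ‖b j + A‖ + ‖b j‖ := norm_sub_le _ _
        _ ≤ _ := by gcongr; exact norm_le_pi_norm b j
    have := norm_nonneg b
    have := norm_nonneg y
    linarith

lemma stepII {k : ℕ} (hk : 2 ≤ k) {Φ : Equiv.Perm (Fin k → ℂ)} (hΦ : Φ ∈ Sh k)
    (b y : Fin k → ℂ) (r R ε : ℝ) (hr : 0 ≤ r) (hR : 0 < R) (hε : 0 < ε) (i₀ : Fin k)
    (hb : 4 * (r + 1 + R) + 8 ≤ ‖b i₀‖)
    (hK : ∀ x : Fin k → ℂ, ‖x‖ ≤ 1 → ‖Φ x - b‖ ≤ R) (hyR : ‖Φ y - b‖ ≤ R) (hy : 1 < ‖y‖) :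
    ∃ φ ∈ Sh k, Near φ r ε ∧ ∃ b' : Fin k → ℂ, (∀ i, 4 * (r + 3) ≤ ‖b' i‖) ∧
      (∀ x : Fin k → ℂ, ‖x‖ ≤ 1 → ‖φ (Φ x) - b'‖ ≤ 3) ∧ 3000 ≤ ‖φ (Φ y) - b'‖ := by
  obtain ⟨i, hi⟩ : ∃ i, 1 < ‖y i‖ := by
    by_contra hcon
    push Not at hcon
    exact absurd ((pi_norm_le_iff_of_nonneg zero_le_one).2 hcon) (not_le.2 hy)
  obtain ⟨j, hj⟩ := exists_ne_fin hk i
  set v : Fin k → ℂ := Pi.single j 1 with hv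
  have hvi : v i = 0 := by simp [hv, hj.symm]
  have hvn : ‖v‖ = 1 := by rw [hv, Pi.norm_single, norm_one]
  obtain ⟨N, hN⟩ := pow_unbounded_of_one_lt (3001 + ‖y‖) hi
  set Θ' := shear i v hvi (fun t => t ^ N) with hΘ'
  have hΘ'm : Θ' ∈ Sh k := shear_mem i v hvi _ (by fun_prop)
  obtain ⟨τ, hτ, hτa⟩ := translation_mem hk b
  set Θ := Θ' * Φ⁻¹ * τ with hΘ
  have hΘm : Θ ∈ Sh k := mul_mem (mul_mem hΘ'm (inv_mem hΦ)) hτ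
  have hΘa : ∀ z, Θ (Φ z - b) = Θ' z := by
    intro z
    rw [hΘ, Equiv.Perm.mul_apply, Equiv.Perm.mul_apply, hτa]
    have : b + (Φ z - b) = Φ z := by abel
    rw [this]
    exact congrArg Θ' (Φ.symm_apply_apply z)
  obtain ⟨R', hR', H⟩ := local_approx hΘm (R + 1) (by positivity)
  obtain ⟨δ, hδ, hδ'⟩ := unif_cont_ball (Sh_cont hΘm) (R + 1) (1 / 2) (by norm_num)
  set ε0 := min ε 1 / 2 with hε0
  have hε0p : 0 < ε0 := by positivity
  have hε01 : ε0 ≤ 1 / 2 := by rw [hε0]; linarith [min_le_right ε 1]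
  have hε0e : ε0 + ε0 ≤ ε := by rw [hε0]; linarith [min_le_left ε 1]
  have hm1 := min_le_left ε0 δ
  have hm2 := min_le_right ε0 δ
  obtain ⟨φ1, hφ1, hn1, b', hb', ha1⟩ := move hk (r + 1) R (min ε0 δ)
    (max (4 * (r + 1 + R')) (4 * (r + 3))) (by linarith) hR (by positivity) b i₀ hb
  obtain ⟨φ2, hφ2, hn2, ha2⟩ := H (r + 1) ε0 (by linarith) hε0p b'
    (fun l => (le_max_left _ _).trans (hb' l))
  have key : ∀ z, ‖Φ z - b‖ ≤ R → ‖φ2 (φ1 (Φ z)) - (b' + Θ' z)‖ ≤ 1 := by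
    intro z hz
    set w := Φ z - b with hw
    have ew : Φ z = b + w := by rw [hw]; abel
    have a1 := ha1 w hz
    set w' := φ1 (b + w) - b' with hw'
    have ew' : φ1 (b + w) = b' + w' := by rw [hw']; abel
    have d : ‖w' - w‖ ≤ min ε0 δ := by
      have : w' - w = φ1 (b + w) - (b' + w) := by rw [hw']; abel
      rw [this]; exact a1
    have bw' : ‖w'‖ ≤ R + 1 := by
      calc ‖w'‖ = ‖w + (w' - w)‖ := by congr 1; abel
        _ ≤ ‖w‖ + ‖w' - w‖ := norm_add_le _ _
        _ ≤ R + 1 := by linarith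
    have a2 := ha2 w' bw'
    have u := hδ' w' w bw' (by linarith) (by linarith)
    rw [hΘa z] at u
    rw [ew, ew']
    calc ‖φ2 (b' + w') - (b' + Θ' z)‖
        = ‖(φ2 (b' + w') - (b' + Θ w')) + (Θ w' - Θ' z)‖ := by congr 1; abel
      _ ≤ ‖φ2 (b' + w') - (b' + Θ w')‖ + ‖Θ w' - Θ' z‖ := norm_add_le _ _
      _ ≤ 1 := by linarith
  refine ⟨φ2 * φ1, mul_mem hφ2 hφ1,
    (hn2.mul hn1 (by linarith) (by linarith)).mono le_rfl (by linarith), b',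
    fun l => (le_max_right _ _).trans (hb' l), ?_, ?_⟩
  · intro x hx
    have a := key x (hK x hx)
    have c : ‖Θ' x‖ ≤ 2 := by
      rw [hΘ', shear_apply]
      have h1 : ‖x i‖ ^ N ≤ 1 := pow_le_one₀ (norm_nonneg _) ((norm_le_pi_norm x i).trans hx)
      calc ‖x + x i ^ N • v‖ ≤ ‖x‖ + ‖x i ^ N • v‖ := norm_add_le _ _
        _ = ‖x‖ + ‖x i‖ ^ N := by rw [norm_smul, hvn, mul_one, norm_pow]
        _ ≤ 2 := by linarith
    rw [Equiv.Perm.mul_apply]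
    calc ‖φ2 (φ1 (Φ x)) - b'‖ = ‖(φ2 (φ1 (Φ x)) - (b' + Θ' x)) + Θ' x‖ := by congr 1; abel
      _ ≤ ‖φ2 (φ1 (Φ x)) - (b' + Θ' x)‖ + ‖Θ' x‖ := norm_add_le _ _
      _ ≤ 3 := by linarith
  · have a := key y hyR
    have c : 3001 ≤ ‖Θ' y‖ := by
      rw [hΘ', shear_apply]
      have : ‖y i‖ ^ N ≤ ‖y + y i ^ N • v‖ + ‖y‖ := by
        calc ‖y i‖ ^ N = ‖y i ^ N • v‖ := by rw [norm_smul, hvn, mul_one, norm_pow]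
          _ = ‖(y + y i ^ N • v) - y‖ := by congr 1; abel
          _ ≤ _ := norm_sub_le _ _
      linarith
    rw [Equiv.Perm.mul_apply]
    have : ‖Θ' y‖ ≤ ‖φ2 (φ1 (Φ y)) - b'‖ + ‖φ2 (φ1 (Φ y)) - (b' + Θ' y)‖ := by
      calc ‖Θ' y‖ = ‖(φ2 (φ1 (Φ y)) - b') - (φ2 (φ1 (Φ y)) - (b' + Θ' y))‖ := by
            congr 1; abel
        _ ≤ _ := norm_sub_le _ _
    linarith

/-- The image of the closed unit polydisc is well separated from the polydisc of radius `r`. -/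
def Sep {k : ℕ} (Φ : Equiv.Perm (Fin k → ℂ)) (r : ℝ) : Prop :=
  ∃ (b : Fin k → ℂ) (ρ : ℝ) (i : Fin k), 1 ≤ ρ ∧ (∀ x : Fin k → ℂ, ‖x‖ ≤ 1 → ‖Φ x - b‖ ≤ ρ) ∧
    10 * (r + ρ) + 20 ≤ ‖b i‖

lemma Sep.norm_gt {k : ℕ} {Φ : Equiv.Perm (Fin k → ℂ)} {r : ℝ} (h : Sep Φ r) (hr : 0 ≤ r)
    (x : Fin k → ℂ) (hx : ‖x‖ ≤ 1) : r < ‖Φ x‖ := by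
  obtain ⟨b, ρ, i, hρ, h1, h2⟩ := h
  have := h1 x hx
  have h3 : ‖b i‖ ≤ ‖Φ x‖ + ‖Φ x - b‖ := by
    calc ‖b i‖ ≤ ‖b‖ := norm_le_pi_norm b i
      _ = ‖Φ x - (Φ x - b)‖ := by congr 1; abel
      _ ≤ _ := norm_sub_le _ _
  linarith

lemma stepIII {k : ℕ} (hk : 2 ≤ k) {Φ : Equiv.Perm (Fin k → ℂ)} (hΦ : Φ ∈ Sh k)
    (r : ℝ) (hr : 0 ≤ r) (hS : Sep Φ r) (y : Fin k → ℂ) (hy : 1 < ‖y‖) (ε : ℝ) (hε : 0 < ε) :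
    ∃ φ ∈ Sh k, Near φ r ε ∧ ∃ r' : ℝ, r + 1 ≤ r' ∧ Sep (φ * Φ) r' ∧ ‖φ (Φ y)‖ < r' - 1 := by
  obtain ⟨b, ρ, i, hρ, h1, h2⟩ := hS
  set ε0 := min ε 1 / 3 with hε0
  have hε0p : 0 < ε0 := by positivity
  have hε01 : ε0 ≤ 1 / 3 := by rw [hε0]; linarith [min_le_right ε 1]
  have hε0e : ε0 + ε0 + ε0 ≤ ε := by rw [hε0]; linarith [min_le_left ε 1]
  obtain ⟨φ1, hφ1, hn1, b1, hb1, ha1⟩ := move hk (r + 1 + 1) ρ ε0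
    (4 * (r + 3 + 1000 * (ρ + 1)) + 8) (by linarith) (by linarith) hε0p b i (by linarith)
  have hK1 : ∀ x : Fin k → ℂ, ‖x‖ ≤ 1 → ‖φ1 (Φ x) - b1‖ ≤ ρ + 1 := by
    intro x hx
    have e1 := h1 x hx
    have e2 := ha1 (Φ x - b) e1
    have e3 : b + (Φ x - b) = Φ x := by abel
    rw [e3] at e2
    calc ‖φ1 (Φ x) - b1‖ = ‖(φ1 (Φ x) - (b1 + (Φ x - b))) + (Φ x - b)‖ := by congr 1; abel
      _ ≤ ‖φ1 (Φ x) - (b1 + (Φ x - b))‖ + ‖Φ x - b‖ := norm_add_le _ _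
      _ ≤ ρ + 1 := by linarith
  by_cases hc : 1000 * (ρ + 1) ≤ ‖φ1 (Φ y) - b1‖
  · obtain ⟨φ2, hφ2, hn2, r', hr', hy', b', ρ', j, hρ', hT', hb'⟩ := stepI hk
      ((fun x => φ1 (Φ x)) '' {x | ‖x‖ ≤ 1}) b1 (φ1 (Φ y)) (r + 1) (ρ + 1) ε0 (by linarith)
      (by linarith) hε0p (by rintro _ ⟨x, hx, rfl⟩; exact hK1 x hx) hc
      (fun l => by linarith [hb1 l])
    refine ⟨φ2 * φ1, mul_mem hφ2 hφ1, (hn2.mul (hn1.mono (by linarith) le_rfl) (by linarith)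
      (by linarith)).mono le_rfl (by linarith), r', by linarith, ⟨b', ρ', j, hρ', ?_, hb'⟩, hy'⟩
    intro x hx
    exact hT' _ ⟨x, hx, rfl⟩
  · push Not at hc
    obtain ⟨φ2, hφ2, hn2, b2, hb2, hK2, hy2⟩ := stepII hk (mul_mem hφ1 hΦ) b1 y (r + 1 + 1)
      (1000 * (ρ + 1)) ε0 (by linarith) (by linarith) hε0p i
      (by linarith [hb1 i]) (fun x hx => (hK1 x hx).trans (by linarith)) hc.le hy
    obtain ⟨φ3, hφ3, hn3, r', hr', hy', b', ρ', j, hρ', hT', hb'⟩ := stepI hk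
      ((fun x => φ2 (φ1 (Φ x))) '' {x | ‖x‖ ≤ 1}) b2 (φ2 (φ1 (Φ y))) (r + 1) 3 ε0 (by linarith)
      (by norm_num) hε0p (by rintro _ ⟨x, hx, rfl⟩; exact hK2 x hx)
      (le_trans (by norm_num) hy2) (fun l => by linarith [hb2 l])
    have hn12 := hn2.mul hn1 (by linarith) (by linarith)
    refine ⟨φ3 * (φ2 * φ1), mul_mem hφ3 (mul_mem hφ2 hφ1),
      (hn3.mul hn12 (by linarith) (by linarith)).mono le_rfl (by linarith), r', by linarith,
      ⟨b', ρ', j, hρ', ?_, hb'⟩, hy'⟩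
    intro x hx
    exact hT' _ ⟨x, hx, rfl⟩

lemma half_chain {k : ℕ} (g : ℕ → (Fin k → ℂ) → (Fin k → ℂ)) (r : ℕ → ℝ)
    (hr : ∀ n, r n + 1 ≤ r (n + 1))
    (h : ∀ n x, ‖x‖ ≤ r n → ‖g (n + 1) x - g n x‖ ≤ (1 / 2) ^ (n + 1)) :
    ∀ n m, n ≤ m → ∀ x, ‖x‖ ≤ r n → ‖g m x - g n x‖ ≤ (1 / 2) ^ n - (1 / 2) ^ m := by
  have hmono : Monotone r := monotone_nat_of_le_succ (fun n => by linarith [hr n])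
  intro n m hnm
  induction m, hnm using Nat.le_induction with
  | base => intro x _; simp
  | succ m hnm ih =>
    intro x hx
    have h1 := ih x hx
    have h2 := h m x (hx.trans (hmono hnm))
    calc ‖g (m + 1) x - g n x‖ = ‖(g (m + 1) x - g m x) + (g m x - g n x)‖ := by congr 1; abel
      _ ≤ ‖g (m + 1) x - g m x‖ + ‖g m x - g n x‖ := norm_add_le _ _
      _ ≤ (1 / 2) ^ (m + 1) + ((1 / 2) ^ n - (1 / 2) ^ m) := add_le_add h2 h1
      _ = _ := by ring

lemma r_large (r : ℕ → ℝ) (hr0 : 0 ≤ r 0) (hr : ∀ n, r n + 1 ≤ r (n + 1)) (n : ℕ) :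
    (n : ℝ) ≤ r n := by
  induction n with
  | zero => simpa using hr0
  | succ n ih => push_cast; linarith [hr n]

lemma entire_limit {k : ℕ} (g : ℕ → (Fin k → ℂ) → (Fin k → ℂ)) (hg : ∀ n, Differentiable ℂ (g n))
    (r : ℕ → ℝ) (hr0 : 0 ≤ r 0) (hr : ∀ n, r n + 1 ≤ r (n + 1))
    (h : ∀ n x, ‖x‖ ≤ r n → ‖g (n + 1) x - g n x‖ ≤ (1 / 2) ^ (n + 1)) :
    ∃ G : (Fin k → ℂ) → (Fin k → ℂ), Differentiable ℂ G ∧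
      (∀ x, Tendsto (fun n => g n x) atTop (𝓝 (G x))) ∧
      ∀ n x, ‖x‖ ≤ r n → ‖G x - g n x‖ ≤ (1 / 2) ^ n := by
  have hmono : Monotone r := monotone_nat_of_le_succ (fun n => by linarith [hr n])
  have hch := half_chain g r hr h
  have hhalf : Tendsto (fun n : ℕ => (1 / 2 : ℝ) ^ n) atTop (𝓝 0) :=
    tendsto_pow_atTop_nhds_zero_of_lt_one (by norm_num) (by norm_num)
  have hex : ∀ R : ℝ, ∃ n, R ≤ r n := fun R => by
    obtain ⟨n, hn⟩ := exists_nat_ge R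
    exact ⟨n, hn.trans (r_large r hr0 hr n)⟩
  have hch' : ∀ n m m', n ≤ m → m ≤ m' → ∀ x, ‖x‖ ≤ r n → ‖g m' x - g m x‖ ≤ (1 / 2) ^ m := by
    intro n m m' h1 h2 x hx
    refine (hch m m' h2 x (hx.trans (hmono h1))).trans ?_
    have : (0 : ℝ) ≤ (1 / 2) ^ m' := by positivity
    linarith
  have hlim : ∀ x, ∃ l, Tendsto (fun n => g n x) atTop (𝓝 l) := by
    intro x
    apply cauchySeq_tendsto_of_complete
    rw [Metric.cauchySeq_iff']
    intro ε hε
    obtain ⟨n0, hn0⟩ := hex ‖x‖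
    obtain ⟨n, hn, hn1⟩ := ((hhalf.eventually (gt_mem_nhds hε)).and (eventually_ge_atTop n0)).exists
    refine ⟨n, fun m hm => ?_⟩
    rw [dist_eq_norm]
    exact (hch' n0 n m hn1 hm x hn0).trans_lt hn
  choose G hG using hlim
  refine ⟨G, ?_, hG, ?_⟩
  · intro x
    obtain ⟨n0, hn0⟩ := hex (‖x‖ + 2)
    have hd : ∀ z ∈ ball x 1, ∀ m m', n0 ≤ m → m ≤ m' →
        ‖fderiv ℂ (g m') z - fderiv ℂ (g m) z‖ ≤ 2 * (1 / 2) ^ m := by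
      intro z hz m m' h1 h2
      have hw : ∀ w ∈ ball z 1, ‖g m' w - g m w‖ ≤ (1 / 2) ^ m := by
        intro w hw
        refine hch' n0 m m' h1 h2 w ?_
        rw [mem_ball, dist_eq_norm] at hz hw
        calc ‖w‖ = ‖x + ((w - z) + (z - x))‖ := by congr 1; abel
          _ ≤ ‖x‖ + (‖w - z‖ + ‖z - x‖) := (norm_add_le _ _).trans (by gcongr; exact norm_add_le _ _)
          _ ≤ r n0 := by linarith
      have := Complex.norm_fderiv_le_div_of_mapsTo_ball (f := fun w => g m' w - g m w) (c := z)
        (R₁ := 1) (R₂ := 2 * (1 / 2) ^ m) ((hg m').sub (hg m)).differentiableOn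
        (by
          intro w hw'
          rw [mem_closedBall, dist_eq_norm]
          refine (norm_sub_le _ _).trans ?_
          linarith [hw w hw', hw z (mem_ball_self one_pos)]) one_pos
      rw [fderiv_fun_sub ((hg m') z) ((hg m) z), div_one] at this
      exact this
    have hUC : UniformCauchySeqOn (fun n z => fderiv ℂ (g n) z) atTop (ball x 1) := by
      rw [Metric.uniformCauchySeqOn_iff]
      intro ε hε
      obtain ⟨n, hn, hn1⟩ := ((hhalf.eventually (gt_mem_nhds (show (0 : ℝ) < ε / 8 by positivity))).and
        (eventually_ge_atTop n0)).exists
      refine ⟨n, fun a ha c hc z hz => ?_⟩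
      have e1 := hd z hz n a hn1 ha
      have e2 := hd z hz n c hn1 hc
      rw [← dist_eq_norm] at e1 e2
      rw [dist_comm] at e2
      have := dist_triangle (fderiv ℂ (g a) z) (fderiv ℂ (g n) z) (fderiv ℂ (g c) z)
      linarith
    have hlim' : ∀ z, ∃ l, z ∈ ball x 1 → Tendsto (fun n => fderiv ℂ (g n) z) atTop (𝓝 l) := by
      intro z
      by_cases hz : z ∈ ball x 1
      · obtain ⟨l, hl⟩ := cauchySeq_tendsto_of_complete (hUC.cauchySeq hz)
        exact ⟨l, fun _ => hl⟩
      · exact ⟨0, fun h => absurd h hz⟩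
    choose G' hG' using hlim'
    have hU := hUC.tendstoUniformlyOn_of_tendsto (f := G') hG'
    exact (hasFDerivAt_of_tendstoUniformlyOn isOpen_ball hU
      (fun n z _ => ((hg n) z).hasFDerivAt) (fun z _ => hG z)
      (mem_ball_self one_pos)).differentiableAt
  · intro n x hx
    have h1 : Tendsto (fun m => ‖g m x - g n x‖) atTop (𝓝 ‖G x - g n x‖) :=
      ((hG x).sub_const _).norm
    refine le_of_tendsto h1 ?_
    filter_upwards [eventually_ge_atTop n] with m hm
    exact hch' n n m le_rfl hm x hx

lemma exists_seq {k : ℕ} (hk : 2 ≤ k) (y : ℕ → Fin k → ℂ) (hy : ∀ n, 1 < ‖y n‖) :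
    ∃ (Φ φ : ℕ → Equiv.Perm (Fin k → ℂ)) (r : ℕ → ℝ), (∀ n, Φ n ∈ Sh k) ∧
      (∀ n, Φ (n + 1) = φ n * Φ n) ∧ 0 ≤ r 0 ∧ (∀ n, r n + 1 ≤ r (n + 1)) ∧
      (∀ n, Sep (Φ n) (r n)) ∧ (∀ n, Near (φ n) (r n) ((1 / 2) ^ (n + 1))) ∧
      (∀ n x, ‖x‖ ≤ r n → ‖(Φ (n + 1))⁻¹ x - (Φ n)⁻¹ x‖ ≤ (1 / 2) ^ (n + 1)) ∧
      ∀ n, ‖Φ (n + 1) (y n)‖ < r (n + 1) - 1 := by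
  let S := {p : Equiv.Perm (Fin k → ℂ) × ℝ // p.1 ∈ Sh k ∧ 0 ≤ p.2 ∧ Sep p.1 p.2}
  have step : ∀ (n : ℕ) (s : S), ∃ (s' : S) (φ : Equiv.Perm (Fin k → ℂ)),
      s'.1.1 = φ * s.1.1 ∧ s.1.2 + 1 ≤ s'.1.2 ∧ Near φ s.1.2 ((1 / 2) ^ (n + 1)) ∧
      (∀ x, ‖x‖ ≤ s.1.2 → ‖(s'.1.1)⁻¹ x - (s.1.1)⁻¹ x‖ ≤ (1 / 2) ^ (n + 1)) ∧
      ‖s'.1.1 (y n)‖ < s'.1.2 - 1 := by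
    rintro n ⟨⟨Φ, r⟩, hΦ, hr, hS⟩
    dsimp only at hΦ hr hS
    have hp : (0 : ℝ) < (1 / 2) ^ (n + 1) := by positivity
    have hp1 : ((1 : ℝ) / 2) ^ (n + 1) ≤ 1 := pow_le_one₀ (by norm_num) (by norm_num)
    obtain ⟨δ, hδ, hδ'⟩ := unif_cont_ball (Sh_cont (inv_mem hΦ)) (r + 1) ((1 / 2) ^ (n + 1)) hp
    obtain ⟨φ, hφ, hn, r', hr', hS', hy'⟩ := stepIII hk hΦ r hr hS (y n) (hy n)
      (min ((1 / 2) ^ (n + 1)) δ) (by positivity)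
    have hm1 := min_le_left ((1 / 2 : ℝ) ^ (n + 1)) δ
    have hm2 := min_le_right ((1 / 2 : ℝ) ^ (n + 1)) δ
    refine ⟨⟨⟨φ * Φ, r'⟩, mul_mem hφ hΦ, by simp only; linarith, hS'⟩, φ, rfl, hr',
      hn.mono le_rfl hm1, ?_, hy'⟩
    intro x hx
    simp only at hx ⊢
    rw [mul_inv_rev, Equiv.Perm.mul_apply]
    have h2 := (hn x hx).2
    refine hδ' _ _ ?_ (by linarith) (h2.trans hm2)
    calc ‖φ⁻¹ x‖ = ‖x + (φ⁻¹ x - x)‖ := by congr 1; abel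
      _ ≤ ‖x‖ + ‖φ⁻¹ x - x‖ := norm_add_le _ _
      _ ≤ r + 1 := by linarith
  choose nxt φ' h1 h2 h3 h4 h5 using step
  obtain ⟨τ, hτ, hτa⟩ := translation_mem hk (fun _ : Fin k => (30 : ℂ))
  have hS0 : Sep τ 0 := by
    refine ⟨fun _ => 30, 1, ⟨0, by omega⟩, le_rfl, ?_, by norm_num⟩
    intro x hx
    rw [hτa, add_sub_cancel_left]
    exact hx
  let s : ℕ → S := fun n => Nat.rec ⟨⟨τ, 0⟩, hτ, le_rfl, hS0⟩ (fun n s => nxt n s) n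
  refine ⟨fun n => (s n).1.1, fun n => φ' n (s n), fun n => (s n).1.2, fun n => (s n).2.1,
    fun n => h1 n (s n), le_rfl, fun n => h2 n (s n), fun n => (s n).2.2.2, fun n => h3 n (s n),
    fun n => h4 n (s n), fun n => h5 n (s n)⟩

lemma exists_FB {k : ℕ} (hk : 2 ≤ k) (y : ℕ → Fin k → ℂ) (hy : ∀ n, 1 < ‖y n‖) :
    ∃ G : (Fin k → ℂ) → (Fin k → ℂ), Differentiable ℂ G ∧ Function.Injective G ∧
      IsOpen (range G) ∧ (∀ x, ‖x‖ ≤ 1 → x ∉ range G) ∧ ∀ n, y n ∈ range G := by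
  obtain ⟨Φ, φ, r, hΦ, hrec, hr0, hr, hS, hn, hinv, hyn⟩ := exists_seq hk y hy
  have hmono : Monotone r := monotone_nat_of_le_succ (fun n => by linarith [hr n])
  have hhalf : Tendsto (fun n : ℕ => (1 / 2 : ℝ) ^ n) atTop (𝓝 0) :=
    tendsto_pow_atTop_nhds_zero_of_lt_one (by norm_num) (by norm_num)
  have hlarge := r_large r hr0 hr
  have hex : ∀ R : ℝ, ∃ n, R ≤ r n := fun R => by
    obtain ⟨n, hn⟩ := exists_nat_ge R
    exact ⟨n, hn.trans (hlarge n)⟩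
  have hp1 : ∀ n : ℕ, ((1 : ℝ) / 2) ^ n ≤ 1 := fun n => pow_le_one₀ (by norm_num) (by norm_num)
  have hp0 : ∀ n : ℕ, (0 : ℝ) ≤ (1 / 2) ^ n := fun n => by positivity
  obtain ⟨G, hGd, hGl, hGe⟩ := entire_limit (fun n => ((Φ n)⁻¹ : Equiv.Perm (Fin k → ℂ)))
    (fun n => Sh_diff (inv_mem (hΦ n))) r hr0 hr hinv
  have hback : ∀ d n x, ‖x‖ ≤ r n - 1 →
      ‖Φ n ((Φ (n + d))⁻¹ x) - x‖ ≤ (1 / 2) ^ n - (1 / 2) ^ (n + d) := by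
    intro d
    induction d with
    | zero =>
      intro n x _
      have : Φ n ((Φ (n + 0))⁻¹ x) = x := (Φ n).apply_symm_apply x
      rw [this]; simp
    | succ d ih =>
      intro n x hx
      have e0 : n + (d + 1) = n + 1 + d := by ring
      rw [e0]
      have h1 := ih (n + 1) x (by linarith [hr n])
      set z := (Φ (n + 1 + d))⁻¹ x
      set w := Φ (n + 1) z with hw
      have e1 : Φ n z = (φ n)⁻¹ w := by
        rw [hw, hrec n, Equiv.Perm.mul_apply]
        exact ((φ n).symm_apply_apply _).symm
      have h2 : ‖w‖ ≤ r n := by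
        calc ‖w‖ = ‖x + (w - x)‖ := by congr 1; abel
          _ ≤ ‖x‖ + ‖w - x‖ := norm_add_le _ _
          _ ≤ r n := by linarith [hp1 (n + 1), hp0 (n + 1 + d)]
      have h3 := (hn n w h2).2
      rw [e1]
      calc ‖(φ n)⁻¹ w - x‖ = ‖((φ n)⁻¹ w - w) + (w - x)‖ := by congr 1; abel
        _ ≤ ‖(φ n)⁻¹ w - w‖ + ‖w - x‖ := norm_add_le _ _
        _ ≤ (1 / 2) ^ (n + 1) + ((1 / 2) ^ (n + 1) - (1 / 2) ^ (n + 1 + d)) := add_le_add h3 h1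
        _ = _ := by ring
  have hΦG : ∀ n x, ‖x‖ ≤ r n - 1 → ‖Φ n (G x) - x‖ ≤ (1 / 2) ^ n := by
    intro n x hx
    have h1 : Tendsto (fun m => ‖Φ n ((Φ m)⁻¹ x) - x‖) atTop (𝓝 ‖Φ n (G x) - x‖) :=
      ((((Sh_cont (hΦ n)).tendsto (G x)).comp (hGl x)).sub_const x).norm
    refine le_of_tendsto h1 ?_
    filter_upwards [eventually_ge_atTop n] with m hm
    obtain ⟨d, rfl⟩ := Nat.exists_eq_add_of_le hm
    linarith [hback d n x hx, hp0 (n + d)]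
  have hrange : range G = ⋃ n, {z | ‖Φ n z‖ < r n - 1} := by
    ext z
    simp only [mem_iUnion, mem_ofPred_eq]
    constructor
    · rintro ⟨x, rfl⟩
      obtain ⟨n, hn'⟩ := hex (‖x‖ + 3)
      refine ⟨n, ?_⟩
      have h1 := hΦG n x (by linarith)
      calc ‖Φ n (G x)‖ = ‖x + (Φ n (G x) - x)‖ := by congr 1; abel
        _ ≤ ‖x‖ + ‖Φ n (G x) - x‖ := norm_add_le _ _
        _ < r n - 1 := by linarith [hp1 n]
    · rintro ⟨n, hz⟩
      have hfw : ∀ d, ‖Φ (n + d) z - Φ n z‖ ≤ (1 / 2) ^ n - (1 / 2) ^ (n + d) ∧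
          ‖Φ (n + d) z‖ ≤ r n ∧ ‖Φ (n + d + 1) z - Φ (n + d) z‖ ≤ (1 / 2) ^ (n + d + 1) := by
        have aux : ∀ d, ‖Φ (n + d) z - Φ n z‖ ≤ (1 / 2) ^ n - (1 / 2) ^ (n + d) →
          ‖Φ (n + d) z‖ ≤ r n ∧ ‖Φ (n + d + 1) z - Φ (n + d) z‖ ≤ (1 / 2) ^ (n + d + 1) := by
          intro d hd
          have h2 : ‖Φ (n + d) z‖ ≤ r n := by
            calc ‖Φ (n + d) z‖ = ‖Φ n z + (Φ (n + d) z - Φ n z)‖ := by congr 1; abel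
              _ ≤ ‖Φ n z‖ + ‖Φ (n + d) z - Φ n z‖ := norm_add_le _ _
              _ ≤ r n := by linarith [hp1 n, hp0 (n + d)]
          refine ⟨h2, ?_⟩
          rw [hrec (n + d), Equiv.Perm.mul_apply]
          exact (hn (n + d) _ (h2.trans (hmono (Nat.le_add_right n d)))).1
        intro d
        induction d with
        | zero =>
          have h0 : ‖Φ (n + 0) z - Φ n z‖ ≤ (1 / 2) ^ n - (1 / 2) ^ (n + 0) := by simp
          exact ⟨h0, aux 0 h0⟩
        | succ d ih =>
          have h0 : ‖Φ (n + (d + 1)) z - Φ n z‖ ≤ (1 / 2) ^ n - (1 / 2) ^ (n + (d + 1)) := by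
            rw [← add_assoc]
            calc ‖Φ (n + d + 1) z - Φ n z‖
                = ‖(Φ (n + d + 1) z - Φ (n + d) z) + (Φ (n + d) z - Φ n z)‖ := by congr 1; abel
              _ ≤ ‖Φ (n + d + 1) z - Φ (n + d) z‖ + ‖Φ (n + d) z - Φ n z‖ := norm_add_le _ _
              _ ≤ (1 / 2) ^ (n + d + 1) + ((1 / 2) ^ n - (1 / 2) ^ (n + d)) :=
                add_le_add ih.2.2 ih.1
              _ = _ := by ring
          exact ⟨h0, aux (d + 1) h0⟩
      have hC : CauchySeq (fun d => Φ (n + d) z) := by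
        refine cauchySeq_of_le_geometric (1 / 2) 1 (by norm_num) (fun d => ?_)
        rw [dist_comm, dist_eq_norm, one_mul]
        refine ((hfw d).2.2).trans ?_
        exact pow_le_pow_of_le_one (by norm_num) (by norm_num) (by omega)
      obtain ⟨x, hx⟩ := cauchySeq_tendsto_of_complete hC
      refine ⟨x, ?_⟩
      have t1 : Tendsto (fun d => G (Φ (n + d) z)) atTop (𝓝 (G x)) :=
        (hGd.continuous.tendsto x).comp hx
      have t2 : Tendsto (fun d => G (Φ (n + d) z)) atTop (𝓝 z) := by
        rw [tendsto_iff_norm_sub_tendsto_zero]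
        refine squeeze_zero (fun _ => norm_nonneg _) (fun d => ?_) hhalf
        have := hGe (n + d) (Φ (n + d) z) ((hfw d).2.1.trans (hmono (Nat.le_add_right n d)))
        have e : (Φ (n + d))⁻¹ (Φ (n + d) z) = z := (Φ (n + d)).symm_apply_apply z
        rw [e] at this
        exact this.trans (pow_le_pow_of_le_one (by norm_num) (by norm_num) (by omega))
      exact tendsto_nhds_unique t1 t2
  refine ⟨G, hGd, ?_, ?_, ?_, ?_⟩
  · intro x x' hxx
    obtain ⟨n0, hn0⟩ := hex (‖x‖ + ‖x'‖ + 1)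
    have t : ∀ u, ‖u‖ ≤ ‖x‖ + ‖x'‖ → Tendsto (fun n => Φ n (G u)) atTop (𝓝 u) := by
      intro u hu
      rw [tendsto_iff_norm_sub_tendsto_zero]
      refine squeeze_zero' (Eventually.of_forall fun _ => norm_nonneg _) ?_ hhalf
      filter_upwards [eventually_ge_atTop n0] with n hn'
      exact hΦG n u (by linarith [hmono hn'])
    have t1 := t x (by linarith [norm_nonneg x'])
    have t2 := t x' (by linarith [norm_nonneg x])
    rw [← hxx] at t2
    exact tendsto_nhds_unique t1 t2
  · rw [hrange]
    exact isOpen_iUnion fun n => isOpen_lt (Sh_cont (hΦ n)).norm continuous_const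
  · intro x hx hxr
    rw [hrange, mem_iUnion] at hxr
    obtain ⟨n, h1⟩ := hxr
    have h2 := (hS n).norm_gt ((Nat.cast_nonneg n).trans (hlarge n)) x hx
    simp only [mem_ofPred_eq] at h1
    linarith
  · intro n
    rw [hrange, mem_iUnion]
    exact ⟨n + 1, hyn n⟩

/-- The key domain: it avoids the closed unit polydisc and is dense in its complement. -/
lemma exists_FB_dense {k : ℕ} (hk : 2 ≤ k) :
    ∃ G : (Fin k → ℂ) → (Fin k → ℂ), Differentiable ℂ G ∧ Function.Injective G ∧
      IsOpen (range G) ∧ (∀ x, ‖x‖ ≤ 1 → x ∉ range G) ∧ (closure (range G))ᶜ = ball 0 1 := by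
  have hne : Nonempty {x : Fin k → ℂ // 1 < ‖x‖} := by
    refine ⟨⟨Pi.single ⟨0, by omega⟩ 2, ?_⟩⟩
    rw [Pi.norm_single]; norm_num
  obtain ⟨u, hu⟩ := TopologicalSpace.exists_dense_seq {x : Fin k → ℂ // 1 < ‖x‖}
  obtain ⟨G, h1, h2, h3, h4, h5⟩ := exists_FB hk (fun n => (u n).1) (fun n => (u n).2)
  refine ⟨G, h1, h2, h3, h4, ?_⟩
  have hsub : {x : Fin k → ℂ | 1 < ‖x‖} ⊆ closure (range G) := by
    intro x hx
    have hd : (⟨x, hx⟩ : {x : Fin k → ℂ // 1 < ‖x‖}) ∈ closure (range u) := hu _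
    have := image_closure_subset_closure_image continuous_subtype_val (mem_image_of_mem Subtype.val hd)
    refine closure_mono ?_ this
    rintro _ ⟨_, ⟨n, rfl⟩, rfl⟩
    exact h5 n
  ext x
  rw [mem_compl_iff, mem_ball_zero_iff]
  constructor
  · intro hx
    by_contra hcon
    push Not at hcon
    apply hx
    have hx0 : x ≠ 0 := by
      rintro rfl
      rw [norm_zero] at hcon
      linarith
    have ht : Tendsto (fun n : ℕ => ((1 + 1 / ((n : ℝ) + 1) : ℝ)) • x) atTop (𝓝 x) := by
      have := (tendsto_one_div_add_atTop_nhds_zero_nat (𝕜 := ℝ)).const_add 1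
      have := this.smul_const x
      simpa using this
    rw [← isClosed_closure.closure_eq]
    refine mem_closure_of_tendsto ht (Eventually.of_forall fun n => hsub ?_)
    have hpos : (0 : ℝ) < 1 / ((n : ℝ) + 1) := by positivity
    show 1 < ‖((1 + 1 / ((n : ℝ) + 1) : ℝ)) • x‖
    rw [norm_smul, Real.norm_of_nonneg (by positivity)]
    nlinarith
  · intro hx hcl
    rw [_root_.mem_closure_iff] at hcl
    obtain ⟨z, hz1, hz2⟩ := hcl (ball 0 1) isOpen_ball (by simpa using hx)
    exact h4 z (by simpa using (mem_ball_zero_iff.1 hz1).le) hz2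

lemma no_basin {k : ℕ} (Ω : Set (Fin k → ℂ)) (hne : Ω.Nonempty) (ho : IsOpen Ω)
    (hcl : (closure Ω)ᶜ = ball 0 1) (F G : (Fin k → ℂ) → (Fin k → ℂ))
    (hF : Differentiable ℂ F) (hG : Differentiable ℂ G) (hGF : ∀ x, G (F x) = x)
    (hFG : ∀ x, F (G x) = x) (p : Fin k → ℂ)
    (hΩ : ∀ z, z ∈ Ω ↔ Tendsto (fun n => F^[n] z) atTop (𝓝 p)) : False := by
  have hFΩ : ∀ z, F z ∈ Ω ↔ z ∈ Ω := by
    intro z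
    rw [hΩ, hΩ, ← tendsto_add_atTop_iff_nat (f := fun n => F^[n] z) 1]
    simp only [Function.iterate_succ_apply]
  have hGΩ : ∀ z, G z ∈ Ω ↔ z ∈ Ω := by
    intro z
    rw [← hFΩ (G z), hFG]
  have hFc : MapsTo F (closure Ω) (closure Ω) :=
    MapsTo.closure (fun z hz => (hFΩ z).2 hz) hF.continuous
  have hGc : MapsTo G (closure Ω) (closure Ω) :=
    MapsTo.closure (fun z hz => (hGΩ z).2 hz) hG.continuous
  have hFU : MapsTo F (ball 0 1) (ball 0 1) := by
    rw [← hcl]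
    intro z hz hcon
    apply hz
    have := hGc hcon
    rwa [hGF] at this
  have hGU : MapsTo G (ball 0 1) (ball 0 1) := by
    rw [← hcl]
    intro z hz hcon
    apply hz
    have := hFc hcon
    rwa [hFG] at this
  have hrig := rigid F G hF hG hGF hFG hFU hGU
  have hit : ∀ n z, ‖z‖ ≤ ‖F^[n] z‖ := by
    intro n
    induction n with
    | zero => intro z; simp
    | succ n ih =>
      intro z
      rw [Function.iterate_succ_apply]
      exact (hrig z).trans (ih (F z))
  have hle : ∀ z ∈ Ω, ‖z‖ ≤ ‖p‖ := fun z hz =>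
    ge_of_tendsto ((hΩ z).1 hz).norm (Eventually.of_forall fun n => hit n z)
  obtain ⟨z0, hz0⟩ := hne
  have hfix : F p = p := by
    have t1 := (hΩ z0).1 hz0
    have t2 := (hF.continuous.tendsto p).comp t1
    have t3 := (tendsto_add_atTop_iff_nat 1).2 t1
    refine tendsto_nhds_unique t2 (t3.congr fun n => ?_)
    rw [Function.iterate_succ_apply']; rfl
  have hpΩ : p ∈ Ω := by
    rw [hΩ]
    have : (fun n => F^[n] p) = fun _ => p := by
      funext n
      exact Function.iterate_fixed hfix n
    rw [this]
    exact tendsto_const_nhds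
  have hp0 : 0 < ‖p‖ := by
    rw [norm_pos_iff]
    rintro rfl
    have h0 : (0 : Fin k → ℂ) ∈ (closure Ω)ᶜ := by rw [hcl]; exact mem_ball_self one_pos
    exact h0 (subset_closure hpΩ)
  have ht : Tendsto (fun n : ℕ => ((1 + 1 / ((n : ℝ) + 1) : ℝ)) • p) atTop (𝓝 p) := by
    have := (tendsto_one_div_add_atTop_nhds_zero_nat (𝕜 := ℝ)).const_add 1
    have := this.smul_const p
    simpa using this
  obtain ⟨n, hn⟩ := (ht.eventually (ho.mem_nhds hpΩ)).exists
  have hpos : (0 : ℝ) < 1 / ((n : ℝ) + 1) := by positivity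
  have := hle _ hn
  rw [norm_smul, Real.norm_of_nonneg (by positivity)] at this
  nlinarith

end FBaux

theorem FB_domain_not_a_single_automorphism_basin (k : ℕ) (hk : 2 ≤ k) :
    ∃ Ω : Set (EuclideanSpace ℂ (Fin k)), IsFBDomain Ω ∧
      ¬ ∃ (F : EuclideanSpace ℂ (Fin k) → EuclideanSpace ℂ (Fin k))
          (p : EuclideanSpace ℂ (Fin k)),
        IsAutomorphism F ∧
        Ω = {z | Tendsto (fun n => F^[n] z) atTop (nhds p)} := by
  obtain ⟨G, hGd, hGi, hGo, hGd1, hGc⟩ := FBaux.exists_FB_dense hk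
  let e : EuclideanSpace ℂ (Fin k) ≃L[ℂ] (Fin k → ℂ) := EuclideanSpace.equiv (Fin k) ℂ
  refine ⟨e ⁻¹' (range G), ⟨hGo.preimage e.continuous, ?_, ?_⟩, ?_⟩
  · intro hcon
    have : e.symm 0 ∈ e ⁻¹' (range G) := by rw [hcon]; exact mem_univ _
    rw [mem_preimage, e.apply_symm_apply] at this
    exact hGd1 0 (by simp) this
  · refine ⟨fun x => e.symm (G (e x)), ?_, ?_, ?_⟩
    · exact e.symm.differentiable.comp (hGd.comp e.differentiable)
    · intro x x' h
      exact e.injective (hGi (e.symm.injective h))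
    · ext z
      constructor
      · rintro ⟨x, rfl⟩
        exact ⟨e x, (e.apply_symm_apply _).symm⟩
      · rintro ⟨x, hx⟩
        refine ⟨e.symm x, ?_⟩
        simp only [e.apply_symm_apply, hx, e.symm_apply_apply]
  · rintro ⟨F, p, ⟨hF, H, hH, hHF, hFH⟩, hΩ⟩
    refine FBaux.no_basin (range G) ⟨G 0, mem_range_self 0⟩ hGo hGc
      (fun x => e (F (e.symm x))) (fun x => e (H (e.symm x)))
      (e.differentiable.comp (hF.comp e.symm.differentiable))
      (e.differentiable.comp (hH.comp e.symm.differentiable))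
      (fun x => by simp only [e.symm_apply_apply, hHF _, e.apply_symm_apply])
      (fun x => by simp only [e.symm_apply_apply, hFH _, e.apply_symm_apply]) (e p) ?_
    intro z
    have hit : ∀ n : ℕ, (fun x => e (F (e.symm x)))^[n] z = e (F^[n] (e.symm z)) := by
      intro n
      induction n with
      | zero => simp
      | succ n ih =>
        rw [Function.iterate_succ_apply', ih, Function.iterate_succ_apply', e.symm_apply_apply]
    have h1 : z ∈ range G ↔ e.symm z ∈ e ⁻¹' (range G) := by
      rw [mem_preimage, e.apply_symm_apply]
    rw [h1, hΩ]
    simp only [hit]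
    constructor
    · intro h
      exact (e.continuous.tendsto p).comp h
    · intro h
      have := (e.symm.continuous.tendsto (e p)).comp h
      simpa [Function.comp_def] using this
end
end

section
/- Let k ≥ 2 and let Ω be a Runge Fatou–Bieberbach domain in ℂ^k. For every compact set K ⊆ Ω, every bounded open set U ⊆ ℂ^k with K ⊆ U, and every ε > 0, there exists a holomorphic automorphism Φ of ℂ^k such that ‖Φ(z) − z‖ < ε for all z ∈ K and Φ(ℂ^k \ Ω) ∩ U = ∅. -/
open Metric Set Filter

noncomputable section

/-- An open set `Ω ⊆ ℂ^k` is Runge if every function holomorphic on `Ω` can be approximated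
uniformly on compact subsets of `Ω` by polynomials. -/
def IsRunge {k : ℕ} (Ω : Set (EuclideanSpace ℂ (Fin k))) : Prop :=
  ∀ f : EuclideanSpace ℂ (Fin k) → ℂ, DifferentiableOn ℂ f Ω →
    ∀ K ⊆ Ω, IsCompact K → ∀ ε > (0 : ℝ),
      ∃ P : MvPolynomial (Fin k) ℂ,
        ∀ z ∈ K, ‖f z - MvPolynomial.eval (fun i => z i) P‖ < ε


section HoloReg
open Complex Topology
variable {E F : Type} [NormedAddCommGroup E] [NormedSpace ℂ E] [FiniteDimensional ℂ E]
  [NormedAddCommGroup F] [NormedSpace ℂ F] [FiniteDimensional ℂ F]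

/-- Cauchy estimate for the Fréchet derivative. -/
theorem fderiv_cauchy {f : E → F} {x : E} {r M : ℝ} (hr : 0 < r) 
    (hf : DifferentiableOn ℂ f (ball x r)) (hM : ∀ y ∈ ball x r, ‖f y‖ ≤ M) :
    ‖fderiv ℂ f x‖ ≤ M / r := by
  have hM0 : 0 ≤ M := (norm_nonneg _).trans (hM x (mem_ball_self hr))
  refine ContinuousLinearMap.opNorm_le_bound _ (by positivity) fun v => ?_
  rcases eq_or_ne v 0 with rfl | hv
  · simp
  have hv' : 0 < ‖v‖ := norm_pos_iff.2 hv
  -- for every R < r / ‖v‖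
  have key : ∀ R : ℝ, 0 < R → R < r / ‖v‖ → ‖fderiv ℂ f x v‖ ≤ M / R := by
    intro R hR hRr
    have hline : ∀ ζ : ℂ, ‖ζ‖ ≤ R → x + ζ • v ∈ ball x r := by
      intro ζ hζ
      rw [mem_ball, dist_eq_norm, add_sub_cancel_left, norm_smul]
      calc ‖ζ‖ * ‖v‖ ≤ R * ‖v‖ := by gcongr
        _ < r := by rwa [lt_div_iff₀ hv'] at hRr
    have hd : ∀ ζ : ℂ, ‖ζ‖ ≤ R → HasDerivAt (fun ζ : ℂ => f (x + ζ • v)) 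
        (fderiv ℂ f (x + ζ • v) v) ζ := by
      intro ζ hζ
      have h1 := ((hf _ (hline ζ hζ)).differentiableAt (isOpen_ball.mem_nhds (hline ζ hζ))).hasFDerivAt
      have h2 : HasDerivAt (fun ζ : ℂ => x + ζ • v) v ζ := by
        simpa using ((hasDerivAt_id ζ).smul_const v).const_add x
      exact h1.comp_hasDerivAt ζ h2
    have := Complex.norm_deriv_le_of_forall_mem_sphere_norm_le (c := 0) (R := R) (C := M)
      (f := fun ζ : ℂ => f (x + ζ • v)) hR
      (DifferentiableOn.diffContOnCl (fun ζ hζ => 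
        (hd ζ (by simpa using (closure_ball_subset_closedBall hζ))).differentiableAt.differentiableWithinAt))
      (fun ζ hζ => hM _ (hline ζ (by simpa using sphere_subset_closedBall hζ)))
    rw [(hd 0 (by simpa using hR.le)).deriv] at this
    simpa using this
  have hlim : Tendsto (fun R : ℝ => M / R) (𝓝[<] (r / ‖v‖)) (𝓝 (M / (r / ‖v‖))) := by
    have : ContinuousAt (fun R : ℝ => M / R) (r / ‖v‖) := by
      exact ContinuousAt.div continuousAt_const continuousAt_id (ne_of_gt (by positivity : (0:ℝ) < r / ‖v‖))
    exact this.tendsto.mono_left nhdsWithin_le_nhds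
  have : ‖fderiv ℂ f x v‖ ≤ M / (r / ‖v‖) := by
    refine ge_of_tendsto hlim ?_
    have h0 : 0 < r / ‖v‖ := by positivity
    filter_upwards [Ioo_mem_nhdsLT h0] with R hR using key R hR.1 hR.2
  calc _ ≤ _ := this
    _ = M / r * ‖v‖ := by field_simp

theorem fderiv_apply_differentiableOn {f : E → F} {U : Set E} (hU : IsOpen U)
    (hf : DifferentiableOn ℂ f U) (v : E) :
    DifferentiableOn ℂ (fun x => fderiv ℂ f x v) U := by
  intro x₀ hx₀
  apply DifferentiableAt.differentiableWithinAt
  let : MeasurableSpace E := borel E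
  have : BorelSpace E := ⟨rfl⟩
  let : MeasurableSpace F := borel F
  have : BorelSpace F := ⟨rfl⟩
  have := FiniteDimensional.proper ℂ E
  have := FiniteDimensional.proper ℂ F
  have : CompleteSpace F := FiniteDimensional.complete ℂ F
  have : FiniteDimensional ℂ (E →L[ℂ] F) := ContinuousLinearMap.finiteDimensional 
  have := FiniteDimensional.proper ℂ (E →L[ℂ] F)
  obtain ⟨r', hr', hsub'⟩ := nhds_basis_closedBall.mem_iff.1 (hU.mem_nhds hx₀)
  obtain ⟨r, hr, hrr⟩ : ∃ r : ℝ, 0 < r ∧ 3 * r = r' := ⟨r' / 3, by positivity, by ring⟩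
  subst hrr
  obtain ⟨M, hM⟩ := (isCompact_closedBall x₀ (3 * r)).exists_bound_of_continuousOn
    (hf.continuousOn.mono hsub')
  have hfd : ∀ y ∈ ball x₀ (2 * r), ‖fderiv ℂ f y‖ ≤ M / r := by
    intro y hy
    have hb : ball y r ⊆ closedBall x₀ (3 * r) := by
      intro z hz
      simp only [mem_ball, mem_closedBall] at *
      linarith [dist_triangle z y x₀]
    exact fderiv_cauchy hr (hf.mono (hb.trans hsub')) (fun z hz => hM z (hb hz))
  set ρ : ℝ := r / (‖v‖ + 1) with hρ
  have hρ0 : 0 < ρ := by positivity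
  have hρv : ρ * ‖v‖ < r := by
    rw [hρ, div_mul_eq_mul_div, div_lt_iff₀ (by positivity)]
    nlinarith [norm_nonneg v]
  have hline : ∀ x ∈ ball x₀ r, ∀ ζ : ℂ, ‖ζ‖ ≤ ρ → x + ζ • v ∈ ball x₀ (2 * r) := by
    intro x hx ζ hζ
    have : ‖ζ • v‖ < r := by
      rw [norm_smul]
      exact lt_of_le_of_lt (by gcongr) hρv
    rw [mem_ball, dist_eq_norm] at *
    calc ‖x + ζ • v - x₀‖ = ‖(x - x₀) + ζ • v‖ := by congr 1; abel
      _ ≤ ‖x - x₀‖ + ‖ζ • v‖ := norm_add_le _ _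
      _ < 2 * r := by linarith
  have hbU : ball x₀ (2 * r) ⊆ U := (ball_subset_closedBall.trans
    (closedBall_subset_closedBall (by linarith))).trans hsub'
  have hdiff : ∀ y ∈ ball x₀ (2 * r), HasFDerivAt f (fderiv ℂ f y) y := fun y hy =>
    ((hf y (hbU hy)).differentiableAt (hU.mem_nhds (hbU hy))).hasFDerivAt
  have hcm : ∀ θ : ℝ, ‖circleMap 0 ρ θ‖ ≤ ρ := fun θ => by simp [abs_of_pos hρ0]
  have hcm0 : ∀ θ : ℝ, circleMap 0 ρ θ ≠ 0 := fun θ => circleMap_ne_center hρ0.ne'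
  let c : ℝ → ℂ := fun θ => deriv (circleMap 0 ρ) θ * ((circleMap 0 ρ θ - 0) ^ 2)⁻¹
  have hc : Continuous c := by
    refine Continuous.mul ?_ (Continuous.inv₀ (by fun_prop) ?_)
    · have h : deriv (circleMap 0 ρ) = fun θ => circleMap 0 ρ θ * I := funext fun θ => by simp
      rw [h]; fun_prop
    · intro θ; simpa using hcm0 θ
  have hrep : ∀ x ∈ ball x₀ r, fderiv ℂ f x v = (2 * Real.pi * I : ℂ)⁻¹ • 
      ∫ θ in (0:ℝ)..2 * Real.pi, c θ • f (x + circleMap 0 ρ θ • v) := by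
    intro x hx
    have hV : IsOpen {ζ : ℂ | x + ζ • v ∈ ball x₀ (2 * r)} := 
      isOpen_ball.preimage (by fun_prop)
    have hd : ∀ ζ ∈ {ζ : ℂ | x + ζ • v ∈ ball x₀ (2 * r)}, HasDerivAt (fun ζ : ℂ => f (x + ζ • v)) 
        (fderiv ℂ f (x + ζ • v) v) ζ := by
      intro ζ hζ
      have h2 : HasDerivAt (fun ζ : ℂ => x + ζ • v) v ζ := by
        simpa using ((hasDerivAt_id ζ).smul_const v).const_add x
      exact (hdiff _ hζ).comp_hasDerivAt ζ h2
    have h := two_pi_I_inv_smul_circleIntegral_sub_sq_inv_smul_of_differentiable hV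
      (c := 0) (w₀ := 0) (R := ρ) (f := fun ζ : ℂ => f (x + ζ • v))
      (fun ζ hζ => hline x hx ζ (by simpa using hζ)) 
      (fun ζ hζ => (hd ζ hζ).differentiableAt.differentiableWithinAt) (mem_ball_self hρ0)
    rw [(hd 0 (hline x hx 0 (by simpa using hρ0.le))).deriv] at h
    simp only [zero_smul, add_zero] at h
    rw [← h, circleIntegral]
    simp only [c, smul_smul]
  have hmain : DifferentiableAt ℂ (fun x => ∫ θ in (0:ℝ)..2 * Real.pi, c θ • f (x + circleMap 0 ρ θ • v)) x₀ := by
    have hcont : ∀ x ∈ ball x₀ r, Continuous (fun θ : ℝ => c θ • f (x + circleMap 0 ρ θ • v)) := by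
      intro x hx
      refine hc.smul ?_
      have : ContinuousOn f (ball x₀ (2 * r)) := hf.continuousOn.mono hbU
      exact this.comp_continuous (by fun_prop) (fun θ => hline x hx _ (hcm θ))
    refine (intervalIntegral.hasFDerivAt_integral_of_dominated_of_fderiv_le 
      (F' := fun x θ => c θ • fderiv ℂ f (x + circleMap 0 ρ θ • v)) 
      (bound := fun θ => ‖c θ‖ * (M / r)) (ball_mem_nhds x₀ hr) ?_ ?_ ?_ ?_ ?_ ?_).differentiableAt
    · filter_upwards [ball_mem_nhds x₀ hr] with x hx
      exact (hcont x hx).aestronglyMeasurable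
    · exact (hcont x₀ (mem_ball_self hr)).intervalIntegrable _ _
    · refine Measurable.aestronglyMeasurable ?_
      refine hc.measurable.smul ?_
      exact (measurable_fderiv ℂ f).comp (by fun_prop : Continuous fun θ : ℝ => x₀ + circleMap 0 ρ θ • v).measurable
    · refine Eventually.of_forall fun θ _ x hx => ?_
      rw [norm_smul]
      gcongr
      exact hfd _ (hline x hx _ (hcm θ))
    · exact (by fun_prop : Continuous fun θ => ‖c θ‖ * (M / r)).intervalIntegrable _ _
    · refine Eventually.of_forall fun θ _ x hx => ?_
      refine HasFDerivAt.const_smul ?_ _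
      have h2 : HasFDerivAt (fun x : E => x + circleMap 0 ρ θ • v) (ContinuousLinearMap.id ℂ E) x :=
        (hasFDerivAt_id x).add_const _
      exact (hdiff _ (hline x hx _ (hcm θ))).comp x h2
  refine (hmain.const_smul ((2 * Real.pi * I : ℂ)⁻¹)).congr_of_eventuallyEq ?_
  filter_upwards [ball_mem_nhds x₀ hr] with x hx using hrep x hx

theorem fderiv_differentiableOn {f : E → F} {U : Set E} (hU : IsOpen U)
    (hf : DifferentiableOn ℂ f U) : DifferentiableOn ℂ (fderiv ℂ f) U := by
  let b := Module.finBasis ℂ E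
  have h : fderiv ℂ f = fun x => ∑ i, (ContinuousLinearMap.smulRightL ℂ E F 
      (LinearMap.toContinuousLinearMap (b.coord i))) (fderiv ℂ f x (b i)) := by
    funext x
    ext v
    have h := congrArg (fderiv ℂ f x) (b.sum_repr v)
    rw [map_sum] at h
    rw [← h]
    simp
  rw [h]
  refine DifferentiableOn.fun_sum fun i _ => ?_
  exact (ContinuousLinearMap.differentiable _).comp_differentiableOn (fderiv_apply_differentiableOn hU hf (b i))

theorem holo_contDiffAt {f : E → F} {U : Set E} (hU : IsOpen U)
    (hf : DifferentiableOn ℂ f U) {x : E} (hx : x ∈ U) : ContDiffAt ℂ 1 f x := by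
  have : ContDiffOn ℂ (0 + 1) f U := by
    rw [contDiffOn_succ_iff_fderiv_of_isOpen hU]
    refine ⟨hf, by simp, ?_⟩
    rw [contDiffOn_zero]
    exact (fderiv_differentiableOn hU hf).continuousOn
  simpa using this.contDiffAt (hU.mem_nhds hx)

theorem holo_strict {f : E → F} {U : Set E} (hU : IsOpen U)
    (hf : DifferentiableOn ℂ f U) {x : E} (hx : x ∈ U) : HasStrictFDerivAt f (fderiv ℂ f x) x :=
  (holo_contDiffAt hU hf hx).hasStrictFDerivAt (by simp)

end HoloReg


section Osgood
open Complex Topology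

theorem exists_zero_of_small_center {φ : ℂ → ℂ} {c : ℂ} {r δ : ℝ} (hr : 0 < r)
    (hφ : DifferentiableOn ℂ φ (closedBall c r)) (hc : ‖φ c‖ < δ)
    (hs : ∀ ζ ∈ sphere c r, δ ≤ ‖φ ζ‖) : ∃ ζ ∈ ball c r, φ ζ = 0 := by
  by_contra! hcon
  have hδ : 0 < δ := (norm_nonneg _).trans_lt hc
  have hne : ∀ x ∈ closure (ball c r), φ x ≠ 0 := by
    intro x hx
    rw [closure_ball c hr.ne'] at hx
    rcases (mem_closedBall.1 hx).lt_or_eq with h | h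
    · exact hcon x h
    · intro h0
      have := hs x h
      rw [h0, norm_zero] at this
      linarith
  have hd : DiffContOnCl ℂ φ (ball c r) := by
    apply DifferentiableOn.diffContOnCl
    rwa [closure_ball c hr.ne']
  have := Complex.norm_le_of_forall_mem_frontier_norm_le (isBounded_ball) (hd.inv hne) (C := δ⁻¹)
    (fun z hz => by
      rw [frontier_ball c hr.ne'] at hz
      simp only [Pi.inv_apply, norm_inv]
      exact inv_anti₀ hδ (hs z hz)) (subset_closure (mem_ball_self hr))
  simp only [Pi.inv_apply, norm_inv] at this
  have h0 : 0 < ‖φ c‖ := norm_pos_iff.2 (hcon c (mem_ball_self hr))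
  rw [inv_le_inv₀ h0 hδ] at this
  linarith

theorem osgood_one {f : ℂ → ℂ} {U : Set ℂ} (hU : IsOpen U) (hf : DifferentiableOn ℂ f U)
    (hinj : InjOn f U) {a : ℂ} (ha : a ∈ U) : deriv f a ≠ 0 := by
  intro h0
  obtain ⟨r, hr, hsub⟩ := nhds_basis_closedBall.mem_iff.1 (hU.mem_nhds ha)
  have hfa : HasDerivAt f 0 a := by
    rw [← h0]
    exact (hf.differentiableAt (hU.mem_nhds ha)).hasDerivAt
  obtain ⟨δ, hδ, hδs⟩ : ∃ δ : ℝ, 0 < δ ∧ ∀ z ∈ sphere a r, δ ≤ ‖f z - f a‖ := by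
    have hc : ContinuousOn (fun z => ‖f z - f a‖) (sphere a r) :=
      ((hf.continuousOn.mono (sphere_subset_closedBall.trans hsub)).sub continuousOn_const).norm
    obtain ⟨z, hz, hmin⟩ := (isCompact_sphere a r).exists_isMinOn (NormedSpace.sphere_nonempty.2 hr.le) hc
    refine ⟨_, ?_, hmin⟩
    rw [norm_pos_iff, sub_ne_zero]
    intro h
    have := hinj (hsub (sphere_subset_closedBall hz)) ha h
    rw [this, mem_sphere, dist_self] at hz
    exact hr.ne hz
  have hev : ∀ᶠ w in 𝓝[≠] a, deriv f w = 0 := by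
    have h1 : ∀ᶠ w in 𝓝[≠] a, ‖f w - f a‖ < δ / 2 := by
      have : Tendsto (fun w => ‖f w - f a‖) (𝓝 a) (𝓝 ‖f a - f a‖) :=
        (hfa.continuousAt.sub continuousAt_const).norm
      rw [sub_self, norm_zero] at this
      exact (this.mono_left nhdsWithin_le_nhds).eventually (gt_mem_nhds (by positivity))
    have h2 : ∀ᶠ w in 𝓝[≠] a, ‖slope f a w‖ < δ / (4 * r) := by
      have := (hasDerivAt_iff_tendsto_slope.1 hfa).norm
      rw [norm_zero] at this
      exact this.eventually (gt_mem_nhds (by positivity))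
    have h3 : ∀ᶠ w in 𝓝[≠] a, w ∈ ball a r := nhdsWithin_le_nhds (ball_mem_nhds a hr)
    filter_upwards [h1, h2, h3, self_mem_nhdsWithin] with w hw1 hw2 hw3 hw4
    have hw4 : w ≠ a := hw4
    have hwU : w ∈ U := hsub (ball_subset_closedBall hw3)
    obtain ⟨ζ, hζ, hζ0⟩ := exists_zero_of_small_center (φ := dslope f w) (c := a) (δ := δ / (4 * r)) hr
      (((differentiableOn_dslope (hU.mem_nhds hwU)).2 hf).mono hsub)
      (by rwa [dslope_of_ne _ hw4.symm, slope_comm])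
      (by
        intro z hz
        have hzw : z ≠ w := by
          rintro rfl
          exact absurd hw3 (by simp [mem_sphere.1 hz])
        have h5 : 0 < ‖z - w‖ := norm_pos_iff.2 (sub_ne_zero.2 hzw)
        have h6 : ‖z - w‖ ≤ 2 * r := by
          rw [← dist_eq_norm]
          have := dist_triangle z a w
          rw [mem_sphere.1 hz, dist_comm a w] at this
          have := mem_ball.1 hw3
          linarith
        rw [dslope_of_ne _ hzw, slope_def_field, norm_div]
        have h7 : δ / 2 ≤ ‖f z - f w‖ := by
          have := norm_sub_norm_le (f z - f a) (f w - f a)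
          rw [sub_sub_sub_cancel_right] at this
          linarith [hδs z hz]
        calc δ / (4 * r) = (δ / 2) / (2 * r) := by field_simp; norm_num
          _ ≤ _ := by gcongr)
    rcases eq_or_ne ζ w with rfl | hne
    · rwa [dslope_same] at hζ0
    · exfalso
      rw [dslope_of_ne _ hne, slope_def_field, div_eq_zero_iff] at hζ0
      rcases hζ0 with h | h
      · exact hne (hinj (hsub (ball_subset_closedBall hζ)) hwU (sub_eq_zero.1 h))
      · exact hne (sub_eq_zero.1 h)
  have hev' : ∀ᶠ w in 𝓝 a, deriv f w = 0 := by
    rw [eventually_nhdsWithin_iff] at hev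
    filter_upwards [hev] with w hw
    rcases eq_or_ne w a with rfl | h
    · exact h0
    · exact hw h
  obtain ⟨ρ, hρ, hb⟩ := Metric.eventually_nhds_iff_ball.1 (hev'.and (hU.mem_nhds ha))
  have hx : a + (ρ / 2 : ℝ) ∈ ball a ρ := by
    rw [mem_ball, dist_eq_norm, add_sub_cancel_left, Complex.norm_real, Real.norm_of_nonneg (by positivity)]
    linarith
  have := isOpen_ball.is_const_of_deriv_eq_zero (convex_ball a ρ).isPreconnected 
    (hf.mono fun x hx => (hb x hx).2) (fun x hx => (hb x hx).1) (mem_ball_self hρ) hx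
  have := hinj ha (hb _ hx).2 this
  simp at this
  linarith

variable {E : Type} [NormedAddCommGroup E] [NormedSpace ℂ E] [FiniteDimensional ℂ E]

theorem osgood_key {f : E → E} {J g : E → ℂ} {B : Set E} (hB : IsOpen B)
    (hdim : 2 ≤ Module.finrank ℂ E)
    (hf : DifferentiableOn ℂ f B) (hJ : DifferentiableOn ℂ J B) (hg : DifferentiableOn ℂ g B)
    (hJf : ∀ x ∈ B, J x = 0 → fderiv ℂ f x = 0) (hJg : ∀ x ∈ B, J x = 0 → g x = 0)
    {b v : E} (hb : b ∈ B) (hJb : J b = 0) (hgv : fderiv ℂ g b v ≠ 0) (hinj : InjOn f B) : False := by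
  set g' := fderiv ℂ g b with hg'
  have hγ : 0 < ‖g' v‖ := norm_pos_iff.2 hgv
  set γ := ‖g' v‖ with hγdef
  -- a vector in the kernel
  obtain ⟨u, hu0, hu⟩ : ∃ u : E, u ≠ 0 ∧ g' u = 0 := by
    have : ¬ Function.Injective (g' : E →ₗ[ℂ] ℂ) := by
      intro h
      have := LinearMap.finrank_le_finrank_of_injective h
      simp at this
      omega
    rw [injective_iff_map_eq_zero] at this
    push Not at this
    obtain ⟨u, h1, h2⟩ := this
    exact ⟨u, h2, h1⟩
  have hc0 : 0 < γ / (2 * (‖v‖ + 1)) := by positivity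
  set c : NNReal := ⟨γ / (2 * (‖v‖ + 1)), hc0.le⟩ with hcdef
  have hc0' : 0 < c := hc0
  have hcv : (c : ℝ) * ‖v‖ ≤ γ / 2 := by
    show γ / (2 * (‖v‖ + 1)) * ‖v‖ ≤ γ / 2
    rw [div_mul_eq_mul_div, div_le_div_iff₀ (by positivity) (by norm_num)]
    nlinarith [norm_nonneg v]
  obtain ⟨s, hs, happ⟩ := (holo_strict hB hg hb).approximates_deriv_on_nhds (c := c) (Or.inr hc0')
  obtain ⟨ρ, hρ, hρs⟩ := Metric.mem_nhds_iff.1 (inter_mem hs (hB.mem_nhds hb))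
  have hgb := hJg b hb hJb
  -- lower bound along the line
  obtain ⟨r, hr, hrv⟩ : ∃ r : ℝ, 0 < r ∧ r * ‖v‖ < ρ / 2 := by
    refine ⟨ρ / (2 * (‖v‖ + 1)), by positivity, ?_⟩
    rw [div_mul_eq_mul_div, div_lt_div_iff₀ (by positivity) (by norm_num)]
    nlinarith [norm_nonneg v]
  have hmem : ∀ w ∈ ball b (ρ / 2), ∀ ζ : ℂ, ‖ζ‖ ≤ r → w + ζ • v ∈ ball b ρ := by
    intro w hw ζ hζ
    have h1 : ‖ζ • v‖ < ρ / 2 := by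
      rw [norm_smul]; exact lt_of_le_of_lt (by gcongr) hrv
    rw [mem_ball, dist_eq_norm] at *
    calc ‖w + ζ • v - b‖ = ‖(w - b) + ζ • v‖ := by congr 1; abel
      _ ≤ ‖w - b‖ + ‖ζ • v‖ := norm_add_le _ _
      _ < ρ := by linarith
  have hbb : b ∈ ball b (ρ / 2) := mem_ball_self (by positivity)
  have hline : ∀ ζ ∈ sphere (0 : ℂ) r, J (b + ζ • v) ≠ 0 := by
    intro ζ hζ h
    have hζr : ‖ζ‖ = r := by simpa using hζ
    have hm := hmem b hbb ζ hζr.le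
    have hg0 := hJg _ (hρs hm).2 h
    have := happ _ (hρs hm).1 _ (hρs (mem_ball_self hρ)).1
    rw [hg0, hgb, add_sub_cancel_left, sub_zero, zero_sub, norm_neg, map_smul, norm_smul, norm_smul, hζr] at this
    have h2 : (c : ℝ) * (r * ‖v‖) ≤ r * (γ / 2) := by
      calc (c : ℝ) * (r * ‖v‖) = r * (c * ‖v‖) := by ring
        _ ≤ _ := by gcongr
    nlinarith
  have hJc : ContinuousOn J B := hJ.continuousOn
  obtain ⟨δ, hδ, hδs⟩ : ∃ δ : ℝ, 0 < δ ∧ ∀ ζ ∈ sphere (0:ℂ) r, δ ≤ ‖J (b + ζ • v)‖ := by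
    have hc : ContinuousOn (fun ζ : ℂ => ‖J (b + ζ • v)‖) (sphere 0 r) := by
      refine ContinuousOn.norm (hJc.comp (by fun_prop) ?_)
      intro ζ hζ
      exact (hρs (hmem b hbb ζ (by simpa using (mem_sphere.1 hζ).le))).2
    obtain ⟨z, hz, hmin⟩ := (isCompact_sphere (0:ℂ) r).exists_isMinOn (NormedSpace.sphere_nonempty.2 hr.le) hc
    exact ⟨_, norm_pos_iff.2 (hline z hz), hmin⟩
  have hev1 : ∀ᶠ w in 𝓝 b, ∀ ζ ∈ sphere (0:ℂ) r, δ / 2 < ‖J (w + ζ • v)‖ := by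
    refine (isCompact_sphere (0:ℂ) r).eventually_forall_of_forall_eventually ?_
    intro ζ hζ
    have hbz := (hρs (hmem b hbb ζ (by simpa using (mem_sphere.1 hζ).le))).2
    have h1 : ContinuousAt (fun p : E × ℂ => ‖J (p.1 + p.2 • v)‖) (b, ζ) := by
      refine ContinuousAt.norm (ContinuousAt.comp (g := J) (f := fun p : E × ℂ => p.1 + p.2 • v) ?_ (by fun_prop))
      exact hJc.continuousAt (hB.mem_nhds hbz)
    exact h1.eventually (lt_mem_nhds (by linarith [hδs ζ hζ]))
  have hev2 : ∀ᶠ w in 𝓝 b, ‖J w‖ < δ / 2 := by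
    have h1 : ContinuousAt (fun w => ‖J w‖) b := (hJc.continuousAt (hB.mem_nhds hb)).norm
    exact h1.eventually (gt_mem_nhds (by show ‖J b‖ < δ / 2; rw [hJb, norm_zero]; positivity))
  have hev : ∀ᶠ w in 𝓝 b, ∃ ζ : ℂ, ‖ζ‖ ≤ r ∧ w + ζ • v ∈ ball b ρ ∧ J (w + ζ • v) = 0 := by
    filter_upwards [hev1, hev2, ball_mem_nhds b (half_pos hρ)] with w h1 h2 h3
    obtain ⟨ζ, hζ, hz⟩ := exists_zero_of_small_center (φ := fun ζ : ℂ => J (w + ζ • v)) (c := 0) (δ := δ / 2) hr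
      (by
        refine DifferentiableOn.comp hJ (by fun_prop) ?_
        intro ζ hζ
        exact (hρs (hmem w h3 ζ (by simpa using hζ))).2)
      (by simpa using h2) (fun ζ hζ => (h1 ζ hζ).le)
    have : ‖ζ‖ ≤ r := by simpa using (mem_ball.1 hζ).le
    exact ⟨ζ, this, hmem w h3 ζ this, hz⟩
  obtain ⟨σ, hσ, hσb⟩ := Metric.eventually_nhds_iff_ball.1 hev
  obtain ⟨s0, hs0, hs0u⟩ : ∃ s0 : ℝ, 0 < s0 ∧ s0 * ‖u‖ < σ := by
    refine ⟨σ / (‖u‖ + 1), by positivity, ?_⟩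
    rw [div_mul_eq_mul_div, div_lt_iff₀ (by positivity)]
    nlinarith [norm_nonneg u]
  have hex : ∀ s : ℝ, ∃ ζ : ℂ, s ∈ Icc 0 s0 → 
      (b + (s : ℂ) • u + ζ • v ∈ ball b ρ ∧ J (b + (s : ℂ) • u + ζ • v) = 0) := by
    intro s
    by_cases hs : s ∈ Icc 0 s0
    · obtain ⟨ζ, -, h⟩ := hσb (b + (s : ℂ) • u) (by
        rw [mem_ball, dist_eq_norm, add_sub_cancel_left, norm_smul, Complex.norm_real, 
          Real.norm_of_nonneg hs.1]
        exact lt_of_le_of_lt (by gcongr; exact hs.2) hs0u)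
      exact ⟨ζ, fun _ => h⟩
    · exact ⟨0, fun h => absurd h hs⟩
  choose ζ hζ using hex
  set p : ℝ → E := fun s => b + (s : ℂ) • u + ζ s • v with hp
  have hpB : ∀ s ∈ Icc 0 s0, p s ∈ B := fun s hs => (hρs (hζ s hs).1).2
  have hdiffp : ∀ s t, p s - p t = ((s - t : ℝ) : ℂ) • u + (ζ s - ζ t) • v := by
    intro s t
    simp only [hp, ofReal_sub, sub_smul]; abel
  have hlip : ∃ C : ℝ, 0 ≤ C ∧ ∀ s ∈ Icc 0 s0, ∀ t ∈ Icc 0 s0, ‖p s - p t‖ ≤ C * |s - t| := by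
    refine ⟨‖u‖ + (2 * c * ‖u‖ / γ) * ‖v‖, by positivity, fun s hs t ht => ?_⟩
    have h1 := happ _ (hρs (hζ s hs).1).1 _ (hρs (hζ t ht).1).1
    have h2 : g (p s) = 0 := hJg _ (hpB s hs) (hζ s hs).2
    have h3 : g (p t) = 0 := hJg _ (hpB t ht) (hζ t ht).2
    change ‖g (p s) - g (p t) - g' (p s - p t)‖ ≤ c * ‖p s - p t‖ at h1
    have h4 : ‖p s - p t‖ ≤ |s - t| * ‖u‖ + ‖ζ s - ζ t‖ * ‖v‖ := by
      rw [hdiffp]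
      refine (norm_add_le _ _).trans ?_
      rw [norm_smul, norm_smul, Complex.norm_real, Real.norm_eq_abs]
    have h5 : g' (p s - p t) = (ζ s - ζ t) * g' v := by
      rw [hdiffp, map_add, map_smul, map_smul, hu]; simp
    rw [h2, h3, sub_zero, zero_sub, norm_neg, h5, norm_mul, ← hγdef] at h1
    have h6 : ‖ζ s - ζ t‖ * γ ≤ c * (|s - t| * ‖u‖) + ‖ζ s - ζ t‖ * (γ / 2) := by
      calc _ ≤ c * ‖p s - p t‖ := h1
        _ ≤ c * (|s - t| * ‖u‖ + ‖ζ s - ζ t‖ * ‖v‖) := by gcongr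
        _ = c * (|s - t| * ‖u‖) + ‖ζ s - ζ t‖ * (c * ‖v‖) := by ring
        _ ≤ _ := by gcongr
    have h7 : ‖ζ s - ζ t‖ ≤ (2 * c * ‖u‖ / γ) * |s - t| := by
      rw [div_mul_eq_mul_div, le_div_iff₀ hγ]
      nlinarith
    calc _ ≤ _ := h4
      _ ≤ |s - t| * ‖u‖ + ((2 * c * ‖u‖ / γ) * |s - t|) * ‖v‖ := by gcongr
      _ = _ := by ring
  obtain ⟨C, hC, hlip⟩ := hlip
  have hder : ∀ s ∈ Icc 0 s0, HasDerivWithinAt (fun s => f (p s)) 0 (Icc 0 s0) s := by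
    intro s hs
    have hfd : HasFDerivAt f (0 : E →L[ℂ] E) (p s) := by
      rw [← hJf _ (hpB s hs) (hζ s hs).2]
      exact (hf.differentiableAt (hB.mem_nhds (hpB s hs))).hasFDerivAt
    have hO : (fun t => p t - p s) =O[𝓝[Icc 0 s0] s] fun t => t - s := by
      refine Asymptotics.IsBigO.of_bound C ?_
      filter_upwards [self_mem_nhdsWithin] with t ht
      simpa using hlip t ht s hs
    have htend : Tendsto p (𝓝[Icc 0 s0] s) (𝓝 (p s)) := by
      rw [tendsto_iff_norm_sub_tendsto_zero]
      have : Tendsto (fun t => t - s) (𝓝[Icc 0 s0] s) (𝓝 0) := by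
        have h : Continuous fun t : ℝ => t - s := by fun_prop
        have := (h.tendsto s).mono_left (nhdsWithin_le_nhds (s := Icc 0 s0))
        simpa using this
      simpa using (hO.trans_tendsto this).norm
    rw [hasDerivWithinAt_iff_isLittleO]
    have := ((hasFDerivAt_iff_isLittleO.1 hfd).comp_tendsto htend).trans_isBigO hO
    simpa [Function.comp_def] using this
  have hconst := constant_of_derivWithin_zero (fun s hs => (hder s hs).differentiableWithinAt)
    (fun s hs => (hder s (Ico_subset_Icc_self hs)).derivWithin 
      (uniqueDiffOn_Icc hs0 s (Ico_subset_Icc_self hs))) s0 ⟨hs0.le, le_rfl⟩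
  have h0 : (0:ℝ) ∈ Icc 0 s0 := ⟨le_rfl, hs0.le⟩
  have h1 : s0 ∈ Icc 0 s0 := ⟨hs0.le, le_rfl⟩
  have heq := hinj (hpB s0 h1) (hpB 0 h0) hconst
  have h2 : p s0 - p 0 = 0 := sub_eq_zero.2 heq
  rw [hdiffp] at h2
  have h3 := congrArg g' h2
  rw [map_add, map_smul, map_smul, hu, smul_zero, zero_add, map_zero, smul_eq_zero] at h3
  rcases h3 with h3 | h3
  · rw [h3, zero_smul, add_zero, smul_eq_zero] at h2
    rcases h2 with h2 | h2
    · simp at h2; exact hs0.ne' h2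
    · exact hu0 h2
  · exact hgv h3

end Osgood


section Osgood2
open Complex Topology
variable {E : Type} [NormedAddCommGroup E] [NormedSpace ℂ E] [FiniteDimensional ℂ E]

def dirD (v : E) (h : E → ℂ) : E → ℂ := fun x => fderiv ℂ h x v

theorem dirD_iter_diff {B : Set E} (hB : IsOpen B) {J : E → ℂ} (hJ : DifferentiableOn ℂ J B) (v : E) (i : ℕ) :
    DifferentiableOn ℂ ((dirD v)^[i] J) B := by
  induction i with
  | zero => exact hJ
  | succ i ih =>
    rw [Function.iterate_succ_apply']
    exact fderiv_apply_differentiableOn hB ih v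

theorem dirD_iter_line {B : Set E} (hB : IsOpen B) {J : E → ℂ} (hJ : DifferentiableOn ℂ J B) (a v : E) (i : ℕ) :
    ∀ ζ : ℂ, a + ζ • v ∈ B → iteratedDeriv i (fun ζ : ℂ => J (a + ζ • v)) ζ = (dirD v)^[i] J (a + ζ • v) := by
  have hV : IsOpen {ζ : ℂ | a + ζ • v ∈ B} := hB.preimage (by fun_prop)
  induction i with
  | zero => intro ζ _; simp
  | succ i ih =>
    intro ζ hζ
    rw [iteratedDeriv_succ, Function.iterate_succ_apply']
    have h1 : iteratedDeriv i (fun ζ : ℂ => J (a + ζ • v)) =ᶠ[𝓝 ζ] fun ζ => (dirD v)^[i] J (a + ζ • v) := by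
      filter_upwards [hV.mem_nhds hζ] with w hw using ih w hw
    rw [h1.deriv_eq]
    have h2 := ((dirD_iter_diff hB hJ v i).differentiableAt (hB.mem_nhds hζ)).hasFDerivAt
    have h3 : HasDerivAt (fun ζ : ℂ => a + ζ • v) v ζ := by
      simpa using ((hasDerivAt_id ζ).smul_const v).const_add a
    exact (h2.comp_hasDerivAt ζ h3).deriv

theorem diffOn_prod {ι : Type} [DecidableEq ι] (u : Finset ι) {g : ι → E → ℂ} {s : Set E} (h : ∀ i, DifferentiableOn ℂ (g i) s) :
    DifferentiableOn ℂ (fun x => ∏ i ∈ u, g i x) s := by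
  induction u using Finset.induction_on with
  | empty => simp
  | insert i u hi ih =>
    simp_rw [Finset.prod_insert hi]
    exact (h i).mul ih

theorem det_fderiv_diff {U : Set E} (hU : IsOpen U) {f : E → E} (hf : DifferentiableOn ℂ f U) :
    DifferentiableOn ℂ (fun x => LinearMap.det (fderiv ℂ f x : E →ₗ[ℂ] E)) U := by
  classical
  let b := Module.finBasis ℂ E
  have h : ∀ x, LinearMap.det (fderiv ℂ f x : E →ₗ[ℂ] E) =
      ∑ σ : Equiv.Perm (Fin (Module.finrank ℂ E)), (Equiv.Perm.sign σ : ℤ) •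
        ∏ i, b.coord (σ i) (fderiv ℂ f x (b i)) := by
    intro x
    rw [← LinearMap.det_toMatrix b, Matrix.det_apply]
    simp [LinearMap.toMatrix_apply, Units.smul_def]
  simp_rw [h]
  refine DifferentiableOn.fun_sum fun σ _ => ?_
  refine DifferentiableOn.const_smul ?_ _
  refine diffOn_prod _ fun i => ?_
  exact ((LinearMap.toContinuousLinearMap (b.coord (σ i))).differentiable.comp_differentiableOn
    (fderiv_apply_differentiableOn hU hf (b i)))

theorem osg_zero {f : E → E} {U : Set E} (hU : IsOpen U) (hdim : 2 ≤ Module.finrank ℂ E)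
    (hf : DifferentiableOn ℂ f U) (hinj : InjOn f U)
    (hdich : ∀ x ∈ U, fderiv ℂ f x = 0 ∨ Function.Injective (fderiv ℂ f x))
    {a : E} (ha : a ∈ U) (h0 : fderiv ℂ f a = 0) : False := by
  classical
  obtain ⟨ρ, hρ, hBU⟩ := Metric.isOpen_iff.1 hU a ha
  set B := ball a ρ with hBdef
  have hB : IsOpen B := isOpen_ball
  set J : E → ℂ := fun x => LinearMap.det (fderiv ℂ f x : E →ₗ[ℂ] E) with hJdef
  have hJ : DifferentiableOn ℂ J B := (det_fderiv_diff hU hf).mono hBU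
  have : Nontrivial E := Module.nontrivial_of_finrank_pos (R := ℂ) (by omega)
  have hJ0 : ∀ x ∈ B, J x = 0 → fderiv ℂ f x = 0 := by
    intro x hx hx0
    rcases hdich x (hBU hx) with h | h
    · exact h
    · exfalso
      have := LinearMap.bot_lt_ker_of_det_eq_zero hx0
      rw [LinearMap.ker_eq_bot.2 h] at this
      exact lt_irrefl _ this
  have hJz : ∀ x, fderiv ℂ f x = 0 → J x = 0 := by
    intro x hx
    simp only [hJdef, hx]
    rw [ContinuousLinearMap.toLinearMap_zero, LinearMap.det_zero]
    exact zero_pow (by omega)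
  have haB : a ∈ B := mem_ball_self hρ
  have hfB := hf.mono hBU
  have hc : ∃ c ∈ B, J c ≠ 0 := by
    by_contra! hcon
    have hcst := fun x (hx : x ∈ B) => hB.is_const_of_fderiv_eq_zero (convex_ball a ρ).isPreconnected hfB
      (fun x hx => hJ0 x hx (hcon x hx)) hx haB
    obtain ⟨v, hv⟩ := exists_ne (0 : E)
    have hv' := norm_pos_iff.2 hv
    have hm : a + ((ρ / 2 / ‖v‖ : ℝ) : ℂ) • v ∈ B := by
      rw [hBdef, mem_ball, dist_eq_norm, add_sub_cancel_left, norm_smul, Complex.norm_real, Real.norm_of_nonneg (by positivity)]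
      field_simp; linarith
    have := hinj (hBU hm) ha (hcst _ hm)
    rw [add_eq_left, smul_eq_zero] at this
    rcases this with h | h
    · have : ρ / 2 / ‖v‖ = 0 := by exact_mod_cast h
      have : 0 < ρ / 2 / ‖v‖ := by positivity
      linarith
    · exact hv h
  obtain ⟨c, hcB, hc⟩ := hc
  have hex : ∃ m, ∃ b ∈ B, J b = 0 ∧ ∃ v, (dirD v)^[m] J b ≠ 0 := by
    by_contra! hcon
    set v := c - a
    have hall := fun m => hcon m a haB (hJz a h0) v
    set V := {ζ : ℂ | a + ζ • v ∈ B}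
    have hV : IsOpen V := hB.preimage (by fun_prop)
    have hVc : Convex ℝ V := by
      have : V = (fun ζ : ℂ => ζ • v) ⁻¹' (ball 0 ρ) := by
        ext ζ; simp [V, B, dist_eq_norm]
      rw [this]
      exact (convex_ball (0 : E) ρ).is_linear_preimage
        ⟨fun x y => add_smul x y v, fun c x => smul_assoc c x v⟩
    set φ := fun ζ : ℂ => J (a + ζ • v)
    have hφd : DifferentiableOn ℂ φ V := hJ.comp (by fun_prop) (fun ζ hζ => hζ)
    have hφ : AnalyticOnNhd ℂ φ V := hφd.analyticOnNhd hV
    have h0V : (0 : ℂ) ∈ V := by simp [V, haB]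
    have h1V : (1 : ℂ) ∈ V := by simp [V, v, hcB]
    have htop : analyticOrderAt φ 0 = ⊤ := by
      rw [ENat.eq_top_iff_forall_ge]
      intro m
      rw [natCast_le_analyticOrderAt_iff_iteratedDeriv_eq_zero (hφ 0 h0V)]
      intro i _
      rw [dirD_iter_line hB hJ a v i 0 h0V]
      simpa using hall i
    rw [analyticOrderAt_eq_top] at htop
    have := hφ.eqOn_zero_of_preconnected_of_eventuallyEq_zero hVc.isPreconnected h0V htop h1V
    apply hc
    simpa [φ, v] using this
  obtain ⟨b, hbB, hJb, v, hv⟩ := Nat.find_spec hex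
  have hmin := fun m (hm : m < Nat.find hex) => Nat.find_min hex hm
  rcases hm : Nat.find hex with _ | m
  · rw [hm] at hv; exact hv hJb
  · rw [hm, Function.iterate_succ_apply'] at hv
    refine osgood_key hB hdim hfB hJ (dirD_iter_diff hB hJ v m) hJ0 ?_ hbB hJb hv (hinj.mono hBU)
    intro x hx hx0
    by_contra hne
    exact hmin m (by omega) ⟨x, hx, hx0, v, hne⟩

end Osgood2


section Osgood3
open Complex Topology

def OsgoodAt (n : ℕ) : Prop := ∀ (E : Type) [NormedAddCommGroup E] [NormedSpace ℂ E] [FiniteDimensional ℂ E],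
  Module.finrank ℂ E = n → ∀ (f : E → E) (U : Set E), IsOpen U → DifferentiableOn ℂ f U → InjOn f U →
    ∀ a ∈ U, Function.Injective (fderiv ℂ f a)

theorem osg_step (n : ℕ) (IH : OsgoodAt n) {E : Type} [NormedAddCommGroup E] [NormedSpace ℂ E] [FiniteDimensional ℂ E]
    (hn : Module.finrank ℂ E = n + 1) {f : E → E} {U : Set E} (hU : IsOpen U) (hf : DifferentiableOn ℂ f U)
    (hinj : InjOn f U) {a : E} (ha : a ∈ U) (hne : fderiv ℂ f a ≠ 0) : Function.Injective (fderiv ℂ f a) := by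
  have : CompleteSpace E := FiniteDimensional.complete ℂ E
  set f' := fderiv ℂ f a with hf'
  obtain ⟨w, hw⟩ : ∃ w, f' w ≠ 0 := by
    by_contra! h
    exact hne (ContinuousLinearMap.ext h)
  obtain ⟨ℓ, hℓ⟩ := SeparatingDual.exists_eq_one (R := ℂ) hw
  set l : E →L[ℂ] ℂ := ℓ.comp f' with hl
  have hlw : l w = 1 := hℓ
  set Θ : E → E := fun x => x + (ℓ (f x) - ℓ (f a) - l (x - a)) • w with hΘ
  have hfs : HasStrictFDerivAt f f' a := holo_strict hU hf ha
  have hΘs : HasStrictFDerivAt Θ (ContinuousLinearMap.id ℂ E) a := by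
    have h1 : HasStrictFDerivAt (fun x => ℓ (f x) - ℓ (f a) - l (x - a)) (ℓ.comp f' - l) a := by
      have h2 : HasStrictFDerivAt (fun x => ℓ (f x)) (ℓ.comp f') a := ℓ.hasStrictFDerivAt.comp a hfs
      have h3 : HasStrictFDerivAt (fun x => l (x - a)) l a := by
        have := l.hasStrictFDerivAt.comp a ((hasStrictFDerivAt_id (𝕜 := ℂ) a).sub_const a)
        simpa using! this
      exact (h2.sub_const _).sub h3
    have h4 := (hasStrictFDerivAt_id (𝕜 := ℂ) a).add (h1.smul_const w)
    have h5 : ContinuousLinearMap.id ℂ E + (ℓ.comp f' - l).smulRight w = ContinuousLinearMap.id ℂ E := by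
      ext x; simp [hl]
    rw [h5] at h4
    exact h4
  have hΘd : DifferentiableOn ℂ Θ U := by
    have h1 : DifferentiableOn ℂ (fun x => ℓ (f x)) U := ℓ.differentiable.comp_differentiableOn hf
    have h2 : Differentiable ℂ (fun x => l (x - a)) := by fun_prop
    exact differentiableOn_id.add (((h1.sub_const _).sub h2.differentiableOn).smul_const w)
  have hΘc : ContDiffAt ℂ 1 Θ a := holo_contDiffAt hU hΘd ha
  have hΘe : HasFDerivAt Θ ((ContinuousLinearEquiv.refl ℂ E : E ≃L[ℂ] E) : E →L[ℂ] E) a := hΘs.hasFDerivAt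
  have hΘa : Θ a = a := by simp [hΘ]
  set g := hΘc.localInverse hΘe one_ne_zero with hg
  have hgc : ContDiffAt ℂ 1 g a := by
    have := hΘc.to_localInverse hΘe one_ne_zero
    rwa [hΘa] at this
  have hge : ∀ᶠ y in 𝓝 a, Θ (g y) = y := by
    have := (hΘc.hasStrictFDerivAt' hΘe one_ne_zero).eventually_right_inverse
    rwa [hΘa] at this
  have hgs : HasStrictFDerivAt g (ContinuousLinearMap.id ℂ E) a := by
    have := (hΘc.hasStrictFDerivAt' hΘe one_ne_zero).to_localInverse
    rwa [hΘa] at this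
  have hga : g a = a := by
    have := (hΘc.hasStrictFDerivAt' hΘe one_ne_zero).localInverse_apply_image
    rw [hΘa] at this
    exact this
  have hgU : ∀ᶠ y in 𝓝 a, g y ∈ U := by
    have := hgs.continuousAt
    apply this
    rw [hga]
    exact hU.mem_nhds ha
  have hgd : ∀ᶠ y in 𝓝 a, DifferentiableAt ℂ g y := 
    (hgc.eventually (by simp)).mono fun y hy => hy.differentiableAt (by simp)
  obtain ⟨ρ, hρ, hball⟩ := Metric.eventually_nhds_iff_ball.1 (hge.and (hgU.and hgd))
  have hkey : ∀ y ∈ ball a ρ, ℓ (f (g y)) = ℓ (f a) + l (y - a) := by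
    intro y hy
    have h1 := congrArg l (hball y hy).1
    simp only [hΘ, map_add, map_smul, hlw, smul_eq_mul, mul_one, map_sub] at h1
    rw [map_sub, ← h1]; ring
  -- kernels
  set H := LinearMap.ker (l : E →ₗ[ℂ] ℂ) with hH
  set H' := LinearMap.ker (ℓ : E →ₗ[ℂ] ℂ) with hH'
  have hl0 : (l : E →ₗ[ℂ] ℂ) ≠ 0 := by
    intro h
    have := LinearMap.congr_fun h w
    simp [hlw] at this
  have hℓ0 : (ℓ : E →ₗ[ℂ] ℂ) ≠ 0 := by
    intro h
    have := LinearMap.congr_fun h (f' w)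
    simp [hℓ] at this
  have hd1 : Module.finrank ℂ H + 1 = Module.finrank ℂ E := Module.Dual.finrank_ker_add_one_of_ne_zero hl0
  have hd2 : Module.finrank ℂ H' + 1 = Module.finrank ℂ E := Module.Dual.finrank_ker_add_one_of_ne_zero hℓ0
  let e : H' ≃ₗ[ℂ] H := LinearEquiv.ofFinrankEq _ _ (by omega)
  obtain ⟨T0, hT0⟩ := LinearMap.exists_extend (e : H' →ₗ[ℂ] H)
  set T : E →L[ℂ] H := LinearMap.toContinuousLinearMap T0
  have hT : ∀ x, ℓ x = 0 → T x = 0 → x = 0 := by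
    intro x hx hTx
    have h1 := LinearMap.congr_fun hT0 ⟨x, hx⟩
    have h2 : T0 x = 0 := hTx
    have h3 : e ⟨x, hx⟩ = 0 := by rw [← h2]; exact h1.symm
    have := (LinearEquiv.map_eq_zero_iff e).1 h3
    exact congrArg Subtype.val this
  set h : H → H := fun u => T (f (g (a + u))) with hh
  set V : Set H := {u : H | a + (u : E) ∈ ball a ρ} with hV
  have hVo : IsOpen V := isOpen_ball.preimage (by fun_prop)
  have hhd : DifferentiableOn ℂ h V := by
    intro u hu
    apply DifferentiableAt.differentiableWithinAt
    refine T.differentiableAt.comp u ?_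
    refine DifferentiableAt.comp (g := f) u (hf.differentiableAt (hU.mem_nhds (hball _ hu).2.1)) ?_
    refine DifferentiableAt.comp (g := g) u (hball _ hu).2.2 ?_
    exact (H.subtypeL.differentiableAt).const_add a
  have hhi : InjOn h V := by
    intro u1 h1 u2 h2 h12
    have h3 : T (f (g (a + u1)) - f (g (a + u2))) = 0 := by
      rw [map_sub, sub_eq_zero]; exact h12
    have h4 : ℓ (f (g (a + u1)) - f (g (a + u2))) = 0 := by
      rw [map_sub, hkey _ h1, hkey _ h2]
      have e1 : l (u1 : E) = 0 := u1.2
      have e2 : l (u2 : E) = 0 := u2.2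
      simp [e1, e2]
    have h5 := sub_eq_zero.1 (hT _ h4 h3)
    have h6 := hinj (hball _ h1).2.1 (hball _ h2).2.1 h5
    have h7 : a + (u1 : E) = a + u2 := by
      rw [← (hball _ h1).1, ← (hball _ h2).1, h6]
    exact Subtype.ext (add_left_cancel h7)
  have hV0 : (0 : H) ∈ V := by simp [hV, hρ]
  have hIH := IH H (by omega) h V hVo hhd hhi 0 hV0
  have hder : HasFDerivAt h (T.comp (f'.comp H.subtypeL)) 0 := by
    have e1 : HasFDerivAt (fun u : H => a + (u : E)) H.subtypeL 0 := (H.subtypeL.hasFDerivAt).const_add a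
    have e2 : HasFDerivAt g (ContinuousLinearMap.id ℂ E) (a + ((0 : H) : E)) := by simpa using hgs.hasFDerivAt
    have e3 := e2.comp (0 : H) e1
    have e4 : HasFDerivAt f f' (g (a + ((0 : H) : E))) := by simpa [hga] using hfs.hasFDerivAt
    have e5 := e4.comp (0 : H) e3
    have e6 := T.hasFDerivAt.comp (0 : H) e5
    simpa using! e6
  rw [hder.fderiv] at hIH
  rw [injective_iff_map_eq_zero]
  intro x hx
  have hxl : l x = 0 := by simp [hl, hx]
  have := (injective_iff_map_eq_zero _).1 hIH ⟨x, hxl⟩ (by simp [hx])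
  exact congrArg Subtype.val this

theorem osgood_all : ∀ n, OsgoodAt n := by
  intro n
  induction n with
  | zero =>
    intro E _ _ _ hn f U hU hf hinj a ha
    have := Module.finrank_zero_iff.1 hn
    exact Function.injective_of_subsingleton _
  | succ n IH =>
    intro E _ _ _ hn f U hU hf hinj a ha
    by_cases h0 : fderiv ℂ f a = 0
    · exfalso
      rcases n with _ | n
      · let e : E ≃L[ℂ] ℂ := ContinuousLinearEquiv.ofFinrankEq (by simp [hn])
        have h1 := osgood_one (f := fun ζ => e (f (e.symm ζ))) (U := e.symm ⁻¹' U) (a := e a)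
          (hU.preimage e.symm.continuous)
          (e.differentiable.comp_differentiableOn (hf.comp e.symm.differentiable.differentiableOn fun x hx => hx))
          (fun x hx y hy hxy => e.symm.injective (hinj hx hy (e.injective hxy)))
          (by simpa using ha)
        apply h1
        have e0 : HasDerivAt (fun ζ : ℂ => e.symm ζ) (e.symm 1) (e a) := 
          (e.symm : ℂ →L[ℂ] E).hasDerivAt
        have e1 : HasFDerivAt f (fderiv ℂ f a) (e.symm (e a)) := by
          simpa using (hf.differentiableAt (hU.mem_nhds ha)).hasFDerivAt
        have e2 := e1.comp_hasDerivAt (e a) e0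
        have e3 := (e : E →L[ℂ] ℂ).hasFDerivAt.comp_hasDerivAt (e a) e2
        have := e3.deriv
        rw [h0] at this
        simpa using! this
      · refine osg_zero hU (by omega) hf hinj ?_ ha h0
        intro x hx
        by_cases hx0 : fderiv ℂ f x = 0
        · exact Or.inl hx0
        · exact Or.inr (osg_step _ IH hn hU hf hinj hx hx0)
    · exact osg_step n IH hn hU hf hinj ha h0

theorem osgood {E : Type} [NormedAddCommGroup E] [NormedSpace ℂ E] [FiniteDimensional ℂ E]
    {f : E → E} (hf : Differentiable ℂ f) (hinj : Function.Injective f) (a : E) : Function.Injective (fderiv ℂ f a) :=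
  osgood_all _ E rfl f univ isOpen_univ hf.differentiableOn (hinj.injOn) a (mem_univ _)

end Osgood3


section Inv
open Complex Topology
variable {E : Type} [NormedAddCommGroup E] [NormedSpace ℂ E] [FiniteDimensional ℂ E]
variable {F : Type} [NormedAddCommGroup F] [NormedSpace ℂ F] [FiniteDimensional ℂ F]

theorem fb_inverse {f : E → E} (hf : Differentiable ℂ f) (hinj : Function.Injective f) :
    ∃ G : E → E, DifferentiableOn ℂ G (range f) ∧ ∀ z, G (f z) = z := by
  have : CompleteSpace E := FiniteDimensional.complete ℂ E
  refine ⟨Function.invFun f, ?_, Function.leftInverse_invFun hinj⟩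
  rintro _ ⟨z, rfl⟩
  have hs : HasStrictFDerivAt f (fderiv ℂ f z) z := holo_strict isOpen_univ hf.differentiableOn (mem_univ z)
  let e : E ≃L[ℂ] E := (LinearEquiv.ofInjectiveEndo (fderiv ℂ f z : E →ₗ[ℂ] E) (osgood hf hinj z)).toContinuousLinearEquiv
  have he : (e : E →L[ℂ] E) = fderiv ℂ f z := by
    ext x; rfl
  rw [← he] at hs
  have := hs.to_local_left_inverse (g := Function.invFun f) (Eventually.of_forall (Function.leftInverse_invFun hinj))
  exact this.hasFDerivAt.differentiableAt.differentiableWithinAt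

theorem loc_lip {g : E → F} {Ω K : Set E} (hΩ : IsOpen Ω) (hg : DifferentiableOn ℂ g Ω) (hK : IsCompact K) (hKΩ : K ⊆ Ω) :
    ∃ L δ : ℝ, 0 < L ∧ 0 < δ ∧ ∀ x ∈ K, ∀ y, ‖y - x‖ < δ → y ∈ Ω ∧ ‖g y - g x‖ ≤ L * ‖y - x‖ := by
  have : ProperSpace E := FiniteDimensional.proper ℂ E
  obtain ⟨δ, hδ, hsub⟩ := hK.exists_cthickening_subset_open hΩ hKΩ
  have hc : IsCompact (cthickening δ K) := hK.cthickening
  have hcont : ContinuousOn (fderiv ℂ g) (cthickening δ K) := 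
    (fderiv_differentiableOn hΩ hg).continuousOn.mono hsub
  obtain ⟨C, hC⟩ := hc.exists_bound_of_continuousOn hcont
  refine ⟨max C 1, δ, by positivity, hδ, fun x hx y hy => ?_⟩
  have hball : ball x δ ⊆ cthickening δ K := by
    refine (ball_subset_thickening hx δ).trans (thickening_subset_cthickening _ _)
  have hyb : y ∈ ball x δ := by rwa [mem_ball, dist_eq_norm]
  refine ⟨hsub (hball hyb), ?_⟩
  exact (convex_ball x δ).norm_image_sub_le_of_norm_fderiv_le (𝕜 := ℂ)
    (fun z hz => hg.differentiableAt (hΩ.mem_nhds (hsub (hball hz))))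
    (fun z hz => (hC z (hball hz)).trans (le_max_left _ _)) (mem_ball_self hδ) hyb

theorem lip_ball {g : E → F} (hg : Differentiable ℂ g) (R : ℝ) :
    ∃ L : ℝ, 0 ≤ L ∧ ∀ x ∈ closedBall (0 : E) R, ∀ y ∈ closedBall (0 : E) R, ‖g y - g x‖ ≤ L * ‖y - x‖ := by
  have : ProperSpace E := FiniteDimensional.proper ℂ E
  have hcont : ContinuousOn (fderiv ℂ g) (closedBall (0 : E) R) := 
    (fderiv_differentiableOn isOpen_univ hg.differentiableOn).continuousOn.mono (subset_univ _)
  obtain ⟨C, hC⟩ := (isCompact_closedBall (0 : E) R).exists_bound_of_continuousOn hcont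
  refine ⟨max C 0, le_max_right _ _, fun x hx y hy => ?_⟩
  exact (convex_closedBall (0 : E) R).norm_image_sub_le_of_norm_fderiv_le (𝕜 := ℂ)
    (fun z hz => hg z) (fun z hz => (hC z hz).trans (le_max_left _ _)) hx hy

theorem taylor_ball {g : E → F} (hg : Differentiable ℂ g) (R : ℝ) :
    ∃ M : ℝ, 0 ≤ M ∧ ∀ x ∈ closedBall (0 : E) R, ∀ y ∈ closedBall (0 : E) R,
      ‖g y - g x - fderiv ℂ g x (y - x)‖ ≤ M * ‖y - x‖ ^ 2 := by
  have hd : Differentiable ℂ (fderiv ℂ g) := 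
    differentiableOn_univ.1 (fderiv_differentiableOn isOpen_univ hg.differentiableOn)
  obtain ⟨L, hL, hLip⟩ := lip_ball hd R
  refine ⟨L, hL, fun x hx y hy => ?_⟩
  have hconv := (convex_closedBall (0 : E) R).inter (convex_closedBall x ‖y - x‖)
  have := hconv.norm_image_sub_le_of_norm_fderiv_le' (𝕜 := ℂ) (f := g) (φ := fderiv ℂ g x) (C := L * ‖y - x‖)
    (fun z hz => hg z) (fun z hz => (hLip x hx z hz.1).trans (by
      have := mem_closedBall.1 hz.2
      rw [dist_eq_norm] at this
      gcongr)) (x := x) (y := y) ⟨hx, by simp⟩ ⟨hy, by simp [dist_eq_norm]⟩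
  refine this.trans (le_of_eq (by ring))

end Inv


section Auto
variable {k : ℕ}
local notation "Ec" => EuclideanSpace ℂ (Fin k)

theorem auto_id : IsAutomorphism (fun x : Ec => x) :=
  ⟨differentiable_id, fun x => x, differentiable_id, fun _ => rfl, fun _ => rfl⟩

theorem auto_comp {f g : Ec → Ec} (hf : IsAutomorphism f) (hg : IsAutomorphism g) :
    IsAutomorphism (fun x => f (g x)) := by
  obtain ⟨hf1, f', hf2, hf3, hf4⟩ := hf
  obtain ⟨hg1, g', hg2, hg3, hg4⟩ := hg
  exact ⟨hf1.comp hg1, fun x => g' (f' x), hg2.comp hf2, fun x => by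
    show g' (f' (f (g x))) = x
    rw [hf3, hg3], fun x => by
    show f (g (g' (f' x))) = x
    rw [hg4, hf4]⟩

theorem auto_iter {f : Ec → Ec} (hf : IsAutomorphism f) (n : ℕ) : IsAutomorphism (f^[n]) := by
  induction n with
  | zero => exact auto_id
  | succ n ih =>
    rw [Function.iterate_succ']
    exact auto_comp (f := f) hf ih

def Good (P : Ec → Ec) : Prop :=
  Differentiable ℂ P ∧ ∃ S : ℂ → Ec → Ec, (∀ τ, IsAutomorphism (S τ)) ∧
    ∀ R : ℝ, ∃ C : ℝ, 0 ≤ C ∧ ∀ x τ, ‖x‖ ≤ R → ‖τ‖ ≤ R → ‖S τ x - x - τ • P x‖ ≤ C * ‖τ‖ ^ 2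

theorem good_zero : Good (0 : Ec → Ec) :=
  ⟨differentiable_const _, fun _ x => x, fun _ => auto_id, fun R => ⟨0, le_rfl, fun x τ _ _ => by simp⟩⟩

theorem good_smul (c : ℂ) {P : Ec → Ec} (hP : Good P) : Good (c • P) := by
  obtain ⟨hd, S, hS, hb⟩ := hP
  refine ⟨hd.const_smul c, fun τ => S (c * τ), fun τ => hS _, fun R => ?_⟩
  obtain ⟨C, hC, hCb⟩ := hb (max R (‖c‖ * R))
  refine ⟨C * ‖c‖ ^ 2, by positivity, fun x τ hx hτ => ?_⟩
  have := hCb x (c * τ) (hx.trans (le_max_left _ _)) (by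
    rw [norm_mul]
    exact (mul_le_mul_of_nonneg_left hτ (norm_nonneg _)).trans (le_max_right _ _))
  simp only [Pi.smul_apply]
  rw [smul_smul, mul_comm τ c]
  refine this.trans (le_of_eq ?_)
  rw [norm_mul]; ring

theorem good_add {P Q : Ec → Ec} (hP : Good P) (hQ : Good Q) : Good (P + Q) := by
  obtain ⟨hd1, S1, hS1, hb1⟩ := hP
  obtain ⟨hd2, S2, hS2, hb2⟩ := hQ
  refine ⟨hd1.add hd2, fun τ x => S2 τ (S1 τ x), fun τ => auto_comp (hS2 τ) (hS1 τ), fun R => ?_⟩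
  rcases lt_or_ge R 0 with hR | hR
  · refine ⟨0, le_rfl, fun x τ hx _ => ?_⟩
    linarith [norm_nonneg x]
  obtain ⟨C1, hC1, h1⟩ := hb1 R
  obtain ⟨M0, hM0⟩ := (isCompact_closedBall (0 : Ec) R).exists_bound_of_continuousOn hd1.continuous.continuousOn
  set M := max M0 0
  have hM : ∀ x : Ec, ‖x‖ ≤ R → ‖P x‖ ≤ M := fun x hx => (hM0 x (by simpa using hx)).trans (le_max_left _ _)
  have hMn : 0 ≤ M := le_max_right _ _
  set R2 := R + R * (M + C1 * R) with hR2
  have hRR2 : R ≤ R2 := by rw [hR2]; nlinarith [mul_nonneg hR (add_nonneg hMn (mul_nonneg hC1 hR))]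
  obtain ⟨C2, hC2, h2⟩ := hb2 R2
  obtain ⟨L, hL, hLip⟩ := lip_ball hd2 R2
  refine ⟨C1 + C2 + L * (M + C1 * R), by positivity, fun x τ hx hτ => ?_⟩
  set y := S1 τ x with hy
  have e1 := h1 x τ hx hτ
  have hyx : ‖y - x‖ ≤ ‖τ‖ * (M + C1 * R) := by
    have : y - x = (y - x - τ • P x) + τ • P x := by abel
    rw [this]
    refine (norm_add_le _ _).trans ?_
    rw [norm_smul]
    have := hM x hx
    have h3 : C1 * ‖τ‖ ^ 2 ≤ ‖τ‖ * (C1 * R) := by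
      have : C1 * ‖τ‖ ^ 2 = ‖τ‖ * (C1 * ‖τ‖) := by ring
      rw [this]; gcongr
    have h4 : ‖τ‖ * ‖P x‖ ≤ ‖τ‖ * M := by gcongr
    linarith
  have hyR : ‖y‖ ≤ R2 := by
    have : y = x + (y - x) := by abel
    rw [this]
    refine (norm_add_le _ _).trans ?_
    have : ‖τ‖ * (M + C1 * R) ≤ R * (M + C1 * R) := by gcongr
    linarith
  have e2 := h2 y τ hyR (hτ.trans hRR2)
  have e3 := hLip x (by simpa using hx.trans hRR2) y (by simpa using hyR)
  have e4 : ‖τ • (Q y - Q x)‖ ≤ L * (M + C1 * R) * ‖τ‖ ^ 2 := by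
    rw [norm_smul]
    calc ‖τ‖ * ‖Q y - Q x‖ ≤ ‖τ‖ * (L * (‖τ‖ * (M + C1 * R))) := by gcongr; exact e3.trans (by gcongr)
      _ = _ := by ring
  have : S2 τ y - x - τ • (P + Q) x = (S2 τ y - y - τ • Q y) + (y - x - τ • P x) + τ • (Q y - Q x) := by
    simp only [Pi.add_apply, smul_add, smul_sub]; abel
  rw [this]
  refine (norm_add₃_le).trans ?_
  linarith

theorem good_shear {h : Ec → ℂ} (hd : Differentiable ℂ h) (v : Ec) (hv : ∀ x (t : ℂ), h (x + t • v) = h x) :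
    Good (fun x => h x • v) := by
  refine ⟨hd.smul_const v, fun τ x => x + (τ * h x) • v, fun τ => ?_, fun R => ⟨0, le_rfl, fun x τ _ _ => ?_⟩⟩
  · refine ⟨differentiable_id.add ((hd.const_mul τ).smul_const v), fun x => x + (-(τ * h x)) • v,
      differentiable_id.add ((hd.const_mul τ).neg.smul_const v), fun x => ?_, fun x => ?_⟩
    · simp only [hv]; rw [add_assoc, ← add_smul]; simp
    · simp only [hv]; rw [add_assoc, ← add_smul]; simp
  · simp [smul_smul]

theorem good_overshear {h : Ec → ℂ} (hd : Differentiable ℂ h) (v : Ec) (hv : ∀ x (t : ℂ), h (x + t • v) = h x)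
    (μ : Ec →L[ℂ] ℂ) (hμ : μ v = 1) :
    Good (fun x => (h x * μ x) • v) := by
  have hdS : ∀ τ : ℂ, Differentiable ℂ (fun x : Ec => x + ((Complex.exp (τ * h x) - 1) * μ x) • v) := fun τ =>
    differentiable_id.add ((((hd.const_mul τ).cexp.sub_const 1).mul μ.differentiable).smul_const v)
  have hinv : ∀ (τ : ℂ) (x : Ec), (fun x : Ec => x + ((Complex.exp (-τ * h x) - 1) * μ x) • v)
      (x + ((Complex.exp (τ * h x) - 1) * μ x) • v) = x := by
    intro τ x
    simp only [hv, map_add, map_smul, hμ, smul_eq_mul, mul_one]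
    rw [add_assoc, ← add_smul]
    have : (Complex.exp (τ * h x) - 1) * μ x + (Complex.exp (-τ * h x) - 1) * (μ x + (Complex.exp (τ * h x) - 1) * μ x) = 0 := by
      have h1 : Complex.exp (-τ * h x) * Complex.exp (τ * h x) = 1 := by
        rw [← Complex.exp_add]; simp
      linear_combination (μ x) * h1
    rw [this]; simp
  refine ⟨(hd.mul μ.differentiable).smul_const v, fun τ x => x + ((Complex.exp (τ * h x) - 1) * μ x) • v, fun τ => ?_, fun R => ?_⟩
  · refine ⟨hdS τ, fun x => x + ((Complex.exp (-τ * h x) - 1) * μ x) • v, hdS (-τ), hinv τ, fun x => ?_⟩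
    simpa using hinv (-τ) x
  · obtain ⟨M0, hM0⟩ := (isCompact_closedBall (0 : Ec) R).exists_bound_of_continuousOn hd.continuous.continuousOn
    set M := max M0 0
    have hM : ∀ x : Ec, ‖x‖ ≤ R → ‖h x‖ ≤ M := fun x hx => (hM0 x (by simpa using hx)).trans (le_max_left _ _)
    have hMn : 0 ≤ M := le_max_right _ _
    rcases lt_or_ge R 0 with hR | hR
    · refine ⟨0, le_rfl, fun x τ hx _ => ?_⟩
      linarith [norm_nonneg x]
    refine ⟨M ^ 2 * Real.exp (R * M) * (‖μ‖ * R) * ‖v‖, by positivity, fun x τ hx hτ => ?_⟩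
    have e1 : x + ((Complex.exp (τ * h x) - 1) * μ x) • v - x - τ • (h x * μ x) • v =
        ((Complex.exp (τ * h x) - 1 - τ * h x) * μ x) • v := by
      rw [add_sub_cancel_left, smul_smul, ← sub_smul]; ring_nf
    rw [e1, norm_smul, norm_mul]
    have e2 : ‖Complex.exp (τ * h x) - 1 - τ * h x‖ ≤ ‖τ * h x‖ ^ 2 * Real.exp ‖τ * h x‖ := by
      have := Complex.norm_exp_sub_sum_le_norm_mul_exp (τ * h x) 2
      simp [Finset.sum_range_succ] at this
      rw [sub_sub]; simpa using this
    have e3 : ‖τ * h x‖ ≤ ‖τ‖ * M := by rw [norm_mul]; gcongr; exact hM x hx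
    have e3' : ‖τ * h x‖ ≤ R * M := e3.trans (by gcongr)
    have e4 : ‖μ x‖ ≤ ‖μ‖ * R := (μ.le_opNorm x).trans (by gcongr)
    calc _ ≤ ((‖τ‖ * M) ^ 2 * Real.exp (R * M)) * (‖μ‖ * R) * ‖v‖ := by
          gcongr
          exact e2.trans (by gcongr)
      _ = _ := by ring

def goodSub (k : ℕ) : Submodule ℂ (EuclideanSpace ℂ (Fin k) → EuclideanSpace ℂ (Fin k)) where
  carrier := {P | Good P}
  add_mem' := good_add
  zero_mem' := good_zero
  smul_mem' c _ h := good_smul c h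

end Auto

section Alg
open Polynomial
variable {R : Type} [CommRing R] [Algebra ℂ R]

theorem coeff_mem_of_eval (W : Submodule ℂ (R × R)) (P Q : R[X])
    (h : ∀ s : ℂ, (P.eval (algebraMap ℂ R s), Q.eval (algebraMap ℂ R s)) ∈ W) (b : ℕ) :
    (P.coeff b, Q.coeff b) ∈ W := by
  rw [← Submodule.Quotient.mk_eq_zero, ← Module.forall_dual_apply_eq_zero_iff ℂ]
  intro φ
  set N := max P.natDegree Q.natDegree + 1 with hN
  set p : ℂ[X] := ∑ i ∈ Finset.range N, C (φ (W.mkQ (P.coeff i, Q.coeff i))) * X ^ i with hp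
  have hp0 : p = 0 := by
    apply Polynomial.funext
    intro s
    have h1 : (P.eval (algebraMap ℂ R s), Q.eval (algebraMap ℂ R s)) =
        ∑ i ∈ Finset.range N, s ^ i • (P.coeff i, Q.coeff i) := by
      rw [Polynomial.eval_eq_sum_range' (n := N) (by omega), Polynomial.eval_eq_sum_range' (n := N) (by omega)]
      ext
      · simp only [Prod.smul_mk, Prod.fst_sum]
        simp only [Algebra.smul_def, map_pow]
        exact Finset.sum_congr rfl fun i _ => mul_comm _ _
      · simp only [Prod.smul_mk, Prod.snd_sum]
        simp only [Algebra.smul_def, map_pow]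
        exact Finset.sum_congr rfl fun i _ => mul_comm _ _
    have h2 : φ (W.mkQ (P.eval (algebraMap ℂ R s), Q.eval (algebraMap ℂ R s))) = 0 := by
      rw [(Submodule.Quotient.mk_eq_zero W).2 (h s) |> (fun h => (h : W.mkQ _ = 0)), map_zero]
    rw [h1, map_sum, map_sum] at h2
    simp only [map_smul, smul_eq_mul] at h2
    rw [hp, eval_finset_sum, eval_zero, ← h2]
    refine Finset.sum_congr rfl fun i _ => ?_
    rw [eval_mul, eval_C, eval_pow, eval_X, mul_comm]
  rcases lt_or_ge b N with hb | hb
  · have h3 : p.coeff b = φ (W.mkQ (P.coeff b, Q.coeff b)) := by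
      rw [hp, finset_sum_coeff]
      simp only [coeff_C_mul, coeff_X_pow]
      simp [hb]
    rw [hp0, coeff_zero] at h3
    exact h3.symm
  · rw [coeff_eq_zero_of_natDegree_lt (by omega), coeff_eq_zero_of_natDegree_lt (by omega)]
    exact map_zero φ

theorem al_alg (W : Submodule ℂ (R × R)) (x y q : R)
    (hU : ∀ (s : ℂ) (n : ℕ), (algebraMap ℂ R s * (q * (x + algebraMap ℂ R s * y) ^ n), -(q * (x + algebraMap ℂ R s * y) ^ n)) ∈ W)
    (hT : ∀ (s : ℂ) (n : ℕ), (algebraMap ℂ R s * (q * (x + algebraMap ℂ R s * y) ^ n * y), -(q * (x + algebraMap ℂ R s * y) ^ n * y)) ∈ W)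
    (a b : ℕ) : (q * x ^ a * y ^ b, (0 : R)) ∈ W := by
  set n := a + b with hn
  set p : ℕ → R[X] := fun n => C q * (C x + X * C y) ^ n with hp
  have hpe : ∀ n (s : ℂ), (p n).eval (algebraMap ℂ R s) = q * (x + algebraMap ℂ R s * y) ^ n := by
    intro n s; simp only [hp, eval_mul, eval_C, eval_pow, eval_X, eval_add]
  have hpd : derivative (p n) = (n : R[X]) * (p (n - 1) * C y) := by
    simp only [hp, derivative_mul, derivative_C, derivative_pow, derivative_add, derivative_X, zero_mul, zero_add, one_mul, mul_zero, add_zero, Polynomial.C_eq_natCast]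
    ring
  have hU' : ∀ b, ((X * p n).coeff b, (-(p n)).coeff b) ∈ W := coeff_mem_of_eval W _ _ fun s => by
    simpa [hpe] using hU s n
  have hUd : ∀ s : ℂ, ((derivative (X * p n)).eval (algebraMap ℂ R s), (derivative (-(p n))).eval (algebraMap ℂ R s)) ∈ W := by
    intro s
    set N := max (derivative (X * p n)).natDegree (derivative (-(p n))).natDegree + 1 with hN
    rw [Polynomial.eval_eq_sum_range' (n := N) (by omega), Polynomial.eval_eq_sum_range' (n := N) (by omega)]
    have : (∑ i ∈ Finset.range N, (derivative (X * p n)).coeff i * algebraMap ℂ R s ^ i, 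
        ∑ i ∈ Finset.range N, (derivative (-(p n))).coeff i * algebraMap ℂ R s ^ i) = 
        ∑ i ∈ Finset.range N, (s ^ i * ((i : ℂ) + 1)) • ((X * p n).coeff (i + 1), (-(p n)).coeff (i + 1)) := by
      ext
      · simp only [Prod.smul_mk, Prod.fst_sum]
        simp only [Algebra.smul_def, map_pow, map_mul, map_add, map_one, map_natCast, coeff_derivative]
        exact Finset.sum_congr rfl fun i _ => by ring
      · simp only [Prod.smul_mk, Prod.snd_sum]
        simp only [Algebra.smul_def, map_pow, map_mul, map_add, map_one, map_natCast, coeff_derivative]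
        exact Finset.sum_congr rfl fun i _ => by ring
    rw [this]
    exact W.sum_mem fun i _ => W.smul_mem _ (hU' _)
  have hfin : ∀ b, ((p n).coeff b, (0 : R[X]).coeff b) ∈ W := by
    refine coeff_mem_of_eval W _ _ fun s => ?_
    have h1 := W.sub_mem (hUd s) (W.smul_mem (n : ℂ) (hT s (n - 1)))
    convert h1 using 1
    ext
    · simp only [derivative_mul, derivative_X, hpd, Prod.fst_sub, Prod.smul_fst, Algebra.smul_def]
      simp [hpe]
      ring
    · simp only [derivative_neg, hpd, Prod.snd_sub, Prod.smul_snd, Algebra.smul_def]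
      simp [hpe]
  have hc := hfin b
  have hcoef : (p n).coeff b = ((n.choose b : ℕ) : ℂ) • (q * x ^ a * y ^ b) := by
    simp only [hp, coeff_C_mul]
    rw [add_comm, add_pow, finset_sum_coeff]
    rw [Finset.sum_eq_single b]
    · have h1 : (X * C y : R[X]) ^ b * C x ^ (n - b) * (n.choose b : R[X]) = C (y ^ b * x ^ a * (n.choose b : R)) * X ^ b := by
        rw [hn, Nat.add_sub_cancel]
        simp only [map_mul, map_pow, map_natCast]; ring
      rw [h1, coeff_C_mul, coeff_X_pow, if_pos rfl, Algebra.smul_def, map_natCast]; ring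
    · intro i _ hi
      have h1 : (X * C y : R[X]) ^ i * C x ^ (n - i) * (n.choose i : R[X]) = C (y ^ i * x ^ (n - i) * (n.choose i : R)) * X ^ i := by
        simp only [map_mul, map_pow, map_natCast]; ring
      rw [h1, coeff_C_mul, coeff_X_pow, if_neg (Ne.symm hi), mul_zero]
    · intro hb
      exact absurd (Finset.mem_range.2 (by omega)) hb
  rw [hcoef] at hc
  have hne : ((n.choose b : ℕ) : ℂ) ≠ 0 := by
    exact_mod_cast (Nat.choose_pos (by omega)).ne'
  have h2 := W.smul_mem (((n.choose b : ℕ) : ℂ)⁻¹) hc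
  convert h2 using 1
  ext
  · simp [smul_smul, inv_mul_cancel₀ hne]
  · simp

end Alg


section PolyGood
variable {k : ℕ}
local notation "Ec" => EuclideanSpace ℂ (Fin k)

def fld (i j : Fin k) : ((Ec → ℂ) × (Ec → ℂ)) →ₗ[ℂ] (Ec → Ec) where
  toFun p := fun x => p.1 x • EuclideanSpace.single i (1 : ℂ) + p.2 x • EuclideanSpace.single j (1 : ℂ)
  map_add' p q := by
    funext x
    simp only [Prod.fst_add, Prod.snd_add, Pi.add_apply, add_smul]
    abel
  map_smul' c p := by
    funext x
    simp [smul_smul, smul_add]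

theorem diff_coord (i : Fin k) : Differentiable ℂ (fun x : Ec => x i) :=
  (EuclideanSpace.proj (𝕜 := ℂ) i).differentiable

theorem mono_good (i j : Fin k) (hij : i ≠ j) (q : Ec → ℂ) (hq : Differentiable ℂ q)
    (hqi : ∀ x (s t : ℂ), q (x + (s • EuclideanSpace.single i (1 : ℂ) + t • EuclideanSpace.single j (1 : ℂ))) = q x) (a b : ℕ) :
    Good (fun x : Ec => (q x * x i ^ a * x j ^ b) • EuclideanSpace.single i (1 : ℂ)) := by
  have key := al_alg ((goodSub k).comap (fld i j)) (fun x : Ec => x i) (fun x : Ec => x j) q ?_ ?_ a b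
  · have h : Good (fld i j (q * (fun x : Ec => x i) ^ a * (fun x : Ec => x j) ^ b, 0)) := key
    convert h using 1
    funext x
    simp [fld]
  · intro s n
    show Good (fld i j _)
    have hd : Differentiable ℂ (fun x : Ec => q x * (x i + s * x j) ^ n) :=
      hq.mul (((diff_coord i).add ((diff_coord j).const_mul s)).pow n)
    have := good_shear hd (s • EuclideanSpace.single i (1 : ℂ) - EuclideanSpace.single j (1 : ℂ)) (by
      intro x t
      have h1 : t • (s • EuclideanSpace.single i (1 : ℂ) - EuclideanSpace.single j (1 : ℂ)) =
        (t * s) • EuclideanSpace.single i (1 : ℂ) + (-t) • EuclideanSpace.single j (1 : ℂ) := by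
        rw [smul_sub, smul_smul, neg_smul, sub_eq_add_neg]
      rw [h1, hqi]
      congr 2
      simp [hij, hij.symm]
      ring)
    convert this using 1
    funext x
    simp [fld, smul_sub, smul_smul, sub_eq_add_neg]
    rw [mul_comm s]
  · intro s n
    show Good (fld i j _)
    have hd : Differentiable ℂ (fun x : Ec => -(q x * (x i + s * x j) ^ n)) :=
      (hq.mul (((diff_coord i).add ((diff_coord j).const_mul s)).pow n)).neg
    have := good_overshear hd (s • EuclideanSpace.single i (1 : ℂ) - EuclideanSpace.single j (1 : ℂ)) (by
      intro x t
      have h1 : t • (s • EuclideanSpace.single i (1 : ℂ) - EuclideanSpace.single j (1 : ℂ)) =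
        (t * s) • EuclideanSpace.single i (1 : ℂ) + (-t) • EuclideanSpace.single j (1 : ℂ) := by
        rw [smul_sub, smul_smul, neg_smul, sub_eq_add_neg]
      rw [h1, hqi]
      congr 3
      simp [hij, hij.symm]
      ring) (-EuclideanSpace.proj (𝕜 := ℂ) j) (by simp [hij, hij.symm])
    convert this using 1
    funext x
    simp [fld, smul_sub, smul_smul, sub_eq_add_neg]
    rw [mul_comm s]

theorem eval_good (hk : 2 ≤ k) (i : Fin k) (P : MvPolynomial (Fin k) ℂ) :
    Good (fun x : Ec => (MvPolynomial.eval (fun l => x l) P) • EuclideanSpace.single i (1 : ℂ)) := by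
  have : Nontrivial (Fin k) := Fin.nontrivial_iff_two_le.2 hk
  obtain ⟨j, hj⟩ := exists_ne i
  induction P using MvPolynomial.induction_on' with
  | monomial m c =>
    have h := mono_good i j hj.symm (fun x : Ec => c * ∏ l ∈ (Finset.univ.erase i).erase j, x l ^ m l) ?_ ?_ (m i) (m j)
    · convert h using 1
      funext x
      congr 1
      rw [MvPolynomial.eval_monomial, Finsupp.prod_fintype _ _ (by simp)]
      rw [← Finset.mul_prod_erase Finset.univ _ (Finset.mem_univ i), ← Finset.mul_prod_erase (Finset.univ.erase i) _ (Finset.mem_erase.2 ⟨hj, Finset.mem_univ j⟩)]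
      ring
    · refine Differentiable.const_mul ?_ c
      rw [← differentiableOn_univ]
      exact diffOn_prod _ fun l => ((diff_coord l).pow _).differentiableOn
    · intro x s t
      simp only
      congr 1
      refine Finset.prod_congr rfl fun l hl => ?_
      simp only [Finset.mem_erase] at hl
      simp [hl.1, hl.2.1]
  | add p q hp hq =>
    have := good_add hp hq
    convert this using 1
    funext x
    simp [add_smul]

theorem poly_good (hk : 2 ≤ k) (P : Fin k → MvPolynomial (Fin k) ℂ) :
    Good (fun x : Ec => WithLp.toLp 2 (fun i => MvPolynomial.eval (fun l => x l) (P i))) := by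
  have : (fun x : Ec => (WithLp.toLp 2 (fun i => MvPolynomial.eval (fun l => x l) (P i)) : Ec)) =
      ∑ i, fun x : Ec => (MvPolynomial.eval (fun l => x l) (P i)) • EuclideanSpace.single i (1 : ℂ) := by
    funext x
    ext l
    simp [Finset.sum_apply, Pi.single_apply]
  rw [this]
  exact (goodSub k).sum_mem fun i _ => eval_good hk i (P i)

end PolyGood


section Approx
open Topology
variable {k : ℕ}
local notation "Ec" => EuclideanSpace ℂ (Fin k)

theorem euclid_norm_le_sum (v : Ec) : ‖v‖ ≤ ∑ i, ‖v i‖ := by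
  have : v = ∑ i, v i • EuclideanSpace.single i (1 : ℂ) := by
    ext l
    simp [Finset.sum_apply, Pi.single_apply]
  conv_lhs => rw [this]
  refine (norm_sum_le _ _).trans (le_of_eq ?_)
  refine Finset.sum_congr rfl fun i _ => ?_
  rw [norm_smul]; simp

theorem runge_vec (hk : 2 ≤ k) {Ω : Set Ec} (hR : IsRunge Ω) {W : Ec → Ec} (hW : DifferentiableOn ℂ W Ω)
    {K : Set Ec} (hK : IsCompact K) (hKΩ : K ⊆ Ω) {η : ℝ} (hη : 0 < η) :
    ∃ P : Fin k → MvPolynomial (Fin k) ℂ, ∀ z ∈ K,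
      ‖W z - WithLp.toLp 2 (fun i => MvPolynomial.eval (fun l => z l) (P i))‖ ≤ η := by
  have hk0 : (0 : ℝ) < k := by exact_mod_cast (by omega : 0 < k)
  have h : ∀ i : Fin k, ∃ P : MvPolynomial (Fin k) ℂ, ∀ z ∈ K, ‖W z i - MvPolynomial.eval (fun l => z l) P‖ < η / k := by
    intro i
    exact hR (fun z => W z i) ((diff_coord i).comp_differentiableOn hW) K hKΩ hK _ (by positivity)
  choose P hP using h
  refine ⟨P, fun z hz => ?_⟩
  refine (euclid_norm_le_sum _).trans ?_
  calc _ ≤ ∑ i : Fin k, η / k := by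
        refine Finset.sum_le_sum fun i _ => ?_
        have := (hP i z hz).le
        simpa using this
    _ = η := by simp; field_simp

theorem start_lemma {Ω : Set Ec} (hΩo : IsOpen Ω) {F G : Ec → Ec} (hF : Differentiable ℂ F)
    (hrange : range F = Ω) (hG : DifferentiableOn ℂ G Ω) (hGF : ∀ z, G (F z) = z)
    {R ε : ℝ} (hR : 0 < R) (hε : 0 < ε) :
    ∃ s0 > 0, ∀ s : ℝ, 0 < s → s < s0 → ∃ A : Ec → Ec, IsAutomorphism A ∧
      ∀ z, ‖z‖ ≤ R → A z ∈ Ω ∧ ‖G (A z) - s • z‖ ≤ ε * s := by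
  have hinj : Function.Injective F := Function.LeftInverse.injective hGF
  have h0 : F 0 ∈ Ω := hrange ▸ mem_range_self 0
  set F' := fderiv ℂ F 0 with hF'
  let e : Ec ≃L[ℂ] Ec := (LinearEquiv.ofInjectiveEndo (F' : Ec →ₗ[ℂ] Ec) (osgood hF hinj 0)).toContinuousLinearEquiv
  have he : ∀ x, e x = F' x := fun x => rfl
  have hGd := (hG.differentiableAt (hΩo.mem_nhds h0)).hasFDerivAt
  set D := fderiv ℂ G (F 0)
  have hDF : ∀ x, D (F' x) = x := by
    have h1 := hGd.comp 0 (hF 0).hasFDerivAt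
    have h2 : G ∘ F = id := funext hGF
    rw [h2] at h1
    have := h1.unique (hasFDerivAt_id 0)
    intro x
    exact congrArg (fun T : Ec →L[ℂ] Ec => T x) this
  set B := ‖F'‖ * R + 1 with hB
  have hBp : 0 < B := by positivity
  have hev := (hGd.isLittleO.def (c := ε / B) (by positivity)).and (hΩo.mem_nhds h0)
  obtain ⟨δ, hδ, hball⟩ := Metric.eventually_nhds_iff_ball.1 hev
  refine ⟨δ / B, by positivity, fun s hs hs0 => ⟨fun z => F 0 + (s : ℂ) • e z, ?_, ?_⟩⟩
  · have hsc : (s : ℂ) ≠ 0 := by exact_mod_cast hs.ne'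
    refine ⟨((e.differentiable).const_smul (s : ℂ)).const_add (F 0), fun y => e.symm ((s : ℂ)⁻¹ • (y - F 0)), ?_, ?_, ?_⟩
    · have h1 : Differentiable ℂ (fun y : Ec => (s : ℂ)⁻¹ • (y - F 0)) := by fun_prop
      exact e.symm.differentiable.comp h1
    · intro z
      show e.symm ((s : ℂ)⁻¹ • (F 0 + (s : ℂ) • e z - F 0)) = z
      rw [add_sub_cancel_left, smul_smul, inv_mul_cancel₀ hsc, one_smul, ContinuousLinearEquiv.symm_apply_apply]
    · intro y
      show F 0 + (s : ℂ) • e (e.symm ((s : ℂ)⁻¹ • (y - F 0))) = y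
      rw [ContinuousLinearEquiv.apply_symm_apply, smul_smul, mul_inv_cancel₀ hsc, one_smul, add_sub_cancel]
  · intro z hz
    have hw : ‖(s : ℂ) • e z‖ ≤ s * (‖F'‖ * R) := by
      rw [norm_smul, Complex.norm_real, Real.norm_of_nonneg hs.le, he]
      gcongr
      exact (F'.le_opNorm z).trans (by gcongr)
    have hw2 : ‖(s : ℂ) • e z‖ ≤ s * B := hw.trans (by rw [hB]; gcongr; linarith)
    have hm : F 0 + (s : ℂ) • e z ∈ ball (F 0) δ := by
      rw [mem_ball, dist_eq_norm, add_sub_cancel_left]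
      have : s * B < δ := (lt_div_iff₀ hBp).1 hs0
      linarith
    obtain ⟨h1, h2⟩ := hball _ hm
    refine ⟨h2, ?_⟩
    rw [hGF, sub_zero, add_sub_cancel_left, map_smul, he, hDF] at h1
    have hss : s • z = (s : ℂ) • z := (Complex.coe_smul s z).symm
    rw [hss]
    refine h1.trans ?_
    calc ε / B * ‖(s : ℂ) • e z‖ ≤ ε / B * (s * B) := by gcongr
      _ = ε * s := by field_simp

theorem step_lemma (hk : 2 ≤ k) {Ω : Set Ec} (hΩo : IsOpen Ω) (hRu : IsRunge Ω) {F G : Ec → Ec} (hF : Differentiable ℂ F)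
    (hrange : range F = Ω) (hG : DifferentiableOn ℂ G Ω) (hGF : ∀ z, G (F z) = z)
    {R θ : ℝ} (hR : 0 < R) (hθ : 0 < θ) :
    ∃ τ0 > 0, ∀ τ : ℝ, 0 < τ → τ ≤ τ0 → ∃ S : Ec → Ec, IsAutomorphism S ∧
      ∀ z, ‖z‖ ≤ R → S (F z) ∈ Ω ∧ ‖G (S (F z)) - (1 + τ) • z‖ ≤ τ * θ := by
  set K' := F '' closedBall 0 (2 * R) with hK'
  have hKc : IsCompact K' := (isCompact_closedBall _ _).image hF.continuous
  have hKΩ : K' ⊆ Ω := by rw [← hrange]; exact image_subset_range _ _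
  obtain ⟨L, δ, hL, hδ, hlip⟩ := loc_lip hΩo hG hKc hKΩ
  set η := min (θ / (2 * L)) (δ / 4) with hη
  have hηp : 0 < η := by rw [hη]; positivity
  have hF'd : Differentiable ℂ (fderiv ℂ F) :=
    differentiableOn_univ.1 (fderiv_differentiableOn isOpen_univ hF.differentiableOn)
  have hW : DifferentiableOn ℂ (fun y => fderiv ℂ F (G y) (G y)) Ω :=
    (hF'd.comp_differentiableOn hG).clm_apply hG
  obtain ⟨P, hP⟩ := runge_vec hk hRu hW hKc hKΩ hηp
  obtain ⟨_, S, hS, hSb⟩ := poly_good hk P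
  obtain ⟨Rb, hRb⟩ := hKc.isBounded.exists_norm_le
  obtain ⟨C, hC, hCb⟩ := hSb (max Rb 1)
  obtain ⟨M, hM, hMb⟩ := taylor_ball hF (2 * R)
  have hden : 0 < C + M * R ^ 2 + 1 := by positivity
  refine ⟨min 1 (η / (C + M * R ^ 2 + 1)), by positivity, fun τ hτ hτ0 => ⟨S τ, hS τ, fun z hz => ?_⟩⟩
  have hτ1 : τ ≤ 1 := hτ0.trans (min_le_left _ _)
  have hτ2 : (C + M * R ^ 2) * τ ≤ η := by
    have := (le_div_iff₀ hden).1 (hτ0.trans (min_le_right _ _))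
    nlinarith
  have hzb : z ∈ closedBall (0 : Ec) (2 * R) := by simp; linarith
  have hss : (1 + τ) • z = z + (τ : ℂ) • z := by
    rw [add_smul, one_smul, Complex.coe_smul]
  have hnτ : ‖(τ : ℂ)‖ = τ := by rw [Complex.norm_real, Real.norm_of_nonneg hτ.le]
  have hzb2 : (1 + τ) • z ∈ closedBall (0 : Ec) (2 * R) := by
    simp only [mem_closedBall, dist_zero_right]
    rw [norm_smul, Real.norm_of_nonneg (by linarith)]
    nlinarith [norm_nonneg z]
  have hFz : F z ∈ K' := mem_image_of_mem _ hzb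
  have e1 := hCb (F z) (τ : ℂ) ((hRb _ hFz).trans (le_max_left _ _)) (by rw [hnτ]; exact hτ1.trans (le_max_right _ _))
  have e2 := hP (F z) hFz
  have e3 := hMb z hzb _ hzb2
  simp only [hGF] at e2
  set p : Ec := WithLp.toLp 2 (fun i => MvPolynomial.eval (fun l => (F z) l) (P i)) with hp
  have hd : (1 + τ) • z - z = (τ : ℂ) • z := by rw [hss]; abel
  rw [hd, map_smul, norm_smul, hnτ] at e3
  rw [hnτ] at e1
  have e3' : ‖F ((1 + τ) • z) - F z - (τ : ℂ) • fderiv ℂ F z z‖ ≤ M * R ^ 2 * τ ^ 2 := by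
    refine e3.trans ?_
    have : (τ * ‖z‖) ^ 2 ≤ (τ * R) ^ 2 := by gcongr
    calc _ ≤ M * (τ * R) ^ 2 := by gcongr
      _ = _ := by ring
  have e2' : ‖(τ : ℂ) • (fderiv ℂ F z z - p)‖ ≤ τ * η := by
    rw [norm_smul, hnτ]; gcongr
  have etot : ‖S τ (F z) - F ((1 + τ) • z)‖ ≤ 2 * η * τ := by
    have : S τ (F z) - F ((1 + τ) • z) = (S τ (F z) - F z - (τ : ℂ) • p) - (τ : ℂ) • (fderiv ℂ F z z - p)
        - (F ((1 + τ) • z) - F z - (τ : ℂ) • fderiv ℂ F z z) := by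
      rw [smul_sub]; abel
    rw [this]
    have h1 := norm_sub_le ((S τ (F z) - F z - (τ : ℂ) • p) - (τ : ℂ) • (fderiv ℂ F z z - p)) (F ((1 + τ) • z) - F z - (τ : ℂ) • fderiv ℂ F z z)
    have h2 := norm_sub_le (S τ (F z) - F z - (τ : ℂ) • p) ((τ : ℂ) • (fderiv ℂ F z z - p))
    have h3 : (C + M * R ^ 2) * τ * τ ≤ η * τ := by gcongr
    nlinarith
  have hη1 : η ≤ θ / (2 * L) := min_le_left _ _
  have hη2 : η ≤ δ / 4 := min_le_right _ _
  have hη1' : 2 * L * η ≤ θ := by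
    rw [le_div_iff₀ (by positivity)] at hη1
    linarith
  obtain ⟨h1, h2⟩ := hlip (F ((1 + τ) • z)) (mem_image_of_mem _ hzb2) (S τ (F z)) (by nlinarith)
  refine ⟨h1, ?_⟩
  rw [hGF] at h2
  refine h2.trans ?_
  calc L * ‖S τ (F z) - F ((1 + τ) • z)‖ ≤ L * (2 * η * τ) := by gcongr
    _ = τ * (2 * L * η) := by ring
    _ ≤ τ * θ := by gcongr

theorem approx_lemma (hk : 2 ≤ k) {Ω : Set Ec} (hΩo : IsOpen Ω) (hRu : IsRunge Ω) {F G : Ec → Ec} (hF : Differentiable ℂ F)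
    (hrange : range F = Ω) (hG : DifferentiableOn ℂ G Ω) (hGF : ∀ z, G (F z) = z)
    {R ε : ℝ} (hR : 0 < R) (hε : 0 < ε) :
    ∃ Ψ : Ec → Ec, IsAutomorphism Ψ ∧ ∀ z, ‖z‖ ≤ R → Ψ z ∈ Ω ∧ ‖G (Ψ z) - z‖ ≤ ε := by
  have hFG : ∀ y ∈ Ω, F (G y) = y := by
    intro y hy
    rw [← hrange] at hy
    obtain ⟨z, rfl⟩ := hy
    rw [hGF]
  wlog hε1 : ε ≤ 1 generalizing ε
  · obtain ⟨Ψ, h1, h2⟩ := this (ε := 1) one_pos le_rfl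
    exact ⟨Ψ, h1, fun z hz => ⟨(h2 z hz).1, (h2 z hz).2.trans (not_le.1 hε1).le⟩⟩
  obtain ⟨s0, hs0, hstart⟩ := start_lemma hΩo hF hrange hG hGF hR (half_pos hε)
  set T := 1 / s0 with hT
  have hTp : 0 < T := by positivity
  set θ := ε / (2 * Real.exp T * T) with hθ
  have hθp : 0 < θ := by positivity
  obtain ⟨τ0, hτ0, hstep⟩ := step_lemma hk hΩo hRu hF hrange hG hGF (R := R + 1) (by linarith) hθp
  obtain ⟨N, hN⟩ := exists_nat_gt (T / τ0)
  have hNp : (0 : ℝ) < N := lt_of_le_of_lt (by positivity) hN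
  set τ := T / N with hτ
  have hτp : 0 < τ := by positivity
  have hττ0 : τ ≤ τ0 := by
    rw [hτ, div_le_iff₀ hNp]
    rw [div_lt_iff₀ hτ0] at hN
    linarith
  have hNτ : N * τ = T := by rw [hτ]; field_simp
  set Λ := (1 + τ) ^ N with hΛ
  have hΛp : 0 < Λ := by positivity
  have hΛ1 : 1 + T ≤ Λ := by
    rw [← hNτ]; exact one_add_mul_le_pow (by linarith) N
  have hΛ2 : Λ ≤ Real.exp T := by
    rw [← hNτ, Real.exp_nat_mul]
    have := Real.add_one_le_exp τ
    rw [hΛ]; gcongr; linarith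
  have hss : Λ⁻¹ < s0 := by
    rw [inv_lt_comm₀ hΛp hs0, ← one_div]
    linarith
  obtain ⟨A, hA, hAb⟩ := hstart Λ⁻¹ (by positivity) hss
  obtain ⟨S, hS, hSb⟩ := hstep τ hτp hττ0
  refine ⟨fun z => S^[N] (A z), auto_comp (auto_iter hS N) hA, fun z hz => ?_⟩
  obtain ⟨hy0, hz0⟩ := hAb z hz
  set z0 := G (A z) with hz0d
  have hz0' : ‖Λ • z0 - z‖ ≤ ε / 2 := by
    have : Λ • z0 - z = Λ • (z0 - Λ⁻¹ • z) := by
      rw [smul_sub, smul_smul, mul_inv_cancel₀ hΛp.ne', one_smul]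
    rw [this, norm_smul, Real.norm_of_nonneg hΛp.le]
    calc _ ≤ Λ * (ε / 2 * Λ⁻¹) := by gcongr
      _ = ε / 2 := by field_simp
  have hz0n : Λ * ‖z0‖ ≤ R + ε / 2 := by
    have : Λ * ‖z0‖ = ‖(Λ • z0 - z) + z‖ := by
      rw [sub_add_cancel, norm_smul, Real.norm_of_nonneg hΛp.le]
    rw [this]
    refine (norm_add_le _ _).trans ?_
    linarith
  have hΛT : Λ * (T * θ) ≤ ε / 2 := by
    calc Λ * (T * θ) ≤ Real.exp T * (T * θ) := by gcongr
      _ = ε / 2 := by rw [hθ]; field_simp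
  have hind : ∀ j : ℕ, j ≤ N → S^[j] (A z) ∈ Ω ∧ ‖G (S^[j] (A z)) - (1 + τ) ^ j • z0‖ ≤ (1 + τ) ^ j * (j * τ * θ) := by
    intro j
    induction j with
    | zero => intro _; exact ⟨hy0, by simp [hz0d]⟩
    | succ j ih =>
      intro hj
      obtain ⟨i1, i2⟩ := ih (by omega)
      set zj := G (S^[j] (A z)) with hzj
      have hjN : (j : ℝ) * τ * θ ≤ T * θ := by
        rw [← hNτ]
        have : (j : ℝ) ≤ N := by exact_mod_cast (by omega : j ≤ N)
        gcongr
      have hpow : (1 + τ) ^ j ≤ Λ := pow_le_pow_right₀ (by linarith) (by omega)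
      have hzn : ‖zj‖ ≤ R + 1 := by
        have e1 : zj = (zj - (1 + τ) ^ j • z0) + (1 + τ) ^ j • z0 := by abel
        have e2 : ‖zj‖ ≤ (1 + τ) ^ j * (j * τ * θ) + (1 + τ) ^ j * ‖z0‖ := by
          conv_lhs => rw [e1]
          refine (norm_add_le _ _).trans ?_
          rw [norm_smul, Real.norm_of_nonneg (by positivity)]
          linarith
        have e3 : (1 + τ) ^ j * (j * τ * θ) ≤ Λ * (T * θ) := by gcongr
        have e4 : (1 + τ) ^ j * ‖z0‖ ≤ Λ * ‖z0‖ := by gcongr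
        linarith
      obtain ⟨s1, s2⟩ := hSb zj hzn
      rw [hFG _ i1] at s1 s2
      rw [Function.iterate_succ_apply']
      refine ⟨s1, ?_⟩
      have e1 : G (S (S^[j] (A z))) - (1 + τ) ^ (j + 1) • z0 = (G (S (S^[j] (A z))) - (1 + τ) • zj) + (1 + τ) • (zj - (1 + τ) ^ j • z0) := by
        rw [smul_sub, smul_smul, pow_succ, mul_comm ((1 + τ) ^ j)]; abel
      rw [e1]
      refine (norm_add_le _ _).trans ?_
      rw [norm_smul, Real.norm_of_nonneg (by positivity)]
      have e2 : (1 + τ) * ‖zj - (1 + τ) ^ j • z0‖ ≤ (1 + τ) * ((1 + τ) ^ j * (j * τ * θ)) := by gcongr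
      have e3 : (1 : ℝ) ≤ (1 + τ) ^ (j + 1) := one_le_pow₀ (by linarith)
      have e4 : τ * θ ≤ (1 + τ) ^ (j + 1) * (τ * θ) := le_mul_of_one_le_left (by positivity) e3
      push_cast
      calc _ ≤ (1 + τ) ^ (j + 1) * (τ * θ) + (1 + τ) * ((1 + τ) ^ j * (j * τ * θ)) := by linarith
        _ = _ := by ring
  obtain ⟨f1, f2⟩ := hind N le_rfl
  refine ⟨f1, ?_⟩
  rw [hNτ] at f2
  have : G (S^[N] (A z)) - z = (G (S^[N] (A z)) - Λ • z0) + (Λ • z0 - z) := by abel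
  show ‖G (S^[N] (A z)) - z‖ ≤ ε
  rw [this]
  refine (norm_add_le _ _).trans ?_
  linarith

end Approx


section Final
variable {k : ℕ}
local notation "Ec" => EuclideanSpace ℂ (Fin k)

theorem solve_near {g : Ec → Ec} {r ε : ℝ} (hε : 0 < ε) (hε1 : ε ≤ 1 / 4)
    (hg : DifferentiableOn ℂ g (ball 0 (r + 2))) (hb : ∀ z ∈ ball (0 : Ec) (r + 2), ‖g z - z‖ ≤ ε)
    {w : Ec} (hw : ‖w‖ ≤ r) : ∃ z, ‖z - w‖ ≤ ε ∧ g z = w := by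
  set q : Ec → Ec := fun z => g z - z with hq
  have hqd : DifferentiableOn ℂ q (ball 0 (r + 2)) := hg.sub differentiableOn_id
  have hfd : ∀ z ∈ ball (0 : Ec) (r + 1), ‖fderiv ℂ q z‖ ≤ 1 / 4 := by
    intro z hz
    have hsub : ball z 1 ⊆ ball 0 (r + 2) := by
      apply ball_subset_ball'
      have := mem_ball.1 hz
      linarith
    have := fderiv_cauchy one_pos (hqd.mono hsub) (fun y hy => hb y (hsub hy))
    linarith [this, div_one ε]
  have hlip : ∀ x ∈ ball (0 : Ec) (r + 1), ∀ y ∈ ball (0 : Ec) (r + 1), ‖q y - q x‖ ≤ 1 / 4 * ‖y - x‖ := by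
    intro x hx y hy
    exact (convex_ball (0 : Ec) (r + 1)).norm_image_sub_le_of_norm_fderiv_le (𝕜 := ℂ)
      (fun z hz => hqd.differentiableAt (isOpen_ball.mem_nhds (ball_subset_ball (by linarith) hz))) hfd hx hy
  have hsub : closedBall w ε ⊆ ball (0 : Ec) (r + 1) := by
    intro z hz
    rw [mem_closedBall, dist_eq_norm] at hz
    rw [mem_ball, dist_zero_right]
    have : ‖z‖ ≤ ‖z - w‖ + ‖w‖ := by simpa using norm_add_le (z - w) w
    linarith
  have hmaps : MapsTo (fun z => w - q z) (closedBall w ε) (closedBall w ε) := by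
    intro z hz
    rw [mem_closedBall, dist_eq_norm]
    have := hb z (ball_subset_ball (by linarith) (hsub hz))
    rw [sub_sub_cancel_left, norm_neg]
    exact this
  have hcontr : ContractingWith (1 / 4) (hmaps.restrict (fun z => w - q z) _ _) := by
    refine ⟨by rw [← NNReal.coe_lt_coe]; norm_num, ?_⟩
    refine LipschitzWith.of_dist_le_mul fun x y => ?_
    rw [Subtype.dist_eq, Subtype.dist_eq, dist_eq_norm, dist_eq_norm]
    simp only [MapsTo.val_restrict_apply, sub_sub_sub_cancel_left]
    rw [norm_sub_rev (x : Ec)]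
    have := hlip x (hsub x.2) y (hsub y.2)
    simpa using this
  obtain ⟨z, hz, hfix, -⟩ := hcontr.exists_fixedPoint' (isClosed_closedBall.isComplete) hmaps
    (mem_closedBall_self hε.le) (edist_ne_top _ _)
  refine ⟨z, by simpa [dist_eq_norm] using hz, ?_⟩
  have h1 : w - (g z - z) = z := hfix
  have h2 : w - g z = 0 := by
    have : w - g z = w - (g z - z) - z := by abel
    rw [this, h1, sub_self]
  exact (sub_eq_zero.1 h2).symm

end Final

theorem pushing_complement_of_Runge_FB_domain_away (k : ℕ) (hk : 2 ≤ k)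
    (Ω : Set (EuclideanSpace ℂ (Fin k))) (hΩ : IsFBDomain Ω) (hR : IsRunge Ω)
    (K : Set (EuclideanSpace ℂ (Fin k))) (hK : IsCompact K) (hKΩ : K ⊆ Ω)
    (U : Set (EuclideanSpace ℂ (Fin k))) (hU : IsOpen U)
    (hUb : Bornology.IsBounded U) (hKU : K ⊆ U)
    (ε : ℝ) (hε : 0 < ε) :
    ∃ Φ : EuclideanSpace ℂ (Fin k) → EuclideanSpace ℂ (Fin k),
      IsAutomorphism Φ ∧ (∀ z ∈ K, ‖Φ z - z‖ < ε) ∧ Φ '' Ωᶜ ∩ U = ∅ := by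
  obtain ⟨hΩo, -, F, hF, hinj, hrange⟩ := hΩ
  obtain ⟨G, hG, hGF⟩ := fb_inverse hF hinj
  rw [hrange] at hG
  have hFG : ∀ y ∈ Ω, F (G y) = y := by
    intro y hy
    rw [← hrange] at hy
    obtain ⟨z, rfl⟩ := hy
    rw [hGF]
  obtain ⟨r0, hr0⟩ := hK.exists_bound_of_continuousOn (hG.continuousOn.mono hKΩ)
  set r := max r0 0 with hr
  have hrn : 0 ≤ r := le_max_right _ _
  have hrK : ∀ y ∈ K, ‖G y‖ ≤ r := fun y hy => (hr0 y hy).trans (le_max_left _ _)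
  obtain ⟨L, hL, hLip⟩ := lip_ball hF (r + 2)
  set ε' := min (1 / 4) (ε / (4 * (L + 1))) with hε'
  have hε'p : 0 < ε' := by rw [hε']; positivity
  have hε'1 : ε' ≤ 1 / 4 := min_le_left _ _
  have hε'2 : L * (2 * ε') < ε := by
    have : ε' ≤ ε / (4 * (L + 1)) := min_le_right _ _
    rw [le_div_iff₀ (by positivity)] at this
    nlinarith
  obtain ⟨A, hA, hAb⟩ := approx_lemma hk hΩo hR hF hrange hG hGF (R := r + 2) (by linarith) hε'p
  obtain ⟨A', hA'd, hA'l, hA'r⟩ := hA.2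
  obtain ⟨Rb, hRb⟩ := (hUb.isCompact_closure).exists_bound_of_continuousOn (hA'd.continuous.continuousOn)
  set RB := max Rb (r + 2) with hRB
  obtain ⟨Ψ, hΨ, hΨb⟩ := approx_lemma hk hΩo hR hF hrange hG hGF (R := RB)
    (lt_of_lt_of_le (by linarith) (le_max_right _ _)) hε'p
  have hΨ0 := hΨ
  obtain ⟨hΨd, Ψ', hΨ'd, hΨ'l, hΨ'r⟩ := hΨ
  refine ⟨fun y => A (Ψ' y), auto_comp hA ⟨hΨ'd, Ψ, hΨd, hΨ'r, hΨ'l⟩, ?_, ?_⟩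
  · intro y hy
    have hball : ∀ z ∈ ball (0 : EuclideanSpace ℂ (Fin k)) (r + 2), ‖z‖ ≤ RB := by
      intro z hz
      rw [mem_ball, dist_zero_right] at hz
      exact hz.le.trans (le_max_right _ _)
    obtain ⟨z, hz1, hz2⟩ := solve_near (g := fun z => G (Ψ z)) (r := r) hε'p hε'1
      (hG.comp hΨd.differentiableOn fun z hz => (hΨb z (hball z hz)).1)
      (fun z hz => (hΨb z (hball z hz)).2) (hrK y hy)
    have hzr : ‖z‖ ≤ r + 1 := by
      have : ‖z‖ ≤ ‖z - G y‖ + ‖G y‖ := by simpa using norm_add_le (z - G y) (G y)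
      linarith [hrK y hy]
    have hΨz : Ψ z = y := by
      have h1 := (hΨb z (hzr.trans (le_trans (by linarith) (le_max_right _ _)))).1
      rw [← hFG _ h1, ← hFG y (hKΩ hy)]
      exact congrArg F hz2
    have hz : Ψ' y = z := by rw [← hΨz, hΨ'l]
    obtain ⟨a1, a2⟩ := hAb z (by linarith)
    show ‖A (Ψ' y) - y‖ < ε
    rw [hz]
    set u := G (A z) with hu
    have hur : ‖u‖ ≤ r + 2 := by
      have : ‖u‖ ≤ ‖u - z‖ + ‖z‖ := by simpa using norm_add_le (u - z) z
      linarith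
    have huw : ‖u - G y‖ ≤ 2 * ε' := by
      have : ‖u - G y‖ ≤ ‖u - z‖ + ‖z - G y‖ := by simpa using norm_add_le (u - z) (z - G y)
      linarith
    have h1 := hLip (G y) (by simpa using (hrK y hy).trans (by linarith)) u (by simpa using hur)
    rw [hFG _ a1, hFG _ (hKΩ hy)] at h1
    calc _ ≤ L * ‖u - G y‖ := h1
      _ ≤ L * (2 * ε') := by gcongr
      _ < ε := hε'2
  · rw [Set.eq_empty_iff_forall_notMem]
    rintro _ ⟨⟨y, hy, rfl⟩, hyU⟩
    apply hy
    have h1 : ‖Ψ' y‖ ≤ Rb := by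
      have := hRb _ (subset_closure hyU)
      simpa [hA'l (Ψ' y)] using this
    have h2 := (hΨb (Ψ' y) (h1.trans (le_max_left _ _))).1
    rwa [hΨ'r y] at h2
end
end
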